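/- arXiv:2004.00157 — 4 statements merged into one kernel-verified Lean document; each statement's English description precedes it below -/
import Mathlib

section
/- Let q ∈ (2,∞] and M ≥ 0, and let W : B₂ → ℂ² be measurable with ‖W‖_{L^q(B₂)} ≤ M. Let u ∈ C²(B₂,ℂ) satisfy Δu = W·∇u almost everywhere in B₂, with ‖u‖_{L^∞(B₂)} ≤ Ĉ and ‖∇u‖_{L²(B₁)} ≥ ĉ for some constants 0 < ĉ ≤ 1 ≤ Ĉ. Set μ = 2q/(q−2) (with μ = 2 when q = ∞). Then there exist a constant C = C(q) > 0, a universal constant c > 0, and a threshold r* > 0 such that for every 0 < r ≤ r*: ‖∇u‖_{L²(B_r)} ≥ r^{C(1+M^{μ}) + c·log[CĈ(1+M)/ĉ]}. -/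
open MeasureTheory Metric Complex ENNReal

noncomputable section

def pdx (u : ℂ → ℂ) (z : ℂ) : ℂ := fderiv ℝ u z 1

def pdy (u : ℂ → ℂ) (z : ℂ) : ℂ := fderiv ℝ u z Complex.I

def lap (u : ℂ → ℂ) (z : ℂ) : ℂ := pdx (pdx u) z + pdy (pdy u) z

def gradLen (u : ℂ → ℂ) (z : ℂ) : ℝ := Real.sqrt (‖pdx u z‖ ^ 2 + ‖pdy u z‖ ^ 2)

/-- Euclidean length of a `ℂ²`-valued field. -/
def pairLen (W : ℂ → ℂ × ℂ) (z : ℂ) : ℝ := Real.sqrt (‖(W z).1‖ ^ 2 + ‖(W z).2‖ ^ 2)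

/-- `W·∇u = W¹ ∂ₓu + W² ∂_y u` for a `ℂ²`-valued field `W`. -/
def wDot (W : ℂ → ℂ × ℂ) (u : ℂ → ℂ) (z : ℂ) : ℂ :=
  (W z).1 * pdx u z + (W z).2 * pdy u z

/-- Continuous differentiable functions with compact support have symmetric mixed energy:
the integral of the Jacobian vanishes. -/
lemma integral_fderiv_mul_fderiv_comm {a b : ℂ → ℝ} (ha : ContDiff ℝ 1 a) (hb : ContDiff ℝ 1 b)
    (hac : HasCompactSupport a) (hbc : HasCompactSupport b) (v w : ℂ) :
    ∫ z, fderiv ℝ a z v * fderiv ℝ b z w = ∫ z, fderiv ℝ a z w * fderiv ℝ b z v := by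
  have cont : ∀ {f : ℂ → ℝ} (y : ℂ), ContDiff ℝ 1 f → Continuous fun z => fderiv ℝ f z y :=
    fun y hf => (hf.continuous_fderiv one_ne_zero).clm_apply continuous_const
  have int : ∀ {f : ℂ → ℝ} (y : ℂ), ContDiff ℝ 1 f → HasCompactSupport f →
      Integrable fun z => fderiv ℝ f z y :=
    fun y hf hfc => (cont y hf).integrable_of_hasCompactSupport (hfc.fderiv_apply ℝ y)
  obtain ⟨A, hA⟩ := ha.lipschitzWith_of_hasCompactSupport hac one_ne_zero
  obtain ⟨B, hB⟩ := hb.lipschitzWith_of_hasCompactSupport hbc one_ne_zero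
  have lim₁ := hA.integral_inv_smul_sub_mul_tendsto_integral_lineDeriv_mul
    (μ := volume) (int w hb hbc) v
  have lim₂ := (hB.integral_inv_smul_sub_mul_tendsto_integral_lineDeriv_mul
    (μ := volume) (int w ha hac) (-v)).neg
  have da : Differentiable ℝ a := ha.differentiable one_ne_zero
  have db : Differentiable ℝ b := hb.differentiable one_ne_zero
  have key : ∀ t : ℝ, ∫ z, (t⁻¹ • (a (z + t • v) - a z)) * fderiv ℝ b z w =
      -∫ z, (t⁻¹ • (b (z + t • (-v)) - b z)) * fderiv ℝ a z w := by
    intro t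
    have hfd : ∀ z, HasFDerivAt (fun z => t⁻¹ • (a (z + t • v) - a z))
        (t⁻¹ • (fderiv ℝ a (z + t • v) - fderiv ℝ a z)) z := fun z =>
      (((hasFDerivAt_comp_add_right (t • v)).2 (da (z + t • v)).hasFDerivAt).fun_sub
        (da z).hasFDerivAt).fun_const_smul _
    have hfd' : ∀ z, fderiv ℝ (fun z => t⁻¹ • (a (z + t • v) - a z)) z w =
        t⁻¹ * (fderiv ℝ a (z + t • v) w - fderiv ℝ a z w) := fun z => by
      rw [(hfd z).fderiv]; rfl
    have ca := cont w ha
    have ca' : Continuous fun z => fderiv ℝ a (z + t • v) w :=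
      ca.comp (continuous_id.add continuous_const)
    have cA : Continuous fun z => t⁻¹ • (a (z + t • v) - a z) := by
      have := da.continuous
      fun_prop
    have i₁ : Integrable fun z => fderiv ℝ a (z + t • v) w * b z :=
      (ca'.mul db.continuous).integrable_of_hasCompactSupport hbc.mul_left
    have i₂ : Integrable fun z => fderiv ℝ a z w * b z :=
      (ca.mul db.continuous).integrable_of_hasCompactSupport hbc.mul_left
    have i₃ : Integrable fun z => fderiv ℝ a z w * b (z + t • (-v)) :=
      (ca.mul (db.continuous.comp
        (continuous_id.add continuous_const))).integrable_of_hasCompactSupport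
        (hac.fderiv_apply ℝ w).mul_right
    have shift : ∫ z, fderiv ℝ a (z + t • v) w * b z =
        ∫ z, fderiv ℝ a z w * b (z + t • (-v)) := by
      rw [← integral_add_right_eq_self (fun z => fderiv ℝ a z w * b (z + t • (-v))) (t • v)]
      simp
    rw [integral_mul_fderiv_eq_neg_fderiv_mul_of_integrable]
    · congr 1
      calc ∫ z, fderiv ℝ (fun z => t⁻¹ • (a (z + t • v) - a z)) z w * b z
          = ∫ z, t⁻¹ * (fderiv ℝ a (z + t • v) w * b z - fderiv ℝ a z w * b z) := by
            congr 1; ext z; rw [hfd']; ring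
        _ = ∫ z, t⁻¹ * (fderiv ℝ a z w * b (z + t • (-v)) - fderiv ℝ a z w * b z) := by
            rw [integral_const_mul, integral_const_mul, integral_sub i₁ i₂, integral_sub i₃ i₂,
              shift]
        _ = _ := by congr 1; ext z; simp only [smul_eq_mul]; ring
    · refine ((i₁.sub i₂).const_mul t⁻¹).congr (ae_of_all _ fun z => ?_)
      simp only [hfd', Pi.sub_apply]; ring
    · exact (cA.mul (cont w hb)).integrable_of_hasCompactSupport (hbc.fderiv_apply ℝ w).mul_left
    · exact (cA.mul db.continuous).integrable_of_hasCompactSupport hbc.mul_left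
    · exact fun z _ => (hfd z).differentiableAt
    · exact fun z _ => db z
  have := tendsto_nhds_unique lim₁ (lim₂.congr fun t => (key t).symm)
  simp only [(da _).lineDeriv_eq_fderiv, (db _).lineDeriv_eq_fderiv, map_neg, neg_mul,
    integral_neg, neg_neg] at this
  rw [this]
  congr 1; ext z; ring

/-- Carleman's positive commutator inequality for the Cauchy–Riemann operator, in terms of the
real and imaginary parts `a`, `b` of the conjugated function. -/
lemma commutator_ineq {a b φ : ℂ → ℝ} (ha : ContDiff ℝ 1 a) (hb : ContDiff ℝ 1 b)
    (hac : HasCompactSupport a) (hbc : HasCompactSupport b) (hφ : ContDiff ℝ 2 φ) :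
    2 * ∫ z, (fderiv ℝ (fun z => fderiv ℝ φ z 1) z 1 + fderiv ℝ (fun z => fderiv ℝ φ z I) z I) *
        (a z ^ 2 + b z ^ 2) ≤
      ∫ z, ((fderiv ℝ a z 1 - fderiv ℝ b z I - fderiv ℝ φ z 1 * a z + fderiv ℝ φ z I * b z) ^ 2 +
        (fderiv ℝ b z 1 + fderiv ℝ a z I - fderiv ℝ φ z 1 * b z - fderiv ℝ φ z I * a z) ^ 2) := by
  have cont : ∀ {f : ℂ → ℝ} (y : ℂ), ContDiff ℝ 1 f → Continuous fun z => fderiv ℝ f z y :=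
    fun y hf => (hf.continuous_fderiv one_ne_zero).clm_apply continuous_const
  have hφ' : ∀ y, ContDiff ℝ 1 fun z => fderiv ℝ φ z y := fun y =>
    (hφ.fderiv_right (m := 1) (by norm_num)).clm_apply contDiff_const
  set s : ℂ → ℝ := fun z => a z ^ 2 + b z ^ 2 with hs
  have cs : ContDiff ℝ 1 s := (ha.pow 2).add (hb.pow 2)
  have hsc : HasCompactSupport s := by
    have h1 : HasCompactSupport fun z => a z ^ 2 := by
      simp only [sq]; exact hac.mul_right
    have h2 : HasCompactSupport fun z => b z ^ 2 := by
      simp only [sq]; exact hbc.mul_right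
    exact h1.add h2
  have da : Differentiable ℝ a := ha.differentiable one_ne_zero
  have db : Differentiable ℝ b := hb.differentiable one_ne_zero
  have ds : ∀ z y, fderiv ℝ s z y = 2 * (a z * fderiv ℝ a z y + b z * fderiv ℝ b z y) := by
    intro z y
    have := (((da z).hasFDerivAt.pow 2).add ((db z).hasFDerivAt.pow 2)).fderiv
    simp only [hs]
    erw [this]
    simp
    ring
  have ibp : ∀ y, Integrable (fun z => fderiv ℝ φ z y * fderiv ℝ s z y) ∧
      Integrable (fun z => fderiv ℝ (fun z => fderiv ℝ φ z y) z y * s z) ∧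
      ∫ z, fderiv ℝ φ z y * fderiv ℝ s z y =
      -∫ z, fderiv ℝ (fun z => fderiv ℝ φ z y) z y * s z := by
    intro y
    have i1 : Integrable (fun z => fderiv ℝ φ z y * fderiv ℝ s z y) :=
      ((hφ' y).continuous.mul (cont y cs)).integrable_of_hasCompactSupport
        (hsc.fderiv_apply ℝ y).mul_left
    have i2 : Integrable (fun z => fderiv ℝ (fun z => fderiv ℝ φ z y) z y * s z) :=
      ((cont y (hφ' y)).mul cs.continuous).integrable_of_hasCompactSupport hsc.mul_left
    refine ⟨i1, i2, ?_⟩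
    refine integral_mul_fderiv_eq_neg_fderiv_mul_of_integrable i2 i1
      (((hφ' y).continuous.mul cs.continuous).integrable_of_hasCompactSupport hsc.mul_left)
      (fun z _ => (hφ' y).differentiable one_ne_zero z) (fun z _ => cs.differentiable one_ne_zero z)
  obtain ⟨ix, jx, hx⟩ := ibp 1
  obtain ⟨iy, jy, hy⟩ := ibp I
  have jac : ∀ v w, Integrable fun z => fderiv ℝ a z v * fderiv ℝ b z w := fun v w =>
    ((cont v ha).mul (cont w hb)).integrable_of_hasCompactSupport (hbc.fderiv_apply ℝ w).mul_left
  set P' : ℂ → ℝ := fun z =>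
    (fderiv ℝ a z 1 + fderiv ℝ b z I + fderiv ℝ φ z 1 * a z + fderiv ℝ φ z I * b z) ^ 2 +
    (fderiv ℝ b z 1 - fderiv ℝ a z I + fderiv ℝ φ z 1 * b z - fderiv ℝ φ z I * a z) ^ 2 with hP'
  have iP' : Integrable P' := by
    have c1 := cont 1 ha
    have c2 := cont 1 hb
    have c3 := cont I ha
    have c4 := cont I hb
    have c5 := (hφ' 1).continuous
    have c6 := (hφ' I).continuous
    have c7 := ha.continuous
    have c8 := hb.continuous
    refine Continuous.integrable_of_hasCompactSupport (by fun_prop) ?_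
    have sq' : ∀ {g : ℂ → ℝ}, HasCompactSupport g → HasCompactSupport fun z => g z ^ 2 :=
      fun {g} hg => by
        simp only [sq]; exact hg.mul_right
    have e1 := hac.fderiv_apply ℝ 1
    have e2 := hac.fderiv_apply ℝ I
    have e3 := hbc.fderiv_apply ℝ 1
    have e4 := hbc.fderiv_apply ℝ I
    have e5 : HasCompactSupport fun z => fderiv ℝ φ z 1 * a z := hac.mul_left
    have e6 : HasCompactSupport fun z => fderiv ℝ φ z I * b z := hbc.mul_left
    have e7 : HasCompactSupport fun z => fderiv ℝ φ z 1 * b z := hbc.mul_left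
    have e8 : HasCompactSupport fun z => fderiv ℝ φ z I * a z := hac.mul_left
    exact (sq' (((e1.add e4).add e5).add e6)).add (sq' (((e3.sub e2).add e7).sub e8))
  have nonneg : 0 ≤ ∫ z, P' z := integral_nonneg fun z => by positivity
  have expand : ∀ z,
      (fderiv ℝ a z 1 - fderiv ℝ b z I - fderiv ℝ φ z 1 * a z + fderiv ℝ φ z I * b z) ^ 2 +
        (fderiv ℝ b z 1 + fderiv ℝ a z I - fderiv ℝ φ z 1 * b z - fderiv ℝ φ z I * a z) ^ 2 =
      P' z + (-4) * (fderiv ℝ a z 1 * fderiv ℝ b z I) + 4 * (fderiv ℝ a z I * fderiv ℝ b z 1) +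
      (-2) * (fderiv ℝ φ z 1 * fderiv ℝ s z 1) + (-2) * (fderiv ℝ φ z I * fderiv ℝ s z I) := by
    intro z
    rw [ds, ds]
    simp only [hP']
    ring
  simp_rw [expand, add_mul]
  have k1 := (jac 1 I).const_mul (-4)
  have k2 := (jac I 1).const_mul 4
  have k3 := ix.const_mul (-2)
  have k4 := iy.const_mul (-2)
  have m1 : Integrable fun z => P' z + (-4) * (fderiv ℝ a z 1 * fderiv ℝ b z I) := iP'.add k1
  have m2 : Integrable fun z => P' z + (-4) * (fderiv ℝ a z 1 * fderiv ℝ b z I) +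
      4 * (fderiv ℝ a z I * fderiv ℝ b z 1) := m1.add k2
  have m3 : Integrable fun z => P' z + (-4) * (fderiv ℝ a z 1 * fderiv ℝ b z I) +
      4 * (fderiv ℝ a z I * fderiv ℝ b z 1) + (-2) * (fderiv ℝ φ z 1 * fderiv ℝ s z 1) :=
    m2.add k3
  rw [integral_add m3 k4, integral_add m2 k3, integral_add m1 k2, integral_add iP' k1,
    integral_const_mul, integral_const_mul,
    integral_const_mul, integral_const_mul, hx, hy, integral_add jx jy,
    integral_fderiv_mul_fderiv_comm ha hb hac hbc 1 I]
  linarith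

/-- Weighted `L²` Carleman inequality for the Cauchy–Riemann operator. -/
lemma carleman_ineq {f : ℂ → ℂ} {φ : ℂ → ℝ} (hf : ContDiff ℝ 1 f) (hfc : HasCompactSupport f)
    (hφ : ContDiff ℝ 2 φ) :
    2 * ∫ z, (fderiv ℝ (fun z => fderiv ℝ φ z 1) z 1 + fderiv ℝ (fun z => fderiv ℝ φ z I) z I) *
        (‖f z‖ ^ 2 * Real.exp (2 * φ z)) ≤
      ∫ z, ‖pdx f z + I * pdy f z‖ ^ 2 * Real.exp (2 * φ z) := by
  have hφ1 : ContDiff ℝ 1 φ := hφ.of_le (by norm_num)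
  have cre : ContDiff ℝ 1 fun z => (f z).re := reCLM.contDiff.comp hf
  have cim : ContDiff ℝ 1 fun z => (f z).im := imCLM.contDiff.comp hf
  have cφexp : ContDiff ℝ 1 fun z => Real.exp (φ z) := Real.contDiff_exp.comp hφ1
  have kre : HasCompactSupport fun z => (f z).re := hfc.comp_left (g := re) rfl
  have kim : HasCompactSupport fun z => (f z).im := hfc.comp_left (g := im) rfl
  have df : Differentiable ℝ f := hf.differentiable one_ne_zero
  have dφ : Differentiable ℝ φ := hφ1.differentiable one_ne_zero
  have dre : ∀ z v, fderiv ℝ (fun z => Real.exp (φ z) * (f z).re) z v =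
      Real.exp (φ z) * (fderiv ℝ φ z v * (f z).re + (fderiv ℝ f z v).re) := by
    intro z v
    have := ((dφ z).hasFDerivAt.exp.mul (reCLM.hasFDerivAt.comp z (df z).hasFDerivAt)).fderiv
    erw [this]
    simp
    ring
  have dim : ∀ z v, fderiv ℝ (fun z => Real.exp (φ z) * (f z).im) z v =
      Real.exp (φ z) * (fderiv ℝ φ z v * (f z).im + (fderiv ℝ f z v).im) := by
    intro z v
    have := ((dφ z).hasFDerivAt.exp.mul (imCLM.hasFDerivAt.comp z (df z).hasFDerivAt)).fderiv
    erw [this]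
    simp
    ring
  have key := commutator_ineq (cφexp.mul cre) (cφexp.mul cim) kre.mul_left kim.mul_left hφ
  have exp2 : ∀ z, Real.exp (2 * φ z) = Real.exp (φ z) ^ 2 := fun z => by
    rw [← Real.exp_nat_mul]; norm_num
  calc _ = 2 * ∫ z, (fderiv ℝ (fun z => fderiv ℝ φ z 1) z 1 +
        fderiv ℝ (fun z => fderiv ℝ φ z I) z I) *
        ((Real.exp (φ z) * (f z).re) ^ 2 + (Real.exp (φ z) * (f z).im) ^ 2) := by
        congr 2; ext z
        rw [exp2, Complex.sq_norm, Complex.normSq_apply]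
        ring
    _ ≤ _ := key
    _ = _ := by
        congr 1; ext z
        rw [dre, dre, dim, dim, exp2, Complex.sq_norm, Complex.normSq_apply]
        simp only [pdx, pdy, add_re, add_im, mul_re, mul_im, I_re, I_im]
        ring

/-- The regularised logarithm `log (|z|² + ε²)`. -/
def regLog (ε : ℝ) (z : ℂ) : ℝ := Real.log (z.re ^ 2 + z.im ^ 2 + ε ^ 2)

lemma regLog_arg_pos {ε : ℝ} (hε : 0 < ε) (z : ℂ) : 0 < z.re ^ 2 + z.im ^ 2 + ε ^ 2 := by
  positivity

lemma contDiff_reSq_add_imSq (ε : ℝ) {n : WithTop ℕ∞} :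
    ContDiff ℝ n fun z : ℂ => z.re ^ 2 + z.im ^ 2 + ε ^ 2 :=
  ((reCLM.contDiff.pow 2).add (imCLM.contDiff.pow 2)).add contDiff_const

lemma contDiff_regLog {ε : ℝ} (hε : 0 < ε) {n : WithTop ℕ∞} : ContDiff ℝ n (regLog ε) :=
  (contDiff_reSq_add_imSq ε).log fun z => (regLog_arg_pos hε z).ne'

lemma hasFDerivAt_reSq_add_imSq (ε : ℝ) (z : ℂ) :
    HasFDerivAt (fun z : ℂ => z.re ^ 2 + z.im ^ 2 + ε ^ 2)
      ((2 * z.re) • reCLM + (2 * z.im) • imCLM) z := by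
  have := (((reCLM.hasFDerivAt (x := z)).pow 2).add
    ((imCLM.hasFDerivAt (x := z)).pow 2)).add_const (ε ^ 2)
  refine HasFDerivAt.congr_fderiv this ?_
  ext v
  simp

lemma fderiv_regLog {ε : ℝ} (hε : 0 < ε) (z v : ℂ) :
    fderiv ℝ (regLog ε) z v =
      (2 * z.re * v.re + 2 * z.im * v.im) / (z.re ^ 2 + z.im ^ 2 + ε ^ 2) := by
  have := ((hasFDerivAt_reSq_add_imSq ε z).log (regLog_arg_pos hε z).ne').fderiv
  rw [show regLog ε = fun z => Real.log (z.re ^ 2 + z.im ^ 2 + ε ^ 2) from rfl, this]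
  simp
  field_simp

lemma laplacian_regLog {ε : ℝ} (hε : 0 < ε) (z : ℂ) :
    fderiv ℝ (fun z => fderiv ℝ (regLog ε) z 1) z 1 +
      fderiv ℝ (fun z => fderiv ℝ (regLog ε) z I) z I =
      4 * ε ^ 2 / (z.re ^ 2 + z.im ^ 2 + ε ^ 2) ^ 2 := by
  have hD := (regLog_arg_pos hε z).ne'
  have h1 : (fun z => fderiv ℝ (regLog ε) z 1) =
      fun z => (2 * z.re) * (z.re ^ 2 + z.im ^ 2 + ε ^ 2)⁻¹ := by
    ext z; rw [fderiv_regLog hε]; simp [div_eq_mul_inv]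
  have h2 : (fun z => fderiv ℝ (regLog ε) z I) =
      fun z => (2 * z.im) * (z.re ^ 2 + z.im ^ 2 + ε ^ 2)⁻¹ := by
    ext z; rw [fderiv_regLog hε]; simp [div_eq_mul_inv]
  have hinv := (hasDerivAt_inv hD).comp_hasFDerivAt z (hasFDerivAt_reSq_add_imSq ε z)
  have e1 := (((reCLM.hasFDerivAt (x := z)).const_mul 2).mul hinv).fderiv
  have e2 := (((imCLM.hasFDerivAt (x := z)).const_mul 2).mul hinv).fderiv
  rw [h1, h2]
  erw [e1, e2]
  simp
  field_simp
  ring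

lemma fderiv_convolution_apply {V g : ℂ → ℝ} (hV : Continuous V) (hg : ContDiff ℝ 1 g)
    (hgc : HasCompactSupport g) (z v : ℂ) :
    fderiv ℝ (convolution V g (ContinuousLinearMap.mul ℝ ℝ) volume) z v =
      convolution V (fun x => fderiv ℝ g x v) (ContinuousLinearMap.mul ℝ ℝ) volume z := by
  rw [(hgc.hasFDerivAt_convolution_right _ hV.locallyIntegrable hg z).fderiv,
    convolution_precompR_apply _ hV.locallyIntegrable (hgc.fderiv ℝ)
      (hg.continuous_fderiv one_ne_zero)]

lemma laplacian_normSq (z : ℂ) :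
    fderiv ℝ (fun z => fderiv ℝ (fun z : ℂ => z.re ^ 2 + z.im ^ 2 + 0 ^ 2) z 1) z 1 +
      fderiv ℝ (fun z => fderiv ℝ (fun z : ℂ => z.re ^ 2 + z.im ^ 2 + 0 ^ 2) z I) z I = 4 := by
  have h1 : (fun z => fderiv ℝ (fun z : ℂ => z.re ^ 2 + z.im ^ 2 + (0 : ℝ) ^ 2) z 1) =
      fun z : ℂ => 2 * z.re := by
    ext z; rw [(hasFDerivAt_reSq_add_imSq 0 z).fderiv]; simp
  have h2 : (fun z => fderiv ℝ (fun z : ℂ => z.re ^ 2 + z.im ^ 2 + (0 : ℝ) ^ 2) z I) =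
      fun z : ℂ => 2 * z.im := by
    ext z; rw [(hasFDerivAt_reSq_add_imSq 0 z).fderiv]; simp
  have e1 := ((reCLM.hasFDerivAt (x := z)).const_mul 2).fderiv
  have e2 := ((imCLM.hasFDerivAt (x := z)).const_mul 2).fderiv
  rw [h1, h2]
  erw [e1, e2]
  simp
  norm_num

lemma sq_norm_eq (z : ℂ) : ‖z‖ ^ 2 = z.re ^ 2 + z.im ^ 2 := by
  rw [Complex.sq_norm, normSq_apply]; ring

lemma abs_regLog_le {ε s : ℝ} (hε : 0 < ε) (hε1 : ε ≤ 1) (hs : 0 < s) (hs1 : s ≤ 1) {x : ℂ}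
    (hx : x ≠ 0) (hx4 : ‖x‖ ≤ 4) : |regLog ε x| ≤ (64 + 2 / s) * ‖x‖ ^ (-s) := by
  have hpos : 0 < ‖x‖ := norm_pos_iff.2 hx
  have h0 : 0 < ‖x‖ ^ (-s) := Real.rpow_pos_of_pos hpos _
  have hD : regLog ε x = Real.log (‖x‖ ^ 2 + ε ^ 2) := by rw [regLog, sq_norm_eq]
  rw [hD, abs_le]
  constructor
  · have h1 : Real.log (‖x‖ ^ 2) ≤ Real.log (‖x‖ ^ 2 + ε ^ 2) :=
      Real.log_le_log (by positivity) (by nlinarith)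
    have h2 : Real.log (‖x‖⁻¹) ≤ (‖x‖⁻¹) ^ s / s :=
      Real.log_le_rpow_div (by positivity) hs
    rw [Real.inv_rpow hpos.le, ← Real.rpow_neg hpos.le, Real.log_inv] at h2
    rw [Real.log_pow] at h1
    push_cast at h1
    have : 2 / s * ‖x‖ ^ (-s) = 2 * (‖x‖ ^ (-s) / s) := by ring
    nlinarith
  · have h1 : Real.log (‖x‖ ^ 2 + ε ^ 2) ≤ ‖x‖ ^ 2 + ε ^ 2 - 1 :=
      Real.log_le_sub_one_of_pos (by positivity)
    have h2 : (4 : ℝ)⁻¹ ≤ ‖x‖ ^ (-s) := by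
      rw [Real.rpow_neg hpos.le]
      apply inv_anti₀ (by positivity)
      calc ‖x‖ ^ s ≤ 4 ^ s := Real.rpow_le_rpow hpos.le hx4 hs.le
        _ ≤ 4 ^ (1 : ℝ) := Real.rpow_le_rpow_of_exponent_le (by norm_num) hs1
        _ = 4 := Real.rpow_one _
    have h3 : 0 ≤ 2 / s * ‖x‖ ^ (-s) := by positivity
    nlinarith

/-- A `C²` function that is bounded in terms of Riesz potentials of `V` and whose Laplacian
dominates `V + 1`. -/
lemma exists_potential {V : ℂ → ℝ} {s A : ℝ} (hV : Continuous V) (hVc : HasCompactSupport V)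
    (hV0 : ∀ z, 0 ≤ V z) (hV2 : ∀ z, V z ≠ 0 → ‖z‖ < 2) (hs : 0 < s) (hs1 : s ≤ 1)
    (hint : ∀ z : ℂ, ‖z‖ < 2 → Integrable fun ζ => ‖z - ζ‖ ^ (-s) * V ζ)
    (hA : ∀ z : ℂ, ‖z‖ < 2 → ∫ ζ, ‖z - ζ‖ ^ (-s) * V ζ ≤ A) :
    ∃ φ : ℂ → ℝ, ContDiff ℝ 2 φ ∧
      (∀ z : ℂ, ‖z‖ < 2 → V z + 1 ≤
        fderiv ℝ (fun z => fderiv ℝ φ z 1) z 1 + fderiv ℝ (fun z => fderiv ℝ φ z I) z I) ∧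
      ∀ z : ℂ, ‖z‖ < 2 → |φ z| ≤ 4 + (64 + 2 / s) * A := by
  obtain ⟨d, hd, hd1⟩ : ∃ d > 0, ∀ z ζ : ℂ, dist z ζ < d → |V z - V ζ| < 1 := by
    have := Metric.uniformContinuous_iff.1 (hVc.uniformContinuous_of_continuous hV) 1 one_pos
    obtain ⟨d, hd, h⟩ := this
    exact ⟨d, hd, fun z ζ h' => h h'⟩
  set ε := min d 1 with hεd
  have hε : 0 < ε := lt_min hd one_pos
  have hε1 : ε ≤ 1 := min_le_right _ _
  let cut : ContDiffBump (0 : ℂ) := ⟨4, 5, by norm_num, by norm_num⟩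
  set G : ℂ → ℝ := fun z => cut z * regLog ε z with hG
  have cG : ContDiff ℝ 2 G := cut.contDiff.mul (contDiff_regLog hε)
  have cG1 : ContDiff ℝ 1 G := cG.of_le (by norm_num)
  have kG : HasCompactSupport G := cut.hasCompactSupport.mul_right
  have cG' : ∀ v, ContDiff ℝ 1 fun z => fderiv ℝ G z v := fun v =>
    (cG.fderiv_right (m := 1) (by norm_num)).clm_apply contDiff_const
  have kG' : ∀ v, HasCompactSupport fun z => fderiv ℝ G z v := fun v => kG.fderiv_apply ℝ v
  set ψ : ℂ → ℝ := convolution V G (ContinuousLinearMap.mul ℝ ℝ) volume with hψ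
  have cψ : ContDiff ℝ 2 ψ := kG.contDiff_convolution_right _ hV.locallyIntegrable cG
  have hGeq : ∀ x : ℂ, ‖x‖ < 4 → ∀ᶠ y in nhds x, G y = regLog ε y := by
    intro x hx
    have : ball (0 : ℂ) 4 ∈ nhds x := isOpen_ball.mem_nhds (by simpa using hx)
    filter_upwards [this] with y hy
    rw [hG]
    simp only
    rw [cut.one_of_mem_closedBall (ball_subset_closedBall hy), one_mul]
  have lapG : ∀ x : ℂ, ‖x‖ < 4 → fderiv ℝ (fun z => fderiv ℝ G z 1) x 1 +
      fderiv ℝ (fun z => fderiv ℝ G z I) x I =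
      4 * ε ^ 2 / (x.re ^ 2 + x.im ^ 2 + ε ^ 2) ^ 2 := by
    intro x hx
    rw [← laplacian_regLog hε]
    have h1 : ∀ v, ∀ᶠ y in nhds x, fderiv ℝ G y v = fderiv ℝ (regLog ε) y v := fun v =>
      (hGeq x hx).eventually_nhds.mono fun y hy => by
        rw [Filter.EventuallyEq.fderiv_eq hy]
    rw [Filter.EventuallyEq.fderiv_eq (h1 1), Filter.EventuallyEq.fderiv_eq (h1 I)]
  have intc : ∀ {g : ℂ → ℝ}, Continuous g → ∀ z, Integrable fun ζ => V ζ * g (z - ζ) :=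
    fun {g} hg z => (hV.mul (hg.comp
      (continuous_const.sub continuous_id))).integrable_of_hasCompactSupport
      hVc.mul_right
  have lapψ : ∀ z, fderiv ℝ (fun z => fderiv ℝ ψ z 1) z 1 + fderiv ℝ (fun z => fderiv ℝ ψ z I) z I =
      ∫ ζ, V ζ * (fderiv ℝ (fun z => fderiv ℝ G z 1) (z - ζ) 1 +
        fderiv ℝ (fun z => fderiv ℝ G z I) (z - ζ) I) := by
    intro z
    have h1 : ∀ v, (fun z => fderiv ℝ ψ z v) =
        convolution V (fun x => fderiv ℝ G x v) (ContinuousLinearMap.mul ℝ ℝ) volume :=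
      fun v => funext fun z => fderiv_convolution_apply hV cG1 kG z v
    have c1 : ∀ v, Continuous fun x => fderiv ℝ (fun z => fderiv ℝ G z v) x v := fun v =>
      ((cG' v).continuous_fderiv one_ne_zero).clm_apply continuous_const
    rw [h1, h1, fderiv_convolution_apply hV (cG' _) (kG' _),
      fderiv_convolution_apply hV (cG' _) (kG' _)]
    simp only [convolution_def, ContinuousLinearMap.mul_apply', mul_add]
    rw [integral_add (intc (c1 1) z) (intc (c1 I) z)]
  have lapψ_nonneg : ∀ z : ℂ, ‖z‖ < 2 → ∀ ζ, 0 ≤ V ζ *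
      (fderiv ℝ (fun z => fderiv ℝ G z 1) (z - ζ) 1 +
        fderiv ℝ (fun z => fderiv ℝ G z I) (z - ζ) I) := by
    intro z hz ζ
    by_cases h : V ζ = 0
    · simp [h]
    · have : ‖z - ζ‖ < 4 := (norm_sub_le _ _).trans_lt (by linarith [hV2 ζ h])
      rw [lapG _ this]
      exact mul_nonneg (hV0 _) (by positivity)
  have lower : ∀ z : ℂ, ‖z‖ < 2 → V z - 1 ≤ fderiv ℝ (fun z => fderiv ℝ ψ z 1) z 1 +
      fderiv ℝ (fun z => fderiv ℝ ψ z I) z I := by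
    intro z hz
    rw [lapψ]
    by_cases hVz : V z ≤ 1
    · exact (by linarith : V z - 1 ≤ 0).trans (integral_nonneg (lapψ_nonneg z hz))
    push Not at hVz
    have c1 : ∀ v, Continuous fun x => fderiv ℝ (fun z => fderiv ℝ G z v) x v := fun v =>
      ((cG' v).continuous_fderiv one_ne_zero).clm_apply continuous_const
    have hint' := intc ((c1 1).add (c1 I)) z
    calc V z - 1 ≤ (V z - 1) * Real.pi := by nlinarith [Real.pi_gt_three]
      _ = ∫ ζ in ball z ε, (V z - 1) / ε ^ 2 := by
          rw [setIntegral_const, measureReal_def, Complex.volume_ball]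
          simp only [ENNReal.toReal_mul, ENNReal.toReal_pow, ENNReal.toReal_ofReal hε.le,
            ENNReal.coe_toReal, smul_eq_mul, NNReal.coe_real_pi]
          field_simp
      _ ≤ ∫ ζ in ball z ε, V ζ * (fderiv ℝ (fun z => fderiv ℝ G z 1) (z - ζ) 1 +
        fderiv ℝ (fun z => fderiv ℝ G z I) (z - ζ) I) := by
          refine setIntegral_mono_on (integrableOn_const measure_ball_lt_top.ne)
            hint'.integrableOn measurableSet_ball fun ζ hζ => ?_
          rw [mem_ball] at hζ
          have hζ' : ‖z - ζ‖ < ε := by rwa [← dist_eq_norm, dist_comm]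
          rw [lapG _ (by linarith), ← sq_norm_eq]
          have h1 := hd1 z ζ (by rw [dist_comm]; exact hζ.trans_le (min_le_left _ _))
          have h2 : V z - 1 ≤ V ζ := by linarith [(abs_lt.1 h1).2]
          have h3 : 1 / ε ^ 2 ≤ 4 * ε ^ 2 / (‖z - ζ‖ ^ 2 + ε ^ 2) ^ 2 := by
            rw [div_le_div_iff₀ (by positivity) (by positivity)]
            have : ‖z - ζ‖ ^ 2 ≤ ε ^ 2 := by gcongr
            nlinarith [sq_nonneg ‖z - ζ‖]
          calc (V z - 1) / ε ^ 2 = (V z - 1) * (1 / ε ^ 2) := by ring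
            _ ≤ _ := mul_le_mul h2 h3 (by positivity) (hV0 _)
      _ ≤ _ := setIntegral_le_integral hint' (ae_of_all _ (lapψ_nonneg z hz))
  have bound : ∀ z : ℂ, ‖z‖ < 2 → |ψ z| ≤ (64 + 2 / s) * A := by
    intro z hz
    calc |ψ z| = ‖∫ ζ, V ζ * G (z - ζ)‖ := by
          rw [hψ, Real.norm_eq_abs]; rfl
      _ ≤ ∫ ζ, (64 + 2 / s) * (‖z - ζ‖ ^ (-s) * V ζ) := by
          refine norm_integral_le_of_norm_le ((hint z hz).const_mul _) ?_
          have : ∀ᵐ ζ : ℂ, ζ ≠ z := by simp [ae_iff]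
          filter_upwards [this] with ζ hζ
          by_cases h : V ζ = 0
          · simp [h]
          have h4 : ‖z - ζ‖ < 4 := (norm_sub_le _ _).trans_lt (by linarith [hV2 ζ h])
          rw [(hGeq _ h4).self_of_nhds, norm_mul, Real.norm_eq_abs, Real.norm_eq_abs,
            abs_of_nonneg (hV0 ζ)]
          have := abs_regLog_le hε hε1 hs hs1 (sub_ne_zero.2 hζ.symm) h4.le
          nlinarith [hV0 ζ]
      _ ≤ _ := by
          rw [integral_const_mul]
          have : 0 < 64 + 2 / s := by positivity
          exact mul_le_mul_of_nonneg_left (hA z hz) this.le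
  have cN : ContDiff ℝ 2 fun z : ℂ => z.re ^ 2 + z.im ^ 2 + (0 : ℝ) ^ 2 := contDiff_reSq_add_imSq 0
  refine ⟨fun z => (z.re ^ 2 + z.im ^ 2 + (0 : ℝ) ^ 2) + ψ z, cN.add cψ, fun z hz => ?_,
    fun z hz => ?_⟩
  · have d1 : ∀ {F : ℂ → ℝ}, ContDiff ℝ 2 F → Differentiable ℝ F := fun hF =>
      hF.differentiable two_ne_zero
    have d2 : ∀ {F : ℂ → ℝ} (v : ℂ), ContDiff ℝ 2 F →
        Differentiable ℝ fun z => fderiv ℝ F z v := fun v hF =>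
      ((hF.fderiv_right (m := 1) (by norm_num)).clm_apply contDiff_const).differentiable one_ne_zero
    have h1 : ∀ v, (fun z => fderiv ℝ (fun z => (z.re ^ 2 + z.im ^ 2 + (0 : ℝ) ^ 2) + ψ z) z v) =
        fun z => fderiv ℝ (fun z : ℂ => z.re ^ 2 + z.im ^ 2 + (0 : ℝ) ^ 2) z v +
          fderiv ℝ ψ z v := fun v => funext fun z => by
      rw [fderiv_fun_add (d1 cN z) (d1 cψ z)]; rfl
    rw [h1, h1, fderiv_fun_add (d2 1 cN z) (d2 1 cψ z), fderiv_fun_add (d2 I cN z) (d2 I cψ z)]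
    have := laplacian_normSq z
    have := lower z hz
    simp only [add_apply]
    linarith
  · refine (abs_add_le _ _).trans (add_le_add ?_ (bound z hz))
    rw [← sq_norm_eq, abs_of_nonneg (by positivity)]
    nlinarith [norm_nonneg z]

lemma lintegral_ball_inv_norm_lt_top (R : ℝ) :
    ∫⁻ x in ball (0 : ℂ) R, ENNReal.ofReal (‖x‖⁻¹) < ∞ := by
  have h : Integrable (fun x : ℂ => (Set.Iio R).indicator (fun y : ℝ => y⁻¹) ‖x‖) := by
    rw [integrable_fun_norm_addHaar, Complex.finrank_real_complex]
    have : Set.EqOn (fun y : ℝ => y ^ (2 - 1) • (Set.Iio R).indicator (fun y : ℝ => y⁻¹) y)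
        ((Set.Iio R).indicator fun _ => 1) (Set.Ioi 0) := by
      intro y hy
      have hy' : (y : ℝ) ≠ 0 := (Set.mem_Ioi.1 hy).ne'
      by_cases h : y < R <;> simp [Set.indicator, h, hy']
    rw [integrableOn_congr_fun this measurableSet_Ioi]
    rw [integrableOn_indicator_iff measurableSet_Iio]
    refine integrableOn_const ?_
    rw [Set.inter_comm, Set.Ioi_inter_Iio]
    simp
  have h2 := h.lintegral_lt_top
  refine lt_of_eq_of_lt ?_ h2
  rw [← lintegral_indicator measurableSet_ball]
  congr 1
  ext x
  by_cases hx : ‖x‖ < R <;> simp [Set.indicator, hx]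

lemma measurable_pairLen {W : ℂ → ℂ × ℂ} (hW : Measurable W) : Measurable (pairLen W) := by
  unfold pairLen
  fun_prop

/-- Hölder's inequality for Riesz potentials of a function dominated by `|W|²`, `W ∈ L^q`. -/
lemma exists_riesz_bound (q : ℝ≥0∞) (hq : 2 < q) :
    ∃ s A : ℝ, 0 < s ∧ s ≤ 1 ∧ 0 ≤ A ∧ ∀ (M : ℝ) (W : ℂ → ℂ × ℂ), 0 ≤ M → Measurable W →
      eLpNorm (pairLen W) q (volume.restrict (ball 0 2)) ≤ ENNReal.ofReal M →
      ∀ V : ℂ → ℝ, Continuous V → (∀ z, 0 ≤ V z) → (∀ z, V z ≠ 0 → ‖z‖ < 2) →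
      (∀ᵐ z : ℂ, z ∈ ball (0 : ℂ) 2 → V z ≤ pairLen W z ^ 2) → ∀ z : ℂ, ‖z‖ < 2 →
      Integrable (fun ζ => ‖z - ζ‖ ^ (-s) * V ζ) ∧ ∫ ζ, ‖z - ζ‖ ^ (-s) * V ζ ≤ A * M ^ 2 := by
  set q' := min q 4 with hq'
  have hq'2 : 2 < q' := lt_min hq (by norm_num)
  have hq't : q' ≠ ∞ := ((min_le_right q 4).trans_lt (by norm_num)).ne
  set p := q'.toReal with hp
  have hp2 : 2 < p := by
    have := (ENNReal.toReal_lt_toReal (by norm_num) hq't).2 hq'2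
    simpa using this
  have hp0 : 0 < p := by linarith
  set s := 1 - 2 / p with hs
  have hs0 : 0 < s := by
    have : 2 / p < 1 := by rw [div_lt_one hp0]; exact hp2
    linarith
  have hs1 : s ≤ 1 := by
    have : 0 < 2 / p := by positivity
    linarith
  set K := ∫⁻ x in ball (0 : ℂ) 4, ENNReal.ofReal (‖x‖⁻¹) with hK
  have hKt : K < ∞ := lintegral_ball_inv_norm_lt_top 4
  set vol := (volume.restrict (ball (0 : ℂ) 2)) Set.univ ^ (1 / q'.toReal - 1 / q.toReal) with hvol
  have hexp : 0 ≤ 1 / q'.toReal - 1 / q.toReal := by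
    rcases eq_or_ne q ∞ with rfl | hqt
    · simp
    · have : q'.toReal ≤ q.toReal := ENNReal.toReal_mono hqt (min_le_left _ _)
      have := one_div_le_one_div_of_le hp0 this
      linarith
  have hvt : vol < ∞ := by
    refine ENNReal.rpow_lt_top_of_nonneg hexp ?_
    rw [Measure.restrict_apply_univ]
    exact measure_ball_lt_top.ne
  refine ⟨s, (K ^ s * vol ^ 2).toReal, hs0, hs1, ENNReal.toReal_nonneg, ?_⟩
  intro M W hM hWm hW V hV hV0 hV2 hVW z hz
  have hCt : K ^ s * vol ^ 2 < ∞ :=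
    ENNReal.mul_lt_top (ENNReal.rpow_lt_top_of_nonneg hs0.le hKt.ne) (ENNReal.pow_lt_top hvt)
  have hnorm : eLpNorm (pairLen W) q' (volume.restrict (ball 0 2)) ≤ ENNReal.ofReal M * vol :=
    (eLpNorm_le_eLpNorm_mul_rpow_measure_univ (min_le_left _ _)
      (measurable_pairLen hWm).aestronglyMeasurable).trans (mul_le_mul_left hW _)
  have hkm : Measurable fun ζ : ℂ => ‖z - ζ‖ ^ (-s) := by fun_prop
  have main : ∫⁻ ζ, ENNReal.ofReal (‖z - ζ‖ ^ (-s) * V ζ) ≤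
      ENNReal.ofReal ((K ^ s * vol ^ 2).toReal * M ^ 2) := by
    calc ∫⁻ ζ, ENNReal.ofReal (‖z - ζ‖ ^ (-s) * V ζ)
        = ∫⁻ ζ in ball 0 2, ENNReal.ofReal (‖z - ζ‖ ^ (-s) * V ζ) := by
          rw [setLIntegral_eq_of_support_subset]
          intro ζ hζ
          rw [mem_ball_zero_iff]
          apply hV2
          intro h0
          simp [h0] at hζ
      _ ≤ ∫⁻ ζ in ball 0 2, ((fun ζ => ENNReal.ofReal (‖z - ζ‖ ^ (-s))) *
            fun ζ => ‖pairLen W ζ‖ₑ ^ 2) ζ := by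
          refine lintegral_mono_ae ?_
          rw [ae_restrict_iff' measurableSet_ball]
          filter_upwards [hVW] with ζ h hζ
          rw [ENNReal.ofReal_mul (by positivity), Pi.mul_apply]
          gcongr
          have hnn : 0 ≤ pairLen W ζ := Real.sqrt_nonneg _
          rw [Real.enorm_eq_ofReal hnn, ← ENNReal.ofReal_pow hnn]
          exact ENNReal.ofReal_le_ofReal (h hζ)
      _ ≤ (∫⁻ ζ in ball 0 2, ENNReal.ofReal (‖z - ζ‖ ^ (-s)) ^ (1 / s)) ^ (1 / (1 / s)) *
            (∫⁻ ζ in ball 0 2, (‖pairLen W ζ‖ₑ ^ 2) ^ (p / 2)) ^ (1 / (p / 2)) := by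
          refine ENNReal.lintegral_mul_le_Lp_mul_Lq _ ?_ hkm.ennreal_ofReal.aemeasurable
            ((measurable_pairLen hWm).enorm.pow_const 2).aemeasurable
          rw [Real.holderConjugate_iff]
          constructor
          · rw [lt_div_iff₀ hs0]
            have : 0 < 2 / p := by positivity
            linarith
          · rw [hs]; field_simp; ring
      _ ≤ K ^ s * (ENNReal.ofReal M * vol) ^ 2 := by
          rw [one_div_one_div]
          gcongr
          · calc ∫⁻ ζ in ball (0 : ℂ) 2, ENNReal.ofReal (‖z - ζ‖ ^ (-s)) ^ (1 / s)
                = ∫⁻ ζ in ball (0 : ℂ) 2, ENNReal.ofReal (‖z - ζ‖⁻¹) := by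
                  congr 1; ext ζ
                  rw [ENNReal.ofReal_rpow_of_nonneg (by positivity) (by positivity),
                    ← Real.rpow_mul (norm_nonneg _), ← Real.rpow_neg_one]
                  congr 2
                  field_simp
              _ = ∫⁻ ζ, (ball (0 : ℂ) 2).indicator (fun ζ => ENNReal.ofReal (‖z - ζ‖⁻¹)) ζ := by
                  rw [lintegral_indicator measurableSet_ball]
              _ ≤ ∫⁻ ζ, (ball (0 : ℂ) 4).indicator (fun x => ENNReal.ofReal (‖x‖⁻¹)) (z - ζ) := by
                  refine lintegral_mono fun ζ => ?_
                  by_cases h : ζ ∈ ball (0 : ℂ) 2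
                  · have h4 : z - ζ ∈ ball (0 : ℂ) 4 := by
                      rw [mem_ball_zero_iff] at h ⊢
                      exact (norm_sub_le _ _).trans_lt (by linarith)
                    rw [Set.indicator_of_mem h, Set.indicator_of_mem h4]
                  · rw [Set.indicator_of_notMem h]
                    exact zero_le
              _ = K := by
                  rw [lintegral_sub_left_eq_self
                    (fun x => (ball (0 : ℂ) 4).indicator (fun x => ENNReal.ofReal (‖x‖⁻¹)) x) z,
                    lintegral_indicator measurableSet_ball]
          · have h2 : (∫⁻ ζ in ball (0 : ℂ) 2, (‖pairLen W ζ‖ₑ ^ 2) ^ (p / 2)) ^ (1 / (p / 2)) =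
                eLpNorm (pairLen W) q' (volume.restrict (ball 0 2)) ^ 2 := by
              rw [eLpNorm_eq_lintegral_rpow_enorm_toReal (by positivity) hq't,
                ← ENNReal.rpow_natCast,
                ← ENNReal.rpow_mul]
              congr 1
              · congr 1; ext ζ
                rw [← ENNReal.rpow_natCast, ← ENNReal.rpow_mul]
                congr 1
                push_cast
                ring
              · rw [← hp]; push_cast; field_simp
            rw [h2]
            gcongr
      _ = ENNReal.ofReal ((K ^ s * vol ^ 2).toReal * M ^ 2) := by
          rw [ENNReal.ofReal_mul ENNReal.toReal_nonneg, ENNReal.ofReal_toReal hCt.ne,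
            ENNReal.ofReal_pow hM]
          ring
  have hnn : ∀ ζ, 0 ≤ ‖z - ζ‖ ^ (-s) * V ζ := fun ζ => mul_nonneg (by positivity) (hV0 ζ)
  have hm : AEStronglyMeasurable fun ζ => ‖z - ζ‖ ^ (-s) * V ζ :=
    (hkm.mul hV.measurable).aestronglyMeasurable
  refine ⟨⟨hm, ?_⟩, ?_⟩
  · rw [hasFiniteIntegral_iff_ofReal (ae_of_all _ hnn)]
    exact main.trans_lt ENNReal.ofReal_lt_top
  · rw [integral_eq_lintegral_of_nonneg_ae (ae_of_all _ hnn) hm]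
    exact ENNReal.toReal_le_of_le_ofReal (by positivity) main

lemma contDiff_cutoff_smul {E : Type*} [NormedAddCommGroup E] [NormedSpace ℝ E]
    {n : WithTop ℕ∞} {U : Set ℂ} {χ : ℂ → ℝ} {g : ℂ → E} (hU : IsOpen U) (hχ : ContDiff ℝ n χ)
    (hs : tsupport χ ⊆ U) (hg : ContDiffOn ℝ n g U) : ContDiff ℝ n fun z => χ z • g z := by
  rw [contDiff_iff_contDiffAt]
  intro z
  by_cases hz : z ∈ tsupport χ
  · exact hχ.contDiffAt.smul (hg.contDiffAt (hU.mem_nhds (hs hz)))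
  · have : (fun z => χ z • g z) =ᶠ[nhds z] fun _ => 0 := by
      filter_upwards [notMem_tsupport_iff_eventuallyEq.1 hz] with y hy
      simp [hy]
    exact contDiffAt_const.congr_of_eventuallyEq this

lemma continuous_cutoff_mul {U : Set ℂ} {χ g : ℂ → ℝ} (hU : IsOpen U) (hχ : Continuous χ)
    (hs : tsupport χ ⊆ U) (hg : ContinuousOn g U) : Continuous fun z => χ z * g z :=
  (contDiff_cutoff_smul (n := 0) hU (contDiff_zero.2 hχ) hs (contDiffOn_zero.2 hg)).continuous

lemma contDiffOn_pdx {u : ℂ → ℂ} {U : Set ℂ} (hU : IsOpen U) {m n : WithTop ℕ∞}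
    (hu : ContDiffOn ℝ n u U) (hmn : m + 1 ≤ n) : ContDiffOn ℝ m (pdx u) U :=
  (hu.fderiv_of_isOpen hU hmn).clm_apply contDiffOn_const

lemma contDiffOn_pdy {u : ℂ → ℂ} {U : Set ℂ} (hU : IsOpen U) {m n : WithTop ℕ∞}
    (hu : ContDiffOn ℝ n u U) (hmn : m + 1 ≤ n) : ContDiffOn ℝ m (pdy u) U :=
  (hu.fderiv_of_isOpen hU hmn).clm_apply contDiffOn_const

lemma continuousOn_lap {u : ℂ → ℂ} {U : Set ℂ} (hU : IsOpen U) (hu : ContDiffOn ℝ 2 u U) :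
    ContinuousOn (lap u) U :=
  ((contDiffOn_pdx (m := 0) hU (contDiffOn_pdx (m := 1) hU hu (by norm_num))
    (by norm_num)).continuousOn).add
  ((contDiffOn_pdy (m := 0) hU (contDiffOn_pdy (m := 1) hU hu (by norm_num))
    (by norm_num)).continuousOn)

lemma sq_gradLen (u : ℂ → ℂ) (z : ℂ) : gradLen u z ^ 2 = ‖pdx u z‖ ^ 2 + ‖pdy u z‖ ^ 2 :=
  Real.sq_sqrt (by positivity)

lemma continuousOn_sq_gradLen {u : ℂ → ℂ} {U : Set ℂ} (hU : IsOpen U)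
    (hu : ContDiffOn ℝ 2 u U) : ContinuousOn (fun z => gradLen u z ^ 2) U := by
  simp_rw [sq_gradLen]
  exact (((contDiffOn_pdx (m := 1) hU hu (by norm_num)).continuousOn.norm).pow 2).add
    (((contDiffOn_pdy (m := 1) hU hu (by norm_num)).continuousOn.norm).pow 2)

lemma sq_norm_wDot_le (W : ℂ → ℂ × ℂ) (u : ℂ → ℂ) (z : ℂ) :
    ‖wDot W u z‖ ^ 2 ≤ pairLen W z ^ 2 * gradLen u z ^ 2 := by
  have h1 : pairLen W z ^ 2 = ‖(W z).1‖ ^ 2 + ‖(W z).2‖ ^ 2 := Real.sq_sqrt (by positivity)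
  rw [h1, sq_gradLen]
  have h2 : ‖wDot W u z‖ ≤ ‖(W z).1‖ * ‖pdx u z‖ + ‖(W z).2‖ * ‖pdy u z‖ := by
    rw [wDot, ← norm_mul, ← norm_mul]
    exact norm_add_le _ _
  calc ‖wDot W u z‖ ^ 2 ≤ (‖(W z).1‖ * ‖pdx u z‖ + ‖(W z).2‖ * ‖pdy u z‖) ^ 2 := by gcongr
    _ ≤ _ := by nlinarith [sq_nonneg (‖(W z).1‖ * ‖pdy u z‖ - ‖(W z).2‖ * ‖pdx u z‖)]

/-- A continuous function controlling `|Δu|² / (|∇u|² + δ)`, together with a bounded weight whose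
Laplacian dominates it. -/
lemma exists_weight (q : ℝ≥0∞) (hq : 2 < q) :
    ∃ B : ℝ, 0 ≤ B ∧ ∀ (M : ℝ) (W : ℂ → ℂ × ℂ) (u : ℂ → ℂ), 0 ≤ M → Measurable W →
      eLpNorm (pairLen W) q (volume.restrict (ball 0 2)) ≤ ENNReal.ofReal M →
      ContDiffOn ℝ 2 u (ball 0 2) →
      (∀ᵐ z : ℂ, z ∈ ball (0 : ℂ) 2 → lap u z = wDot W u z) → ∀ δ : ℝ, 0 < δ →
      ∃ V φ : ℂ → ℝ, Continuous V ∧ HasCompactSupport V ∧ (∀ z, 0 ≤ V z) ∧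
        (∀ z : ℂ, ‖z‖ ≤ 3 / 2 → ‖lap u z‖ ^ 2 ≤ V z * (gradLen u z ^ 2 + δ)) ∧
        ∫ z, V z ≤ B * M ^ 2 ∧ ContDiff ℝ 2 φ ∧
        (∀ z : ℂ, ‖z‖ < 2 → V z + 1 ≤
          fderiv ℝ (fun z => fderiv ℝ φ z 1) z 1 + fderiv ℝ (fun z => fderiv ℝ φ z I) z I) ∧
        ∀ z : ℂ, ‖z‖ < 2 → |φ z| ≤ B * (1 + M ^ 2) := by
  obtain ⟨s, A, hs0, hs1, hA, H⟩ := exists_riesz_bound q hq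
  have hsA : 0 ≤ (64 + 2 / s) * A := by positivity
  refine ⟨4 + 4 * A + (64 + 2 / s) * A, by positivity, ?_⟩
  intro M W u hM hWm hW hu heq δ hδ
  let cut : ContDiffBump (0 : ℂ) := ⟨3 / 2, 7 / 4, by norm_num, by norm_num⟩
  have hcutU : tsupport cut ⊆ ball (0 : ℂ) 2 := by
    rw [cut.tsupport_eq]
    exact closedBall_subset_ball (by norm_num)
  set V : ℂ → ℝ := fun z => cut z * (‖lap u z‖ ^ 2 / (gradLen u z ^ 2 + δ)) with hVdef
  have hV : Continuous V := by
    refine continuous_cutoff_mul isOpen_ball cut.continuous hcutU ?_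
    refine ((continuousOn_lap isOpen_ball hu).norm.pow 2).div
      ((continuousOn_sq_gradLen isOpen_ball hu).add continuousOn_const) fun z _ => ?_
    positivity
  have hVc : HasCompactSupport V := cut.hasCompactSupport.mul_right
  have hV0 : ∀ z, 0 ≤ V z := fun z => mul_nonneg cut.nonneg (by positivity)
  have hV2 : ∀ z, V z ≠ 0 → ‖z‖ < 2 := by
    intro z hz
    have h1 : cut z ≠ 0 := left_ne_zero_of_mul hz
    have := hcutU (subset_tsupport _ h1)
    simpa using this
  have hVW : ∀ᵐ z : ℂ, z ∈ ball (0 : ℂ) 2 → V z ≤ pairLen W z ^ 2 := by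
    filter_upwards [heq] with z hz hzb
    have h1 := sq_norm_wDot_le W u z
    rw [← hz hzb] at h1
    have h2 : ‖lap u z‖ ^ 2 / (gradLen u z ^ 2 + δ) ≤ pairLen W z ^ 2 := by
      rw [div_le_iff₀ (by positivity)]
      nlinarith [sq_nonneg (pairLen W z)]
    calc V z ≤ 1 * (‖lap u z‖ ^ 2 / (gradLen u z ^ 2 + δ)) :=
          mul_le_mul_of_nonneg_right cut.le_one (by positivity)
      _ ≤ _ := by rwa [one_mul]
  have HV := H M W hM hWm hW V hV hV0 hV2 hVW
  obtain ⟨φ, hφ, hlap, hbd⟩ := exists_potential hV hVc hV0 hV2 hs0 hs1 (fun z hz => (HV z hz).1)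
    fun z hz => (HV z hz).2
  refine ⟨V, φ, hV, hVc, hV0, fun z hz => ?_, ?_, hφ, hlap, fun z hz => (hbd z hz).trans ?_⟩
  · rw [hVdef]
    simp only
    rw [cut.one_of_mem_closedBall (by simpa using hz), one_mul, div_mul_cancel₀]
    positivity
  · obtain ⟨hi, hle⟩ := HV 0 (by simp)
    have : ∫ z, V z ≤ ∫ z, 4 * (‖0 - z‖ ^ (-s) * V z) := by
      refine integral_mono_ae (hV.integrable_of_hasCompactSupport hVc) (hi.const_mul 4) ?_
      have : ∀ᵐ ζ : ℂ, ζ ≠ 0 := by simp [ae_iff]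
      filter_upwards [this] with z hz
      by_cases h : V z = 0
      · simp [h]
      have hpos : 0 < ‖z‖ := norm_pos_iff.2 hz
      have h1 : (4 : ℝ)⁻¹ ≤ ‖z‖ ^ (-s) := by
        rw [Real.rpow_neg hpos.le]
        apply inv_anti₀ (by positivity)
        calc ‖z‖ ^ s ≤ 4 ^ s := Real.rpow_le_rpow hpos.le (by linarith [hV2 z h]) hs0.le
          _ ≤ 4 ^ (1 : ℝ) := Real.rpow_le_rpow_of_exponent_le (by norm_num) hs1
          _ = 4 := Real.rpow_one _
      simp only [zero_sub, norm_neg]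
      nlinarith [hV0 z]
    rw [integral_const_mul] at this
    have h3 : 0 ≤ (64 + 2 / s) * A * M ^ 2 := by positivity
    nlinarith [sq_nonneg M]
  · nlinarith [sq_nonneg M, mul_nonneg hsA (sq_nonneg M), mul_nonneg hA (sq_nonneg M)]

/-- Interior energy (Caccioppoli) estimate. -/
lemma exists_energy_bound :
    ∃ L : ℝ, 0 ≤ L ∧ ∀ (u : ℂ → ℂ) (V : ℂ → ℝ) (K : ℝ), 1 ≤ K → ContDiffOn ℝ 2 u (ball 0 2) →
      Continuous V → HasCompactSupport V → (∀ z, 0 ≤ V z) →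
      (∀ z : ℂ, ‖z‖ ≤ 3 / 2 → ‖lap u z‖ ^ 2 ≤ V z * (gradLen u z ^ 2 + 1)) →
      (∀ᵐ z : ℂ, z ∈ ball (0 : ℂ) 2 → ‖u z‖ ≤ K) →
      ∫ z in ball 0 (11 / 8), gradLen u z ^ 2 ≤ L * K ^ 2 * (1 + ∫ z, V z) := by
  let χ : ContDiffBump (0 : ℂ) := ⟨11 / 8, 3 / 2, by norm_num, by norm_num⟩
  have hχU : tsupport χ ⊆ ball (0 : ℂ) 2 := by
    rw [χ.tsupport_eq]
    exact closedBall_subset_ball (by norm_num)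
  have hχ : ContDiff ℝ 1 χ := χ.contDiff
  have hχd : ∀ v, Continuous fun z => fderiv ℝ χ z v := fun v =>
    (hχ.continuous_fderiv one_ne_zero).clm_apply continuous_const
  have hχk := χ.hasCompactSupport
  have sqk : ∀ {g : ℂ → ℝ}, HasCompactSupport g → HasCompactSupport fun z => g z ^ 2 :=
    fun {g} hg => by simp only [sq]; exact hg.mul_right
  set Q : ℂ → ℝ := fun z =>
    4 * (fderiv ℝ χ z 1 ^ 2 + fderiv ℝ χ z I ^ 2) + χ z ^ 2 / 4 with hQ
  have hQ0 : ∀ z, 0 ≤ Q z := fun z => by positivity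
  have hQc : Continuous Q :=
    ((((hχd 1).pow 2).add ((hχd I).pow 2)).const_mul 4).add ((χ.continuous.pow 2).div_const 4)
  have hQk : HasCompactSupport Q :=
    (((sqk (hχk.fderiv_apply ℝ 1)).add (sqk (hχk.fderiv_apply ℝ I))).mul_left (f := fun _ => 4)).add
      (by simp only [div_eq_mul_inv]; exact (sqk hχk).mul_right)
  have hQi := hQc.integrable_of_hasCompactSupport hQk (μ := volume)
  refine ⟨2 * (∫ z, Q z) + 2, by have := integral_nonneg (μ := volume) (f := Q) hQ0; positivity, ?_⟩
  intro u V K hK hu hV hVk hV0 hlap huK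
  have hVi : Integrable V := hV.integrable_of_hasCompactSupport hVk
  have hux := contDiffOn_pdx (m := 1) isOpen_ball hu (by norm_num)
  have huy := contDiffOn_pdy (m := 1) isOpen_ball hu (by norm_num)
  have hu1 : ContDiffOn ℝ 1 (fun z => starRingEnd ℂ (u z)) (ball 0 2) :=
    conjCLE.contDiff.comp_contDiffOn (hu.of_le (by norm_num))
  set χ2 : ℂ → ℝ := fun z => χ z ^ 2 with hχ2
  have hχ2c : ContDiff ℝ 1 χ2 := hχ.pow 2
  have hχ2k : HasCompactSupport χ2 := sqk hχk
  have hχ2U : tsupport χ2 ⊆ ball (0 : ℂ) 2 := by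
    refine (closure_mono ?_).trans hχU
    intro z hz
    exact fun h => hz (by simp [hχ2, h])
  set Fx : ℂ → ℂ := fun z => χ2 z • (starRingEnd ℂ (u z) * pdx u z) with hFx
  set Fy : ℂ → ℂ := fun z => χ2 z • (starRingEnd ℂ (u z) * pdy u z) with hFy
  have cFx : ContDiff ℝ 1 Fx := contDiff_cutoff_smul isOpen_ball hχ2c hχ2U (hu1.mul hux)
  have cFy : ContDiff ℝ 1 Fy := contDiff_cutoff_smul isOpen_ball hχ2c hχ2U (hu1.mul huy)
  have kFx : HasCompactSupport Fx := hχ2k.smul_right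
  have kFy : HasCompactSupport Fy := hχ2k.smul_right
  have zero : ∀ {F : ℂ → ℂ} (v : ℂ), ContDiff ℝ 1 F → HasCompactSupport F →
      Integrable (fun z => fderiv ℝ F z v) ∧ ∫ z, fderiv ℝ F z v = 0 := by
    intro F v hF hFk
    have hi : Integrable (fun z => fderiv ℝ F z v) :=
      ((hF.continuous_fderiv one_ne_zero).clm_apply
        continuous_const).integrable_of_hasCompactSupport (hFk.fderiv_apply ℝ v)
    refine ⟨hi, ?_⟩
    have := integral_mul_fderiv_eq_neg_fderiv_mul_of_integrable (μ := volume)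
      (f := fun _ : ℂ => (1 : ℂ)) (g := F) (v := v) (by simp) (by simpa using hi)
      (by simpa using hF.continuous.integrable_of_hasCompactSupport hFk)
      (fun _ _ => differentiableAt_const _) (fun z _ => hF.differentiable one_ne_zero z)
    simpa using this
  obtain ⟨ix, zx⟩ := zero 1 cFx kFx
  obtain ⟨iy, zy⟩ := zero I cFy kFy
  have hTint : ∫ z, (fderiv ℝ Fx z 1 + fderiv ℝ Fy z I).re = 0 := by
    have := integral_re (ix.add iy)
    simp only [Pi.add_apply] at this
    change ∫ z, RCLike.re (fderiv ℝ Fx z 1 + fderiv ℝ Fy z I) = 0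
    rw [this, integral_add ix iy, zx, zy]
    simp
  have hJi : Integrable fun z => χ2 z * gradLen u z ^ 2 :=
    (continuous_cutoff_mul isOpen_ball hχ2c.continuous hχ2U
      (continuousOn_sq_gradLen isOpen_ball hu)).integrable_of_hasCompactSupport hχ2k.mul_right
  have hχ1 : ∀ z, χ2 z ≤ 1 := fun z => by
    have := χ.le_one (x := z)
    have := χ.nonneg (x := z)
    simp only [hχ2]; nlinarith
  have point : ∀ᵐ z : ℂ, χ2 z * gradLen u z ^ 2 ≤
      2 * (K ^ 2 * Q z + K ^ 2 * V z) + 2 * (fderiv ℝ Fx z 1 + fderiv ℝ Fy z I).re := by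
    filter_upwards [huK] with z hzK
    by_cases hz : z ∈ tsupport χ
    swap
    · have hz0 : χ z = 0 := image_eq_zero_of_notMem_tsupport hz
      have h2 : ∀ᶠ y in nhds z, χ2 y = 0 :=
        (notMem_tsupport_iff_eventuallyEq.1 hz).mono fun y hy => by
          simp only [hχ2]; rw [hy]; simp
      have e1 : Fx =ᶠ[nhds z] fun _ => 0 := h2.mono fun y hy => by simp [hFx, hy]
      have e2 : Fy =ᶠ[nhds z] fun _ => 0 := h2.mono fun y hy => by simp [hFy, hy]
      rw [e1.fderiv_eq, e2.fderiv_eq, h2.self_of_nhds]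
      have := hQ0 z
      have := hV0 z
      simp
      positivity
    have hzU := hχU hz
    have hz32 : ‖z‖ ≤ 3 / 2 := by
      rw [χ.tsupport_eq] at hz
      simpa using hz
    have hUn := isOpen_ball.mem_nhds hzU
    have du := ((hu.of_le (by norm_num : (1 : WithTop ℕ∞) ≤ 2)).contDiffAt hUn).differentiableAt
      one_ne_zero |>.hasFDerivAt
    have dux := (hux.contDiffAt hUn).differentiableAt one_ne_zero |>.hasFDerivAt
    have duy := (huy.contDiffAt hUn).differentiableAt one_ne_zero |>.hasFDerivAt
    have dχ := (hχ.differentiable one_ne_zero z).hasFDerivAt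
    have dχ2 := dχ.pow 2
    have dbar := (conjCLE : ℂ →L[ℝ] ℂ).hasFDerivAt.comp z du
    have d1 := (dχ2.fun_smul (dbar.mul dux)).fderiv
    have d2 := (dχ2.fun_smul (dbar.mul duy)).fderiv
    have hd1 : fderiv ℝ Fx z 1 = (2 * χ z * fderiv ℝ χ z 1 : ℝ) * (starRingEnd ℂ (u z) * pdx u z) +
        (χ z ^ 2 : ℝ) * (starRingEnd ℂ (u z) * pdx (pdx u) z +
          starRingEnd ℂ (pdx u z) * pdx u z) := by
      erw [d1]
      simp [pdx]
      ring
    have hd2 : fderiv ℝ Fy z I = (2 * χ z * fderiv ℝ χ z I : ℝ) * (starRingEnd ℂ (u z) * pdy u z) +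
        (χ z ^ 2 : ℝ) * (starRingEnd ℂ (u z) * pdy (pdy u) z +
          starRingEnd ℂ (pdy u z) * pdy u z) := by
      erw [d2]
      simp [pdy]
      ring
    have hsum : (fderiv ℝ Fx z 1 + fderiv ℝ Fy z I).re = χ z ^ 2 * gradLen u z ^ 2 +
        2 * χ z * fderiv ℝ χ z 1 * (starRingEnd ℂ (u z) * pdx u z).re +
        2 * χ z * fderiv ℝ χ z I * (starRingEnd ℂ (u z) * pdy u z).re +
        χ z ^ 2 * (starRingEnd ℂ (u z) * lap u z).re := by
      rw [hd1, hd2, sq_gradLen, sq_norm_eq, sq_norm_eq, lap]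
      simp only [add_re, mul_re, conj_re, conj_im, ofReal_re, ofReal_im, mul_im, add_im]
      ring
    rw [hsum]
    have hK' := hzK hzU
    have re_le : ∀ w : ℂ, |(starRingEnd ℂ (u z) * w).re| ≤ K * ‖w‖ := fun w =>
      (abs_re_le_norm _).trans (by
        rw [norm_mul, RCLike.norm_conj]
        exact mul_le_mul_of_nonneg_right hK' (norm_nonneg _))
    have cross : ∀ (t : ℝ) (w : ℂ), -(χ z ^ 2 * ‖w‖ ^ 2 / 4 + 4 * K ^ 2 * t ^ 2) ≤
        2 * χ z * t * (starRingEnd ℂ (u z) * w).re := by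
      intro t w
      have h1 := re_le w
      have h2 : (starRingEnd ℂ (u z) * w).re ^ 2 ≤ K ^ 2 * ‖w‖ ^ 2 := by
        rw [← mul_pow, ← sq_abs]; gcongr
      have h3 : |2 * χ z * t * (starRingEnd ℂ (u z) * w).re| ≤ 2 * (|χ z| * ‖w‖) * (K * |t|) := by
        rw [abs_mul, abs_mul, abs_mul, abs_two]
        calc 2 * |χ z| * |t| * |(starRingEnd ℂ (u z) * w).re|
            ≤ 2 * |χ z| * |t| * (K * ‖w‖) := by gcongr
          _ = _ := by ring
      have h4 := (abs_le.1 h3).1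
      have h5 := sq_nonneg (|χ z| * ‖w‖ / 2 - 2 * (K * |t|))
      have h6 : |χ z| ^ 2 = χ z ^ 2 := sq_abs _
      have h7 : |t| ^ 2 = t ^ 2 := sq_abs _
      nlinarith
    have c1 := cross (fderiv ℝ χ z 1) (pdx u z)
    have c2 := cross (fderiv ℝ χ z I) (pdy u z)
    have c3 : -((gradLen u z ^ 2 + 1) / 4 + K ^ 2 * V z) ≤ (starRingEnd ℂ (u z) * lap u z).re := by
      have h1 := (abs_le.1 (re_le (lap u z))).1
      have h2 := hlap z hz32
      have h3 : K * ‖lap u z‖ ≤ (gradLen u z ^ 2 + 1) / 4 + K ^ 2 * V z := by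
        refine abs_le_of_sq_le_sq' ?_ (by have := hV0 z; positivity) |>.2
        have h4 : (K * ‖lap u z‖) ^ 2 ≤ K ^ 2 * (V z * (gradLen u z ^ 2 + 1)) := by
          rw [mul_pow]; gcongr
        nlinarith [sq_nonneg ((gradLen u z ^ 2 + 1) / 4 - K ^ 2 * V z)]
      linarith
    have c4 := mul_le_mul_of_nonneg_left c3 (sq_nonneg (χ z))
    have c5 : χ z ^ 2 * (K ^ 2 * V z) ≤ K ^ 2 * V z := by
      have := hχ1 z
      have h0 : 0 ≤ K ^ 2 * V z := mul_nonneg (sq_nonneg _) (hV0 z)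
      simp only [hχ2] at this
      nlinarith
    have c6 : χ z ^ 2 ≤ K ^ 2 * χ z ^ 2 := by
      have : 1 ≤ K ^ 2 := one_le_pow₀ hK
      nlinarith [sq_nonneg (χ z)]
    have hg := sq_gradLen u z
    simp only [hQ, hχ2]
    have c7 : χ z ^ 2 * gradLen u z ^ 2 = χ z ^ 2 * ‖pdx u z‖ ^ 2 + χ z ^ 2 * ‖pdy u z‖ ^ 2 := by
      rw [hg]; ring
    nlinarith
  have hTi : Integrable fun z => 2 * (fderiv ℝ Fx z 1 + fderiv ℝ Fy z I).re :=
    ((ix.add iy).re).const_mul 2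
  have hRi : Integrable fun z => 2 * (K ^ 2 * Q z + K ^ 2 * V z) :=
    ((hQi.const_mul _).add (hVi.const_mul _)).const_mul 2
  have hmain : ∫ z, χ2 z * gradLen u z ^ 2 ≤ 2 * (K ^ 2 * (∫ z, Q z) + K ^ 2 * ∫ z, V z) := by
    refine (integral_mono_ae hJi (hRi.add hTi) point).trans (le_of_eq ?_)
    have := integral_add hRi hTi
    simp only [Pi.add_apply] at this ⊢
    rw [this, integral_const_mul, integral_const_mul, hTint,
      integral_add (hQi.const_mul _) (hVi.const_mul _), integral_const_mul, integral_const_mul]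
    ring
  calc ∫ z in ball 0 (11 / 8), gradLen u z ^ 2
      = ∫ z in ball 0 (11 / 8), χ2 z * gradLen u z ^ 2 := by
        refine setIntegral_congr_fun measurableSet_ball fun z hz => ?_
        have : χ z = 1 := χ.one_of_mem_closedBall (ball_subset_closedBall hz)
        simp [hχ2, this]
    _ ≤ ∫ z, χ2 z * gradLen u z ^ 2 :=
        setIntegral_le_integral hJi (ae_of_all _ fun z => by simp only [hχ2]; positivity)
    _ ≤ _ := hmain
    _ ≤ _ := by
        have h1 := integral_nonneg (μ := volume) (f := Q) hQ0
        have h2 := integral_nonneg (μ := volume) (f := V) hV0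
        have : 0 ≤ K ^ 2 := sq_nonneg K
        nlinarith [mul_nonneg h1 h2, mul_nonneg this (mul_nonneg h1 h2)]

/-- Carleman inequality for `χ z⁻ᴺ g` with a cutoff `χ` vanishing near the origin. -/
lemma carleman_cutoff {g : ℂ → ℂ} {χ φ : ℂ → ℝ} {U : Set ℂ} (N : ℕ) (hU : IsOpen U)
    (h0 : (0 : ℂ) ∉ U) (hg : ContDiffOn ℝ 1 g U) (hχ : ContDiff ℝ 1 χ) (hχk : HasCompactSupport χ)
    (hs : tsupport χ ⊆ U) (hφ : ContDiff ℝ 2 φ) :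
    Integrable (fun z => ‖(fderiv ℝ χ z 1 + I * fderiv ℝ χ z I) * g z +
      χ z * (pdx g z + I * pdy g z)‖ ^ 2 * ((‖z‖⁻¹) ^ (2 * N) * Real.exp (2 * φ z))) ∧
    2 * ∫ z, (fderiv ℝ (fun z => fderiv ℝ φ z 1) z 1 + fderiv ℝ (fun z => fderiv ℝ φ z I) z I) *
      (χ z ^ 2 * ‖g z‖ ^ 2 * ((‖z‖⁻¹) ^ (2 * N) * Real.exp (2 * φ z))) ≤
    ∫ z, ‖(fderiv ℝ χ z 1 + I * fderiv ℝ χ z I) * g z +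
      χ z * (pdx g z + I * pdy g z)‖ ^ 2 * ((‖z‖⁻¹) ^ (2 * N) * Real.exp (2 * φ z)) := by
  set P : ℂ → ℂ := fun z => (z⁻¹) ^ N with hP
  set f : ℂ → ℂ := fun z => χ z • (P z * g z) with hf
  have ne0 : ∀ z ∈ U, z ≠ 0 := fun z hz h => h0 (h ▸ hz)
  have cP : ContDiffOn ℝ 1 P U := (contDiffOn_id.inv ne0).pow N
  have cf : ContDiff ℝ 1 f := contDiff_cutoff_smul hU hχ hs (cP.mul hg)
  have kf : HasCompactSupport f := hχk.smul_right
  have e1 : ∀ z, ‖f z‖ ^ 2 * Real.exp (2 * φ z) =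
      χ z ^ 2 * ‖g z‖ ^ 2 * ((‖z‖⁻¹) ^ (2 * N) * Real.exp (2 * φ z)) := by
    intro z
    simp only [hf, hP, norm_smul, norm_mul, norm_pow, norm_inv, mul_pow, Real.norm_eq_abs, sq_abs]
    ring
  have e2 : ∀ z, ‖pdx f z + I * pdy f z‖ ^ 2 * Real.exp (2 * φ z) =
      ‖(fderiv ℝ χ z 1 + I * fderiv ℝ χ z I) * g z +
      χ z * (pdx g z + I * pdy g z)‖ ^ 2 * ((‖z‖⁻¹) ^ (2 * N) * Real.exp (2 * φ z)) := by
    intro z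
    by_cases hz : z ∈ tsupport χ
    · have hzU := hs hz
      have dg := ((hg.contDiffAt (hU.mem_nhds hzU)).differentiableAt one_ne_zero).hasFDerivAt
      have dχ := (hχ.differentiable one_ne_zero z).hasFDerivAt
      have dP : HasDerivAt P _ z :=
        ((differentiableAt_id.inv (ne0 z hzU)).pow N : DifferentiableAt ℂ _ z).hasDerivAt
      have dP' := dP.hasFDerivAt.restrictScalars ℝ
      have df := (dχ.fun_smul (dP'.mul dg)).fderiv
      have key : pdx f z + I * pdy f z =
          P z * ((fderiv ℝ χ z 1 + I * fderiv ℝ χ z I) * g z +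
            χ z * (pdx g z + I * pdy g z)) := by
        simp only [pdx, pdy]
        erw [df]
        simp
        linear_combination (χ z * (deriv P z * g z)) * I_sq
      rw [key, norm_mul, mul_pow]
      simp only [hP, norm_pow, norm_inv]
      ring
    · have hz0 : χ =ᶠ[nhds z] fun _ => 0 := notMem_tsupport_iff_eventuallyEq.1 hz
      have hf0 : f =ᶠ[nhds z] fun _ => 0 := hz0.mono fun y hy => by simp [hf, hy]
      simp only [pdx, pdy]
      rw [hf0.fderiv_eq, hz0.fderiv_eq, hz0.self_of_nhds]
      simp
  have hC := carleman_ineq cf kf hφ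
  simp_rw [e1] at hC
  refine ⟨?_, hC.trans (le_of_eq (integral_congr_ae (ae_of_all _ e2)))⟩
  refine Integrable.congr ?_ (ae_of_all _ e2)
  have hd : ∀ v, Continuous fun z => fderiv ℝ f z v := fun v =>
    (cf.continuous_fderiv one_ne_zero).clm_apply continuous_const
  have hk : HasCompactSupport fun z => pdx f z + I * pdy f z :=
    (kf.fderiv_apply ℝ 1).add (HasCompactSupport.mul_left (f := fun _ => I) (kf.fderiv_apply ℝ I))
  refine Continuous.integrable_of_hasCompactSupport ?_ ?_
  · exact (((hd 1).add (continuous_const.mul (hd I))).norm.pow 2).mul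
      (Real.continuous_exp.comp (continuous_const.mul hφ.continuous))
  · refine HasCompactSupport.mul_right ?_
    simp only [sq]
    exact hk.norm.mul_right

lemma pdx_pdy_comm {u : ℂ → ℂ} {U : Set ℂ} (hU : IsOpen U) (hu : ContDiffOn ℝ 2 u U) {z : ℂ}
    (hz : z ∈ U) : pdx (pdy u) z = pdy (pdx u) z := by
  have hc := hu.contDiffAt (hU.mem_nhds hz)
  have hd : DifferentiableAt ℝ (fderiv ℝ u) z :=
    ((hu.fderiv_of_isOpen hU (m := 1) (by norm_num)).contDiffAt (hU.mem_nhds hz)).differentiableAt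
      one_ne_zero
  have hsym := hc.isSymmSndFDerivAt (by simp)
  have h1 : ∀ v w : ℂ, fderiv ℝ (fun y => fderiv ℝ u y v) z w = fderiv ℝ (fderiv ℝ u) z w v := by
    intro v w
    rw [(hd.hasFDerivAt.clm_apply (hasFDerivAt_const v z)).fderiv]
    simp
  change fderiv ℝ (fun y => fderiv ℝ u y I) z 1 = fderiv ℝ (fun y => fderiv ℝ u y 1) z I
  rw [h1, h1]
  exact hsym 1 I

lemma integrable_cutoff_sq_mul {U : Set ℂ} {χ η h : ℂ → ℝ} (hU : IsOpen U)
    (hχk : HasCompactSupport χ) (hs : tsupport χ ⊆ U) (hη : Continuous η)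
    (hηs : tsupport η ⊆ tsupport χ) (hh : ContinuousOn h U) :
    Integrable fun z => η z ^ 2 * h z := by
  have hk : HasCompactSupport η := hχk.of_isClosed_subset (isClosed_tsupport _) hηs
  have hsub : tsupport (fun z => η z ^ 2) ⊆ tsupport η :=
    closure_mono fun z hz h => hz (by simp [h])
  refine (continuous_cutoff_mul hU (hη.pow 2) ((hsub.trans hηs).trans hs)
    hh).integrable_of_hasCompactSupport (HasCompactSupport.mul_right ?_)
  exact hk.of_isClosed_subset (isClosed_tsupport _) hsub

lemma continuousOn_inv_norm_pow_mul_exp {U : Set ℂ} {φ : ℂ → ℝ} (N : ℕ) (h0 : (0 : ℂ) ∉ U)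
    (hφ : Continuous φ) :
    ContinuousOn (fun z : ℂ => (‖z‖⁻¹) ^ (2 * N) * Real.exp (2 * φ z)) U := by
  refine ContinuousOn.mul ((continuousOn_id.norm.inv₀ fun z hz => ?_).pow _) ?_
  · exact norm_ne_zero_iff.2 fun h => h0 (by rw [← show z = 0 from h]; exact hz)
  · exact (Real.continuous_exp.comp (continuous_const.mul hφ)).continuousOn

/-- Carleman inequality for the gradient of `u`, applied to both Cauchy–Riemann components. -/
lemma carleman_gradient {u : ℂ → ℂ} {χ φ : ℂ → ℝ} {U : Set ℂ} (N : ℕ) (hU : IsOpen U)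
    (h0 : (0 : ℂ) ∉ U) (hu : ContDiffOn ℝ 2 u U) (hχ : ContDiff ℝ 1 χ) (hχk : HasCompactSupport χ)
    (hs : tsupport χ ⊆ U) (hφ : ContDiff ℝ 2 φ) :
    Integrable (fun z =>
      (fderiv ℝ (fun z => fderiv ℝ φ z 1) z 1 + fderiv ℝ (fun z => fderiv ℝ φ z I) z I) *
      (χ z ^ 2 * gradLen u z ^ 2 * ((‖z‖⁻¹) ^ (2 * N) * Real.exp (2 * φ z)))) ∧
    Integrable (fun z => ((fderiv ℝ χ z 1 ^ 2 + fderiv ℝ χ z I ^ 2) * gradLen u z ^ 2 +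
      χ z ^ 2 * ‖lap u z‖ ^ 2) * ((‖z‖⁻¹) ^ (2 * N) * Real.exp (2 * φ z))) ∧
    ∫ z, (fderiv ℝ (fun z => fderiv ℝ φ z 1) z 1 + fderiv ℝ (fun z => fderiv ℝ φ z I) z I) *
      (χ z ^ 2 * gradLen u z ^ 2 * ((‖z‖⁻¹) ^ (2 * N) * Real.exp (2 * φ z))) ≤
    ∫ z, ((fderiv ℝ χ z 1 ^ 2 + fderiv ℝ χ z I ^ 2) * gradLen u z ^ 2 +
      χ z ^ 2 * ‖lap u z‖ ^ 2) * ((‖z‖⁻¹) ^ (2 * N) * Real.exp (2 * φ z)) := by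
  set w : ℂ → ℝ := fun z => (‖z‖⁻¹) ^ (2 * N) * Real.exp (2 * φ z) with hw
  set Lφ : ℂ → ℝ := fun z =>
    fderiv ℝ (fun z => fderiv ℝ φ z 1) z 1 + fderiv ℝ (fun z => fderiv ℝ φ z I) z I with hLφ
  have hux := contDiffOn_pdx (m := 1) hU hu (by norm_num)
  have huy := contDiffOn_pdy (m := 1) hU hu (by norm_num)
  set g₁ : ℂ → ℂ := fun z => pdx u z - I * pdy u z with hg₁
  set g₂ : ℂ → ℂ := fun z => starRingEnd ℂ (pdx u z + I * pdy u z) with hg₂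
  have cg₁ : ContDiffOn ℝ 1 g₁ U := hux.sub (contDiffOn_const.mul huy)
  have cg₂ : ContDiffOn ℝ 1 g₂ U :=
    conjCLE.contDiff.comp_contDiffOn (hux.add (contDiffOn_const.mul huy))
  obtain ⟨i₁, l₁⟩ := carleman_cutoff N hU h0 cg₁ hχ hχk hs hφ
  obtain ⟨i₂, l₂⟩ := carleman_cutoff N hU h0 cg₂ hχ hχk hs hφ
  have hw0 : ∀ z, 0 ≤ w z := fun z => by positivity
  have hwc : ContinuousOn w U := continuousOn_inv_norm_pow_mul_exp N h0 hφ.continuous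
  have hφd : ∀ v, Continuous fun z => fderiv ℝ (fun z => fderiv ℝ φ z v) z v := fun v =>
    ((((hφ.fderiv_right (m := 1) (by norm_num)).clm_apply contDiff_const).continuous_fderiv
      one_ne_zero)).clm_apply continuous_const
  have hLc : Continuous Lφ := (hφd 1).add (hφd I)
  have hχd : ∀ v, Continuous fun z => fderiv ℝ χ z v := fun v =>
    (hχ.continuous_fderiv one_ne_zero).clm_apply continuous_const
  have hJ := continuousOn_sq_gradLen hU hu
  have hl := continuousOn_lap hU hu
  have s₁ : ∀ z ∈ U, pdx g₁ z + I * pdy g₁ z = lap u z := by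
    intro z hz
    have dx := (hux.contDiffAt (hU.mem_nhds hz)).differentiableAt one_ne_zero |>.hasFDerivAt
    have dy := (huy.contDiffAt (hU.mem_nhds hz)).differentiableAt one_ne_zero |>.hasFDerivAt
    have hc := pdx_pdy_comm hU hu hz
    have d := (dx.sub (dy.const_mul I)).fderiv
    simp only [lap, pdx, pdy] at hc ⊢
    erw [d]
    simp
    linear_combination -I * hc - (fderiv ℝ (pdy u) z I) * I_sq
  have s₂ : ∀ z ∈ U, pdx g₂ z + I * pdy g₂ z = starRingEnd ℂ (lap u z) := by
    intro z hz
    have dx := (hux.contDiffAt (hU.mem_nhds hz)).differentiableAt one_ne_zero |>.hasFDerivAt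
    have dy := (huy.contDiffAt (hU.mem_nhds hz)).differentiableAt one_ne_zero |>.hasFDerivAt
    have hc := congrArg (starRingEnd ℂ) (pdx_pdy_comm hU hu hz)
    have d := ((conjCLE : ℂ →L[ℝ] ℂ).hasFDerivAt.comp z (dx.add (dy.const_mul I))).fderiv
    simp only [lap, pdx, pdy] at hc ⊢
    erw [d]
    simp
    linear_combination -I * hc - (starRingEnd ℂ (fderiv ℝ (pdy u) z I)) * I_sq
  have hsum : ∀ z, ‖g₁ z‖ ^ 2 + ‖g₂ z‖ ^ 2 = 2 * gradLen u z ^ 2 := by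
    intro z
    rw [sq_gradLen, sq_norm_eq, sq_norm_eq, sq_norm_eq, sq_norm_eq]
    simp only [hg₁, hg₂, add_re, add_im, sub_re, sub_im, mul_re, mul_im, I_re, I_im, conj_re,
      conj_im]
    ring
  have jInt : ∀ g : ℂ → ℂ, ContDiffOn ℝ 1 g U →
      Integrable fun z => Lφ z * (χ z ^ 2 * ‖g z‖ ^ 2 * w z) := by
    intro g hg
    refine (integrable_cutoff_sq_mul hU hχk hs hχ.continuous subset_rfl
      ((hLc.continuousOn.mul (hg.continuousOn.norm.pow 2)).mul hwc)).congr (ae_of_all _ fun z => ?_)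
    simp only [Pi.mul_apply, Pi.pow_apply]
    ring
  have rInt : Integrable fun z => ((fderiv ℝ χ z 1 ^ 2 + fderiv ℝ χ z I ^ 2) * gradLen u z ^ 2 +
      χ z ^ 2 * ‖lap u z‖ ^ 2) * w z := by
    refine (((integrable_cutoff_sq_mul hU hχk hs (hχd 1) (tsupport_fderiv_apply_subset ℝ 1)
      (hJ.mul hwc)).add (integrable_cutoff_sq_mul hU hχk hs (hχd I)
      (tsupport_fderiv_apply_subset ℝ I) (hJ.mul hwc))).add
      (integrable_cutoff_sq_mul hU hχk hs hχ.continuous subset_rfl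
      ((hl.norm.pow 2).mul hwc))).congr (ae_of_all _ fun z => ?_)
    simp only [Pi.add_apply, Pi.mul_apply, Pi.pow_apply]
    ring
  have lInt : Integrable fun z => Lφ z * (χ z ^ 2 * gradLen u z ^ 2 * w z) := by
    refine (integrable_cutoff_sq_mul hU hχk hs hχ.continuous subset_rfl
      ((hLc.continuousOn.mul hJ).mul hwc)).congr (ae_of_all _ fun z => ?_)
    simp only [Pi.mul_apply]
    ring
  have hL : ∫ z, Lφ z * (χ z ^ 2 * ‖g₁ z‖ ^ 2 * w z) + Lφ z * (χ z ^ 2 * ‖g₂ z‖ ^ 2 * w z) =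
      2 * ∫ z, Lφ z * (χ z ^ 2 * gradLen u z ^ 2 * w z) := by
    rw [← integral_const_mul]
    refine integral_congr_ae (ae_of_all _ fun z => ?_)
    linear_combination Lφ z * χ z ^ 2 * w z * hsum z
  rw [integral_add (jInt g₁ cg₁) (jInt g₂ cg₂)] at hL
  have sq_add : ∀ a b : ℂ, ‖a + b‖ ^ 2 ≤ 2 * ‖a‖ ^ 2 + 2 * ‖b‖ ^ 2 := by
    intro a b
    have h : ‖a + b‖ ^ 2 ≤ (‖a‖ + ‖b‖) ^ 2 := by gcongr; exact norm_add_le a b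
    nlinarith [sq_nonneg (‖a‖ - ‖b‖)]
  have hR := integral_mono (i₁.add i₂) (rInt.const_mul 4) fun z => by
    by_cases hz : z ∈ tsupport χ
    · have hzU := hs hz
      simp only [Pi.add_apply]
      rw [s₁ z hzU, s₂ z hzU, ← add_mul, ← mul_assoc (4 : ℝ)]
      refine mul_le_mul_of_nonneg_right ?_ (hw0 z)
      refine (add_le_add (sq_add _ _) (sq_add _ _)).trans (le_of_eq ?_)
      have ha : ‖(fderiv ℝ χ z 1 + I * fderiv ℝ χ z I : ℂ)‖ ^ 2 =
          fderiv ℝ χ z 1 ^ 2 + fderiv ℝ χ z I ^ 2 := by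
        rw [sq_norm_eq]; simp
      simp only [norm_mul, mul_pow, ha, RCLike.norm_conj, norm_real, Real.norm_eq_abs, sq_abs]
      linear_combination 2 * (fderiv ℝ χ z 1 ^ 2 + fderiv ℝ χ z I ^ 2) * hsum z
    · have hz0 : χ =ᶠ[nhds z] fun _ => 0 := notMem_tsupport_iff_eventuallyEq.1 hz
      simp only [Pi.add_apply]
      rw [hz0.fderiv_eq, hz0.self_of_nhds]
      simp
  rw [integral_add' i₁ i₂, integral_const_mul] at hR
  exact ⟨lInt, rInt, by linarith⟩

/-- A cutoff of the annulus between `∂B_r` and `∂B_{5/4}` with scale-invariant gradient bounds. -/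
lemma exists_annular_cutoff : ∃ L : ℝ, 1 ≤ L ∧ ∀ r : ℝ, 0 < r → r < 1 / 2 →
    ∃ χ : ℂ → ℝ, ContDiff ℝ 1 χ ∧ HasCompactSupport χ ∧ tsupport χ ⊆ ball (0 : ℂ) 2 \ {0} ∧
      (∀ z, 0 ≤ χ z) ∧ (∀ z, χ z ≤ 1) ∧ (∀ z, r ≤ ‖z‖ → ‖z‖ ≤ 5 / 4 → χ z = 1) ∧
      (∀ z, ‖z‖ ≤ r / 2 → χ z = 0) ∧ (∀ z, 11 / 8 ≤ ‖z‖ → χ z = 0) ∧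
      (∀ z, ‖z‖ < 1 → fderiv ℝ χ z 1 ^ 2 + fderiv ℝ χ z I ^ 2 ≤ L / r ^ 2) ∧
      ∀ z, 1 ≤ ‖z‖ → fderiv ℝ χ z 1 ^ 2 + fderiv ℝ χ z I ^ 2 ≤ L := by
  let β : ContDiffBump (0 : ℂ) := ⟨1 / 2, 1, by norm_num, by norm_num⟩
  let ζ : ContDiffBump (0 : ℂ) := ⟨5 / 4, 11 / 8, by norm_num, by norm_num⟩
  have cβ : ContDiff ℝ 1 β := β.contDiff
  have cζ : ContDiff ℝ 1 ζ := ζ.contDiff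
  obtain ⟨b, hb⟩ := (β.hasCompactSupport.fderiv ℝ).exists_bound_of_continuous
    (cβ.continuous_fderiv one_ne_zero)
  obtain ⟨d, hd⟩ := (ζ.hasCompactSupport.fderiv ℝ).exists_bound_of_continuous
    (cζ.continuous_fderiv one_ne_zero)
  have opb : ∀ (T : ℂ →L[ℝ] ℝ) (c : ℝ), ‖T‖ ≤ c → T 1 ^ 2 + T I ^ 2 ≤ 2 * c ^ 2 := by
    intro T c hT
    have h : ∀ v : ℂ, ‖v‖ = 1 → T v ^ 2 ≤ c ^ 2 := fun v hv => by
      rw [← sq_abs]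
      have := T.le_of_opNorm_le hT v
      rw [hv, mul_one] at this
      gcongr
      exact this
    linarith [h 1 (by simp), h I (by simp)]
  have zero_of : ∀ z : ℂ, 1 ≤ ‖z‖ → β z = 0 := fun z hz =>
    β.zero_of_le_dist (by simpa using hz)
  have ζ1 : ∀ z : ℂ, ‖z‖ ≤ 5 / 4 → ζ z = 1 := fun z hz =>
    ζ.one_of_mem_closedBall (by simpa using hz)
  have ζ0 : ∀ z : ℂ, 11 / 8 ≤ ‖z‖ → ζ z = 0 := fun z hz => ζ.zero_of_le_dist (by simpa using hz)
  refine ⟨1 + 2 * b ^ 2 + 2 * d ^ 2, by nlinarith [sq_nonneg b, sq_nonneg d], fun r hr hr2 => ?_⟩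
  have hnorm : ∀ z : ℂ, ‖r⁻¹ • z‖ = ‖z‖ / r := fun z => by
    rw [norm_smul, Real.norm_eq_abs, abs_of_pos (inv_pos.2 hr)]; field_simp
  set χ : ℂ → ℝ := fun z => (1 - β (r⁻¹ • z)) * ζ z with hχ
  have χ0 : ∀ z, ‖z‖ ≤ r / 2 → χ z = 0 := by
    intro z hz
    have : β (r⁻¹ • z) = 1 := β.one_of_mem_closedBall (by
      rw [mem_closedBall_zero_iff, hnorm]
      change ‖z‖ / r ≤ 1 / 2
      rw [div_le_iff₀ hr]; linarith)
    simp only [hχ]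
    rw [this, sub_self, zero_mul]
  have χ0' : ∀ z, 11 / 8 ≤ ‖z‖ → χ z = 0 := fun z hz => by simp [hχ, ζ0 z hz]
  have hsupp : tsupport χ ⊆ closedBall 0 (11 / 8) \ ball 0 (r / 2) := by
    refine closure_minimal (fun z hz => ⟨?_, ?_⟩) (isClosed_closedBall.sdiff isOpen_ball)
    · by_contra h
      exact hz (χ0' z (by simpa using (not_le.1 (by simpa using h)).le))
    · intro h
      exact hz (χ0 z (by simpa using (mem_ball_zero_iff.1 h).le))
  refine ⟨χ, ?_, ?_, ?_, ?_, ?_, ?_, χ0, χ0', ?_, ?_⟩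
  · exact (contDiff_const.sub (cβ.comp (contDiff_const_smul _))).mul cζ
  · exact (isCompact_closedBall 0 (11 / 8)).of_isClosed_subset (isClosed_tsupport _)
      (hsupp.trans Set.sdiff_subset)
  · intro z hz
    have h := hsupp hz
    refine ⟨closedBall_subset_ball (by norm_num) h.1, fun h0 => h.2 ?_⟩
    rw [Set.mem_singleton_iff.1 h0]
    simpa using hr
  · exact fun z => mul_nonneg (sub_nonneg.2 β.le_one) ζ.nonneg
  · intro z
    exact mul_le_one₀ (sub_le_self _ β.nonneg) ζ.nonneg ζ.le_one
  · intro z h1 h2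
    simp only [hχ]
    rw [ζ1 z h2, zero_of _ (by rw [hnorm, le_div_iff₀ hr]; linarith)]
    norm_num
  · intro z hz
    have e : χ =ᶠ[nhds z] fun y => 1 - β (r⁻¹ • y) := by
      filter_upwards [isOpen_ball.mem_nhds (mem_ball_zero_iff.2 hz)] with y hy
      simp only [hχ]
      rw [ζ1 y (by linarith [mem_ball_zero_iff.1 hy]), mul_one]
    rw [e.fderiv_eq, fderiv_const_sub, fderiv_comp_smul]
    have h1 := opb _ b (hb (r⁻¹ • z))
    simp only [neg_apply, smul_apply, smul_eq_mul]
    rw [le_div_iff₀ (by positivity)]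
    have h2 : ((-(r⁻¹ * fderiv ℝ β (r⁻¹ • z) 1)) ^ 2 + (-(r⁻¹ * fderiv ℝ β (r⁻¹ • z) I)) ^ 2) *
        r ^ 2 = fderiv ℝ β (r⁻¹ • z) 1 ^ 2 + fderiv ℝ β (r⁻¹ • z) I ^ 2 := by
      field_simp
    rw [h2]
    nlinarith [sq_nonneg d]
  · intro z hz
    have hmem : {y : ℂ | r < ‖y‖} ∈ nhds z :=
      (isOpen_lt continuous_const continuous_norm).mem_nhds (show r < ‖z‖ by linarith)
    have e : χ =ᶠ[nhds z] ζ := by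
      filter_upwards [hmem] with y hy
      have hy' : r < ‖y‖ := hy
      simp only [hχ]
      rw [zero_of _ (by rw [hnorm, le_div_iff₀ hr]; linarith)]
      ring
    rw [e.fderiv_eq]
    nlinarith [opb _ d (hd z), sq_nonneg b]

lemma integrableOn_sq_gradLen {u : ℂ → ℂ} (hu : ContDiffOn ℝ 2 u (ball 0 2)) {ρ : ℝ}
    (hρ : ρ < 2) : IntegrableOn (fun z => gradLen u z ^ 2) (ball 0 ρ) :=
  (((continuousOn_sq_gradLen isOpen_ball hu).mono
    (closedBall_subset_ball hρ)).integrableOn_compact (isCompact_closedBall 0 ρ)).mono_set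
    ball_subset_closedBall

/-- The energy in the unit ball is controlled by the energies in a small and in a larger ball. -/
lemma exists_three_ball_bound : ∃ L : ℝ, 1 ≤ L ∧ ∀ (u : ℂ → ℂ) (V φ : ℂ → ℝ) (N : ℕ) (r δ m : ℝ),
    ContDiffOn ℝ 2 u (ball 0 2) → 0 < r → r < 1 / 2 → 0 < δ → Continuous V → HasCompactSupport V →
    (∀ z, 0 ≤ V z) →
    (∀ z : ℂ, ‖z‖ ≤ 3 / 2 → ‖lap u z‖ ^ 2 ≤ V z * (gradLen u z ^ 2 + δ)) → ContDiff ℝ 2 φ →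
    (∀ z : ℂ, ‖z‖ < 2 → V z + 1 ≤
      fderiv ℝ (fun z => fderiv ℝ φ z 1) z 1 + fderiv ℝ (fun z => fderiv ℝ φ z I) z I) →
    (∀ z : ℂ, ‖z‖ < 2 → |φ z| ≤ m) →
    Real.exp (-2 * m) * ((∫ z in ball 0 1, gradLen u z ^ 2) - ∫ z in ball 0 r, gradLen u z ^ 2) ≤
      L * Real.exp (2 * m) * ((2 / r) ^ (2 * N) / r ^ 2 * (∫ z in ball 0 r, gradLen u z ^ 2) +
        (4 / 5) ^ (2 * N) * ∫ z in ball 0 (11 / 8), gradLen u z ^ 2) +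
      δ * ((2 / r) ^ (2 * N) * Real.exp (2 * m) * ∫ z, V z) := by
  obtain ⟨L, hL, H⟩ := exists_annular_cutoff
  refine ⟨L, hL, ?_⟩
  intro u V φ N r δ m hu hr hr2 hδ hV hVk hV0 hlap hφ hφV hφm
  obtain ⟨χ, hχ, hχk, hs, χnn, χle, χ1, χ0, χ0', hin, hout⟩ := H r hr hr2
  set U : Set ℂ := ball 0 2 \ {0} with hU
  have oU : IsOpen U := isOpen_ball.sdiff isClosed_singleton
  have h0U : (0 : ℂ) ∉ U := fun h => h.2 rfl
  obtain ⟨iL, iR, hLR⟩ :=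
    carleman_gradient N oU h0U (hu.mono Set.sdiff_subset) hχ hχk hs hφ
  set J : ℂ → ℝ := fun z => gradLen u z ^ 2 with hJ
  have J0 : ∀ z, 0 ≤ J z := fun z => sq_nonneg _
  have jr : IntegrableOn J (ball 0 r) := integrableOn_sq_gradLen hu (by linarith)
  have j1 : IntegrableOn J (ball 0 1) := integrableOn_sq_gradLen hu (by norm_num)
  have j2 : IntegrableOn J (ball 0 (11 / 8)) := integrableOn_sq_gradLen hu (by norm_num)
  have Vi : Integrable V := hV.integrable_of_hasCompactSupport hVk
  set a := Real.exp (-2 * m) with ha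
  set b := Real.exp (2 * m) with hb
  have ha0 : 0 < a := Real.exp_pos _
  have hb0 : 0 < b := Real.exp_pos _
  set F₁ := (ball (0 : ℂ) 1).indicator J with hF₁
  set Fr := (ball (0 : ℂ) r).indicator J with hFr
  set F₂ := (ball (0 : ℂ) (11 / 8)).indicator J with hF₂
  have i₁ : Integrable F₁ := j1.integrable_indicator measurableSet_ball
  have ir : Integrable Fr := jr.integrable_indicator measurableSet_ball
  have i₂ : Integrable F₂ := j2.integrable_indicator measurableSet_ball
  have e₁ : ∫ z, F₁ z = ∫ z in ball 0 1, J z := integral_indicator measurableSet_ball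
  have er : ∫ z, Fr z = ∫ z in ball 0 r, J z := integral_indicator measurableSet_ball
  have e₂ : ∫ z, F₂ z = ∫ z in ball 0 (11 / 8), J z := integral_indicator measurableSet_ball
  set κ := (2 / r) ^ (2 * N) with hκ
  have hκ0 : 0 ≤ κ := by positivity
  have iA : Integrable fun z => a * (F₁ z - Fr z) := (i₁.sub ir).const_mul a
  have iB : Integrable fun z => L * b * (κ / r ^ 2 * Fr z + (4 / 5) ^ (2 * N) * F₂ z) :=
    ((ir.const_mul _).add (i₂.const_mul _)).const_mul _
  have iC : Integrable fun z => δ * (κ * b * V z) := (Vi.const_mul _).const_mul _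
  have key := integral_mono (iA.add iR) ((iB.add iC).add iL) fun z => by
    simp only [Pi.add_apply]
    set w := (‖z‖⁻¹) ^ (2 * N) * Real.exp (2 * φ z) with hw
    set G := fderiv ℝ χ z 1 ^ 2 + fderiv ℝ χ z I ^ 2 with hG
    set l := fderiv ℝ (fun z => fderiv ℝ φ z 1) z 1 + fderiv ℝ (fun z => fderiv ℝ φ z I) z I with hl
    have w0 : 0 ≤ w := by positivity
    have F₂0 : 0 ≤ F₂ z := Set.indicator_nonneg (fun z _ => J0 z) z
    have Fr0 : 0 ≤ Fr z := Set.indicator_nonneg (fun z _ => J0 z) z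
    have expb : ‖z‖ < 2 → Real.exp (2 * φ z) ≤ b := fun hz =>
      Real.exp_le_exp.2 (by linarith [(abs_le.1 (hφm z hz)).2])
    have expa : ‖z‖ < 2 → a ≤ Real.exp (2 * φ z) := fun hz =>
      Real.exp_le_exp.2 (by linarith [(abs_le.1 (hφm z hz)).1])
    have inner_w : r / 2 ≤ ‖z‖ → ‖z‖ < 2 → w ≤ κ * b := fun h1 h2 => by
      have : ‖z‖⁻¹ ≤ 2 / r := by
        rw [← inv_div]; exact inv_anti₀ (by positivity) h1
      exact mul_le_mul (pow_le_pow_left₀ (by positivity) this _) (expb h2) (Real.exp_pos _).le hκ0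
    have tA : a * (F₁ z - Fr z) ≤ χ z ^ 2 * J z * w := by
      have hnn : 0 ≤ χ z ^ 2 * J z * w := by have := J0 z; positivity
      by_cases h1 : z ∈ ball (0 : ℂ) 1
      · by_cases h2 : z ∈ ball (0 : ℂ) r
        · simpa [hF₁, hFr, Set.indicator_of_mem h1, Set.indicator_of_mem h2] using hnn
        · have h1' := mem_ball_zero_iff.1 h1
          have h2' : r ≤ ‖z‖ := by simpa using h2
          rw [hF₁, hFr, Set.indicator_of_mem h1, Set.indicator_of_notMem h2,
            χ1 z h2' (by linarith), sub_zero, one_pow, one_mul, mul_comm]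
          refine mul_le_mul_of_nonneg_left ?_ (J0 z)
          have : 1 ≤ ‖z‖⁻¹ := (one_le_inv₀ (by linarith)).2 h1'.le
          calc a ≤ 1 * Real.exp (2 * φ z) := by rw [one_mul]; exact expa (by linarith)
            _ ≤ w := mul_le_mul_of_nonneg_right (one_le_pow₀ this) (Real.exp_pos _).le
      · rw [hF₁, Set.indicator_of_notMem h1]
        nlinarith
    have tC : δ * (χ z ^ 2 * V z * w) ≤ δ * (κ * b * V z) := by
      refine mul_le_mul_of_nonneg_left ?_ hδ.le
      by_cases hz : χ z = 0
      · rw [hz]; have := hV0 z; simp; positivity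
      have h1 : r / 2 ≤ ‖z‖ := by by_contra h; exact hz (χ0 z (not_le.1 h).le)
      have h2 : ‖z‖ < 11 / 8 := by by_contra h; exact hz (χ0' z (not_lt.1 h))
      have h3 : χ z ^ 2 * V z ≤ V z :=
        mul_le_of_le_one_left (hV0 z) (pow_le_one₀ (χnn z) (χle z))
      calc χ z ^ 2 * V z * w ≤ V z * (κ * b) :=
            mul_le_mul h3 (inner_w h1 (by linarith)) w0 (hV0 z)
        _ = _ := by ring
    have tB : G * J z * w ≤ L * b * (κ / r ^ 2 * Fr z + (4 / 5) ^ (2 * N) * F₂ z) := by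
      have hL0 : 0 ≤ L := by linarith
      by_cases hGz : G = 0
      · rw [hGz]; simp; positivity
      have grad0 : fderiv ℝ χ z = 0 → False := fun h => hGz (by simp [hG, h])
      have hne0 : χ z ≠ 0 := fun h => grad0
        (IsLocalMin.fderiv_eq_zero (Filter.Eventually.of_forall fun y => by rw [h]; exact χnn y))
      have hne1 : χ z ≠ 1 := fun h => grad0
        (IsLocalMax.fderiv_eq_zero (Filter.Eventually.of_forall fun y => by rw [h]; exact χle y))
      have h1 : r / 2 ≤ ‖z‖ := by by_contra h; exact hne0 (χ0 z (not_le.1 h).le)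
      have h2 : ‖z‖ < 11 / 8 := by by_contra h; exact hne0 (χ0' z (not_lt.1 h))
      by_cases h3 : ‖z‖ < r
      · have hFr' : Fr z = J z := Set.indicator_of_mem (mem_ball_zero_iff.2 h3) J
        calc G * J z * w ≤ L / r ^ 2 * J z * (κ * b) :=
              mul_le_mul (mul_le_mul_of_nonneg_right (hin z (by linarith)) (J0 z))
                (inner_w h1 (by linarith)) w0 (by have := J0 z; positivity)
          _ = L * b * (κ / r ^ 2 * Fr z) := by rw [hFr']; ring
          _ ≤ _ := by gcongr; simp; positivity
      · have h4 : 5 / 4 < ‖z‖ := by by_contra h; exact hne1 (χ1 z (not_lt.1 h3) (not_lt.1 h))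
        have hF₂' : F₂ z = J z := Set.indicator_of_mem (mem_ball_zero_iff.2 h2) J
        have hw' : w ≤ (4 / 5) ^ (2 * N) * b := by
          have : ‖z‖⁻¹ ≤ 4 / 5 := by
            rw [← inv_div]; exact inv_anti₀ (by positivity) h4.le
          exact mul_le_mul (pow_le_pow_left₀ (by positivity) this _) (expb (by linarith))
            (Real.exp_pos _).le (by positivity)
        calc G * J z * w ≤ L * J z * ((4 / 5) ^ (2 * N) * b) :=
              mul_le_mul (mul_le_mul_of_nonneg_right (hout z (by linarith)) (J0 z)) hw' w0
                (by have := J0 z; positivity)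
          _ = L * b * ((4 / 5) ^ (2 * N) * F₂ z) := by rw [hF₂']; ring
          _ ≤ _ := by gcongr; simp; positivity
    have tL : χ z ^ 2 * ‖lap u z‖ ^ 2 * w + χ z ^ 2 * J z * w ≤
        l * (χ z ^ 2 * J z * w) + δ * (χ z ^ 2 * V z * w) := by
      by_cases hz : χ z = 0
      · simp [hz]
      have h2 : ‖z‖ < 11 / 8 := by by_contra h; exact hz (χ0' z (not_lt.1 h))
      have h3 := mul_le_mul_of_nonneg_left (hlap z (by linarith))
        (mul_nonneg (sq_nonneg (χ z)) w0)
      have h4 := mul_le_mul_of_nonneg_right (hφV z (by linarith))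
        (mul_nonneg (mul_nonneg (sq_nonneg (χ z)) (J0 z)) w0)
      have hJz : gradLen u z ^ 2 = J z := rfl
      rw [hJz] at h3
      linarith
    have hJz : gradLen u z ^ 2 = J z := rfl
    rw [add_mul]
    linarith
  rw [integral_add' iA iR, integral_add' (iB.add iC) iL, integral_add' iB iC, integral_const_mul,
    integral_const_mul, integral_const_mul, integral_const_mul, integral_sub i₁ ir,
    integral_add (ir.const_mul _) (i₂.const_mul _), integral_const_mul, integral_const_mul,
    e₁, er, e₂] at key
  linarith

lemma eLpNorm_gradLen_eq {u : ℂ → ℂ} (hu : ContDiffOn ℝ 2 u (ball 0 2)) {ρ : ℝ} (hρ : ρ < 2) :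
    eLpNorm (gradLen u) 2 (volume.restrict (ball 0 ρ)) =
      ENNReal.ofReal (Real.sqrt (∫ z in ball 0 ρ, gradLen u z ^ 2)) := by
  have hc : ContinuousOn (gradLen u) (ball 0 2) :=
    (continuousOn_sq_gradLen isOpen_ball hu).sqrt.congr fun z _ =>
      (Real.sqrt_sq (Real.sqrt_nonneg _)).symm
  have hm : AEStronglyMeasurable (gradLen u) (volume.restrict (ball 0 ρ)) :=
    (hc.mono (ball_subset_ball hρ.le)).aestronglyMeasurable measurableSet_ball
  have hL : MemLp (gradLen u) 2 (volume.restrict (ball 0 ρ)) :=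
    (memLp_two_iff_integrable_sq hm).2 (integrableOn_sq_gradLen hu hρ)
  rw [hL.eLpNorm_eq_integral_rpow_norm (by norm_num) (by norm_num), Real.sqrt_eq_rpow]
  norm_num

lemma exists_propagation_bound (q : ℝ≥0∞) (hq : 2 < q) :
    ∃ L : ℝ, 1 ≤ L ∧ ∀ (M K : ℝ) (W : ℂ → ℂ × ℂ) (u : ℂ → ℂ), 0 ≤ M → 1 ≤ K → Measurable W →
      eLpNorm (pairLen W) q (volume.restrict (ball 0 2)) ≤ ENNReal.ofReal M →
      ContDiffOn ℝ 2 u (ball 0 2) →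
      (∀ᵐ z : ℂ, z ∈ ball (0 : ℂ) 2 → lap u z = wDot W u z) →
      (∀ᵐ z : ℂ, z ∈ ball (0 : ℂ) 2 → ‖u z‖ ≤ K) →
      ∫ z in ball 0 (11 / 8), gradLen u z ^ 2 ≤ L * ((1 + M) * K) ^ 2 ∧
      ∀ (N : ℕ) (r : ℝ), 0 < r → r < 1 / 2 →
        (∫ z in ball 0 1, gradLen u z ^ 2) - ∫ z in ball 0 r, gradLen u z ^ 2 ≤
          L * Real.exp (4 * (L * (1 + M ^ 2))) *
            ((2 / r) ^ (2 * N) / r ^ 2 * (∫ z in ball 0 r, gradLen u z ^ 2) +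
              (4 / 5) ^ (2 * N) * ∫ z in ball 0 (11 / 8), gradLen u z ^ 2) := by
  obtain ⟨B, hB, HB⟩ := exists_weight q hq
  obtain ⟨D, hD, HD⟩ := exists_energy_bound
  obtain ⟨L, hL, HL⟩ := exists_three_ball_bound
  refine ⟨L + B + D * (1 + B), by have := mul_nonneg hD (by positivity : 0 ≤ 1 + B); linarith, ?_⟩
  set A := L + B + D * (1 + B) with hA
  have hDB : 0 ≤ D * (1 + B) := by positivity
  intro M K W u hM hK hWm hW hu heq huK
  refine ⟨?_, fun N r hr hr2 => ?_⟩
  · obtain ⟨V, φ, hV, hVk, hV0, hlap, hVint, -⟩ := HB M W u hM hWm hW hu heq 1 one_pos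
    refine (HD u V K hK hu hV hVk hV0 hlap huK).trans ?_
    have h1 : 1 + ∫ z, V z ≤ (1 + B) * (1 + M) ^ 2 := by
      nlinarith [mul_nonneg hB hM, sq_nonneg M]
    calc D * K ^ 2 * (1 + ∫ z, V z) ≤ D * K ^ 2 * ((1 + B) * (1 + M) ^ 2) := by gcongr
      _ = D * (1 + B) * ((1 + M) * K) ^ 2 := by ring
      _ ≤ A * ((1 + M) * K) ^ 2 := by gcongr; linarith
  · set m := A * (1 + M ^ 2) with hm
    set E₁ := ∫ z in ball 0 1, gradLen u z ^ 2
    set Er := ∫ z in ball 0 r, gradLen u z ^ 2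
    set E₂ := ∫ z in ball 0 (11 / 8), gradLen u z ^ 2
    have Er0 : 0 ≤ Er := integral_nonneg fun _ => sq_nonneg _
    have E₂0 : 0 ≤ E₂ := integral_nonneg fun _ => sq_nonneg _
    set S := (2 / r) ^ (2 * N) / r ^ 2 * Er + (4 / 5) ^ (2 * N) * E₂ with hS
    have S0 : 0 ≤ S := by positivity
    set T := (2 / r) ^ (2 * N) * Real.exp (2 * m) * (B * M ^ 2) with hT
    have T0 : 0 ≤ T := by positivity
    have step : Real.exp (-2 * m) * (E₁ - Er) ≤ L * Real.exp (2 * m) * S := by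
      refine le_of_forall_pos_le_add fun ε hε => ?_
      have hδ : 0 < ε / (T + 1) := by positivity
      obtain ⟨V, φ, hV, hVk, hV0, hlap, hVint, hφ, hφV, hφb⟩ :=
        HB M W u hM hWm hW hu heq _ hδ
      refine (HL u V φ N r _ m hu hr hr2 hδ hV hVk hV0 hlap hφ hφV fun z hz => ?_).trans ?_
      · refine (hφb z hz).trans ?_
        rw [hm]
        gcongr
        linarith
      · refine add_le_add_right ?_ _
        calc ε / (T + 1) * ((2 / r) ^ (2 * N) * Real.exp (2 * m) * ∫ z, V z)
            ≤ ε / (T + 1) * T := by rw [hT]; gcongr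
          _ ≤ ε := by
            rw [div_mul_eq_mul_div, div_le_iff₀ (by positivity)]
            nlinarith
    have hexp : Real.exp (2 * m) * Real.exp (-2 * m) = 1 := by
      rw [← Real.exp_add]; simp
    have hexp4 : Real.exp (4 * m) = Real.exp (2 * m) * Real.exp (2 * m) := by
      rw [← Real.exp_add]; ring_nf
    calc E₁ - Er = Real.exp (2 * m) * (Real.exp (-2 * m) * (E₁ - Er)) := by
          rw [← mul_assoc, hexp, one_mul]
      _ ≤ Real.exp (2 * m) * (L * Real.exp (2 * m) * S) := by gcongr
      _ = L * Real.exp (4 * m) * S := by rw [hexp4]; ring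
      _ ≤ A * Real.exp (4 * m) * S := by gcongr; linarith

lemma sq_le_one_add_rpow {M : ℝ} (hM : 0 ≤ M) {q : ℝ≥0∞} (hq : 2 < q) :
    M ^ 2 ≤ 1 + M ^ (2 / (1 - 2 / q.toReal)) := by
  have hμ : (2 : ℝ) ≤ 2 / (1 - 2 / q.toReal) := by
    by_cases h : q = ∞
    · simp [h]
    · have h2 : 2 < q.toReal := by
        have := (ENNReal.toReal_lt_toReal (by norm_num) h).2 hq
        simpa using this
      have h3 : 2 / q.toReal < 1 := (div_lt_one (by linarith)).2 h2
      have h4 : 0 < 2 / q.toReal := by positivity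
      rw [le_div_iff₀ (by linarith)]
      linarith
  rcases le_total M 1 with h | h
  · have := Real.rpow_nonneg hM (2 / (1 - 2 / q.toReal))
    nlinarith
  · have := Real.rpow_le_rpow_of_exponent_le h hμ
    rw [Real.rpow_two] at this
    linarith

/-- From the propagation inequality to a lower bound by a power of the radius. -/
lemma exists_radius_pow_le {E : ℝ → ℝ} {E₁ E₂ L m c Y : ℝ} (hL : 1 ≤ L) (hm : 0 ≤ m) (hc : 0 < c)
    (hcY : c ≤ Y) (hE₁ : c ^ 2 ≤ E₁) (hE₂ : E₂ ≤ L * Y ^ 2)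
    (H : ∀ (N : ℕ) (r : ℝ), 0 < r → r < 1 / 2 → E₁ - E r ≤ L * Real.exp (4 * m) *
      ((2 / r) ^ (2 * N) / r ^ 2 * E r + (4 / 5) ^ (2 * N) * E₂)) {p : ℝ}
    (hp : (4 * m + 2 * Real.log (2 * L * Y / c)) / Real.log (5 / 4) + 5 ≤ p) :
    ∃ R > (0 : ℝ), R ≤ 1 ∧ ∀ r, 0 < r → r ≤ R → r ^ p ≤ E r := by
  set ℓ := Real.log (5 / 4) with hℓ
  have hℓ0 : 0 < ℓ := Real.log_pos (by norm_num)
  set D := 2 * L * Y / c with hD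
  have hD1 : 1 ≤ D := by
    rw [hD, le_div_iff₀ hc]; nlinarith
  have hD0 : 0 < D := by linarith
  set X := (4 * m + 2 * Real.log D) / (2 * ℓ) with hX
  have hX0 : 0 ≤ X := by have := Real.log_nonneg hD1; positivity
  set N := ⌈X⌉₊ with hN
  have hNp : ((2 * N + 3 : ℕ) : ℝ) ≤ p := by
    have h1 := (Nat.ceil_lt_add_one hX0).le
    have h2 : (4 * m + 2 * Real.log D) / ℓ = 2 * X := by rw [hX]; field_simp
    rw [h2] at hp
    push_cast
    linarith
  have h54 : Real.exp (4 * m) * D ^ 2 ≤ (5 / 4) ^ (2 * N) := by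
    have h1 : (5 / 4 : ℝ) ^ (2 * N) = Real.exp (ℓ * (2 * N)) := by
      rw [← Real.rpow_natCast, Real.rpow_def_of_pos (by norm_num)]
      push_cast; rfl
    have h2 : D ^ 2 = Real.exp (2 * Real.log D) := by
      rw [two_mul, Real.exp_add, Real.exp_log hD0, sq]
    rw [h1, h2, ← Real.exp_add]
    apply Real.exp_le_exp.2
    have h3 : 4 * m + 2 * Real.log D = X * (2 * ℓ) := by rw [hX]; field_simp
    have := Nat.le_ceil X
    rw [h3]
    nlinarith
  have hexp0 := Real.exp_pos (4 * m)
  have houter : L * Real.exp (4 * m) * ((4 / 5) ^ (2 * N) * E₂) ≤ c ^ 2 / 4 := by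
    have h1 : (4 / 5 : ℝ) ^ (2 * N) * (5 / 4) ^ (2 * N) = 1 := by
      rw [← mul_pow]; norm_num
    have h2 : L * Real.exp (4 * m) * ((4 / 5) ^ (2 * N) * E₂) ≤
        L * Real.exp (4 * m) * ((4 / 5) ^ (2 * N) * (L * Y ^ 2)) := by gcongr
    have h3 : L * Real.exp (4 * m) * ((4 / 5) ^ (2 * N) * (L * Y ^ 2)) =
        (4 / 5) ^ (2 * N) * (Real.exp (4 * m) * D ^ 2) * (c ^ 2 / 4) := by
      rw [hD]; field_simp; ring
    have h4 : (4 / 5 : ℝ) ^ (2 * N) * (Real.exp (4 * m) * D ^ 2) ≤ 1 := by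
      rw [← h1]; gcongr
    rw [h3] at h2
    nlinarith [sq_nonneg c]
  set κ := c ^ 2 / (2 * (L * Real.exp (4 * m)) * 2 ^ (2 * N)) with hκ
  have hκ0 : 0 < κ := by positivity
  refine ⟨min (1 / 4) (min (c ^ 2 / 4) κ), by positivity, (min_le_left _ _).trans (by norm_num), ?_⟩
  intro r hr hrR
  have r4 : r ≤ 1 / 4 := hrR.trans (min_le_left _ _)
  have rc : r ≤ c ^ 2 / 4 := hrR.trans ((min_le_right _ _).trans (min_le_left _ _))
  have rκ : r ≤ κ := hrR.trans ((min_le_right _ _).trans (min_le_right _ _))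
  have hr1 : r ≤ 1 := by linarith
  have hpow : r ^ p ≤ r ^ (2 * N + 3) := by
    rw [← Real.rpow_natCast]
    exact Real.rpow_le_rpow_of_exponent_ge hr hr1 hNp
  refine hpow.trans ?_
  by_cases hbig : c ^ 2 / 4 ≤ E r
  · exact (pow_le_of_le_one hr.le hr1 (by omega)).trans (rc.trans hbig)
  have h1 := H N r hr (by linarith)
  have h2 : c ^ 2 / 2 ≤ L * Real.exp (4 * m) * ((2 / r) ^ (2 * N) / r ^ 2 * E r) := by
    rw [mul_add] at h1
    linarith [not_le.1 hbig]
  have h3 : κ * r ^ (2 * N + 2) ≤ E r := by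
    have h4 : L * Real.exp (4 * m) * ((2 / r) ^ (2 * N) / r ^ 2 * E r) =
        L * Real.exp (4 * m) * 2 ^ (2 * N) * E r / r ^ (2 * N + 2) := by
      rw [div_pow]; field_simp; ring
    rw [h4, le_div_iff₀ (by positivity)] at h2
    rw [hκ, div_mul_eq_mul_div, div_le_iff₀ (by positivity)]
    linarith
  calc r ^ (2 * N + 3) = r * r ^ (2 * N + 2) := by ring
    _ ≤ κ * r ^ (2 * N + 2) := by gcongr
    _ ≤ E r := h3

/-- Theorem 3 (order of vanishing on `B₂`).  Here `μ = 2q/(q-2) = 2/(1 - 2/q)`,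
with `μ = 2` when `q = ∞`; `c` is universal and `C = C(q)`. -/
theorem statement3 :
    ∃ c > (0 : ℝ), ∀ q : ℝ≥0∞, 2 < q → ∃ C > (0 : ℝ),
      ∀ (M chat Chat : ℝ), 0 ≤ M → 0 < chat → chat ≤ 1 → 1 ≤ Chat →
      ∀ (W : ℂ → ℂ × ℂ) (u : ℂ → ℂ),
        Measurable W →
        eLpNorm (pairLen W) q (volume.restrict (ball 0 2)) ≤ ENNReal.ofReal M →
        ContDiffOn ℝ 2 u (ball 0 2) →
        (∀ᵐ z : ℂ, z ∈ ball (0 : ℂ) 2 → lap u z = wDot W u z) →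
        eLpNorm u ∞ (volume.restrict (ball 0 2)) ≤ ENNReal.ofReal Chat →
        ENNReal.ofReal chat ≤ eLpNorm (gradLen u) 2 (volume.restrict (ball 0 1)) →
        ∃ rStar > (0 : ℝ), ∀ r : ℝ, 0 < r → r ≤ rStar →
          ENNReal.ofReal (r ^ (C * (1 + M ^ (2 / (1 - 2 / q.toReal))) +
              c * Real.log (C * Chat * (1 + M) / chat))) ≤
            eLpNorm (gradLen u) 2 (volume.restrict (ball 0 r)) := by
  have hℓ : 0 < Real.log (5 / 4) := Real.log_pos (by norm_num)
  refine ⟨1 / Real.log (5 / 4), by positivity, fun q hq => ?_⟩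
  obtain ⟨L, hL, H⟩ := exists_propagation_bound q hq
  set ℓ := Real.log (5 / 4)
  refine ⟨4 * L / ℓ + 2 * L + 3, by positivity, ?_⟩
  set C := 4 * L / ℓ + 2 * L + 3 with hC
  intro M chat Chat hM hc hc1 hK W u hWm hW hu heq huK hgrad
  have huK' : ∀ᵐ z : ℂ, z ∈ ball (0 : ℂ) 2 → ‖u z‖ ≤ Chat := by
    rw [← ae_restrict_iff' measurableSet_ball]
    rw [eLpNorm_exponent_top] at huK
    filter_upwards [ae_le_eLpNormEssSup (f := u) (μ := volume.restrict (ball 0 2))] with z hz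
    have := hz.trans huK
    rwa [← ofReal_norm, ENNReal.ofReal_le_ofReal_iff (by linarith)] at this
  obtain ⟨hE₂, hprop⟩ := H M Chat W u hM hK hWm hW hu heq huK'
  rw [eLpNorm_gradLen_eq hu (by norm_num),
    ENNReal.ofReal_le_ofReal_iff (Real.sqrt_nonneg _)] at hgrad
  have hE₁ : chat ^ 2 ≤ ∫ z in ball 0 1, gradLen u z ^ 2 :=
    (Real.le_sqrt' hc).1 hgrad
  have hY : 1 ≤ (1 + M) * Chat := by nlinarith
  set μ := 2 / (1 - 2 / q.toReal)
  have hμ : M ^ 2 ≤ 1 + M ^ μ := sq_le_one_add_rpow hM hq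
  have hμ0 : 0 ≤ M ^ μ := Real.rpow_nonneg hM _
  set p := C * (1 + M ^ μ) + 1 / ℓ * Real.log (C * Chat * (1 + M) / chat) with hp
  have hpp : (4 * (L * (1 + M ^ 2)) + 2 * Real.log (2 * L * ((1 + M) * Chat) / chat)) / ℓ + 5 ≤
      p * 2 := by
    have hlog : Real.log (2 * L * ((1 + M) * Chat) / chat) ≤
        Real.log (C * Chat * (1 + M) / chat) := by
      apply Real.log_le_log (by positivity)
      have h1 : 2 * L ≤ C := by
        have : 0 ≤ 4 * L / ℓ := by positivity
        linarith
      rw [mul_assoc C, mul_comm Chat]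
      gcongr
    have h2 : 2 * Real.log (2 * L * ((1 + M) * Chat) / chat) / ℓ ≤
        2 * Real.log (C * Chat * (1 + M) / chat) / ℓ := by gcongr
    have h3 : 4 * (L * (1 + M ^ 2)) / ℓ ≤ 2 * (4 * L / ℓ) * (1 + M ^ μ) := by
      have h4 : 4 * (L * (1 + M ^ 2)) / ℓ = 4 * L / ℓ * (1 + M ^ 2) := by ring
      have h5 : 0 ≤ 4 * L / ℓ := by positivity
      rw [h4, mul_comm 2, mul_assoc]
      gcongr
      linarith
    have h6 : 5 ≤ 2 * (2 * L + 3) * (1 + M ^ μ) := by nlinarith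
    have h7 : p * 2 = 2 * (4 * L / ℓ) * (1 + M ^ μ) + 2 * (2 * L + 3) * (1 + M ^ μ) +
        2 * Real.log (C * Chat * (1 + M) / chat) / ℓ := by rw [hp, hC]; ring
    rw [h7, add_div]
    linarith
  obtain ⟨R, hR, hR1, hRE⟩ := exists_radius_pow_le
    (E := fun r => ∫ z in ball 0 r, gradLen u z ^ 2) (m := L * (1 + M ^ 2)) hL (by positivity) hc
    (hc1.trans hY) hE₁ hE₂ hprop hpp
  refine ⟨R, hR, fun r hr hrR => ?_⟩
  rw [eLpNorm_gradLen_eq hu (by linarith)]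
  refine ENNReal.ofReal_le_ofReal (Real.le_sqrt_of_sq_le ?_)
  rw [← Real.rpow_two, ← Real.rpow_mul hr.le]
  exact hRE r hr hrR

end
end

section
/- Let d ∈ (1,2], q₁ ∈ [2,∞], q₂ ∈ (2,∞], and M₁, M₂ ≥ 0. Let W₁, W₂ : B_d → ℝ² be measurable with ‖W_j‖_{L^{q_j}(B_d)} ≤ M_j for j = 1,2, and let u₁, u₂ ∈ C¹(B_d, ℝ). Set h = T[W₁(u₂) − W₁(u₁)], and define the matrix-valued function G : B_d → ℂ^{2×2} by G₁₁ = G₂₂ = 0, G₁₂ = −W₂(u₂)·e^{h}, and G₂₁ = W₂(u₁)·e^{−h}. If q₁ > 2 set q = q₂ and α = 1; if q₁ = 2 fix any q ∈ (2,q₂) and set α = 2. Then there exists a constant C > 0, depending only on q₁, q₂ and q, such that Σ_{j,k}‖G_{jk}‖_{L^q(B_d)} ≤ C·M₂·exp(C·M₁^{α}). -/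
open MeasureTheory Metric Complex ENNReal

noncomputable section

def pdxR (u : ℂ → ℝ) (z : ℂ) : ℝ := fderiv ℝ u z 1

def pdyR (u : ℂ → ℝ) (z : ℂ) : ℝ := fderiv ℝ u z Complex.I

/-- Wirtinger derivative `∂u = (1/2)(∂ₓu - i ∂_y u)` of a real-valued function. -/
def wirtR (u : ℂ → ℝ) (z : ℂ) : ℂ :=
  (1 / 2 : ℂ) * ((pdxR u z : ℂ) - Complex.I * (pdyR u z : ℂ))

/-- Wirtinger derivative `∂̄u = (1/2)(∂ₓu + i ∂_y u)` of a real-valued function. -/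
def wirtbarR (u : ℂ → ℝ) (z : ℂ) : ℂ :=
  (1 / 2 : ℂ) * ((pdxR u z : ℂ) + Complex.I * (pdyR u z : ℂ))

/-- The coefficient `W_k(u_j)(z) = (1/4)(W_k + conj(W_k) ∂̄u_j/∂u_j)` when
`∂u_j(z) ≠ 0` and `0` otherwise. -/
def Wop (Wk : ℂ → ℂ) (u : ℂ → ℝ) (z : ℂ) : ℂ :=
  if wirtR u z ≠ 0 then
    (1 / 4 : ℂ) * (Wk z + (starRingEnd ℂ) (Wk z) * (wirtbarR u z / wirtR u z))
  else 0

/-- The Cauchy–Pompeiu transform on `B_d`:  `Tω(z) = (1/π) ∫_{B_d} ω(ξ)/(ξ-z) dA(ξ)`. -/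
def cauchyT (d : ℝ) (ω : ℂ → ℂ) (z : ℂ) : ℂ :=
  (1 / (Real.pi : ℂ)) * ∫ ξ in ball (0 : ℂ) d, ω ξ / (ξ - z)

lemma wirtbarR_eq_conj (u : ℂ → ℝ) (z : ℂ) : wirtbarR u z = (starRingEnd ℂ) (wirtR u z) := by
  simp [wirtbarR, wirtR, Complex.ext_iff]

lemma norm_Wop_le (W : ℂ → ℂ) (u : ℂ → ℝ) (z : ℂ) : ‖Wop W u z‖ ≤ (1 / 2) * ‖W z‖ := by
  unfold Wop
  split_ifs with h
  · have h1 : ‖wirtbarR u z / wirtR u z‖ = 1 := by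
      rw [norm_div, wirtbarR_eq_conj, RCLike.norm_conj, div_self (norm_ne_zero_iff.2 h)]
    have h2 := norm_add_le (W z) ((starRingEnd ℂ) (W z) * (wirtbarR u z / wirtR u z))
    rw [norm_mul ((starRingEnd ℂ) (W z)), h1, RCLike.norm_conj] at h2
    rw [norm_mul, show ‖(1 / 4 : ℂ)‖ = 1 / 4 by simp]
    linarith
  · simp

lemma norm_Wop_sub_Wop_le (W : ℂ → ℂ) (u v : ℂ → ℝ) (z : ℂ) :
    ‖Wop W u z - Wop W v z‖ ≤ ‖W z‖ := by
  have := norm_sub_le (Wop W u z) (Wop W v z)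
  linarith [norm_Wop_le W u z, norm_Wop_le W v z]

lemma ofReal_norm_cauchyT_le (d : ℝ) {ω W : ℂ → ℂ} (h : ∀ z, ‖ω z‖ ≤ ‖W z‖) (z : ℂ) :
    ENNReal.ofReal ‖cauchyT d ω z‖ ≤
      ∫⁻ ξ in ball (0 : ℂ) d, ENNReal.ofReal (‖W ξ‖ / ‖ξ - z‖) := by
  have hpi : ‖(1 / (Real.pi : ℂ))‖ ≤ 1 := by
    rw [norm_div, norm_one, Complex.norm_real, Real.norm_of_nonneg Real.pi_pos.le]
    rw [div_le_one Real.pi_pos]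
    linarith [Real.pi_gt_three]
  have h1 : ‖cauchyT d ω z‖ ≤ ‖∫ ξ in ball (0 : ℂ) d, ω ξ / (ξ - z)‖ := by
    rw [cauchyT, norm_mul]
    exact mul_le_of_le_one_left (norm_nonneg _) hpi
  calc ENNReal.ofReal ‖cauchyT d ω z‖
      ≤ ENNReal.ofReal ‖∫ ξ in ball (0 : ℂ) d, ω ξ / (ξ - z)‖ := ENNReal.ofReal_le_ofReal h1
    _ = ‖∫ ξ in ball (0 : ℂ) d, ω ξ / (ξ - z)‖ₑ := ofReal_norm _
    _ ≤ ∫⁻ ξ in ball (0 : ℂ) d, ‖ω ξ / (ξ - z)‖ₑ := enorm_integral_le_lintegral_enorm _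
    _ ≤ _ := by
      refine lintegral_mono fun ξ => ?_
      rw [← ofReal_norm, norm_div]
      exact ENNReal.ofReal_le_ofReal (by gcongr; exact h ξ)

lemma lintegral_ball_comp_sub_le (g : ℂ → ℝ≥0∞) {d : ℝ} (hd : d ≤ 2) {z : ℂ}
    (hz : z ∈ ball (0 : ℂ) d) :
    ∫⁻ ξ in ball (0 : ℂ) d, g (ξ - z) ≤ ∫⁻ x in ball (0 : ℂ) 4, g x := by
  rw [← lintegral_indicator measurableSet_ball, ← lintegral_indicator measurableSet_ball,
    ← lintegral_sub_right_eq_self ((ball (0 : ℂ) 4).indicator g) z]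
  refine lintegral_mono fun ξ => ?_
  by_cases hξ : ξ ∈ ball (0 : ℂ) d
  · have : ξ - z ∈ ball (0 : ℂ) 4 := by
      rw [mem_ball_zero_iff] at *
      linarith [norm_sub_le ξ z]
    simp [Set.indicator_of_mem hξ, Set.indicator_of_mem this]
  · simp [Set.indicator_of_notMem hξ]

lemma lintegral_ball_norm_rpow_lt_top {s : ℝ} (hs : s < 2) (R : ℝ) :
    ∫⁻ x in ball (0 : ℂ) R, ENNReal.ofReal (‖x‖ ^ (-s)) < ∞ := by
  have h : IntegrableOn (fun x : ℂ => ‖x‖ ^ (-s)) (ball (0 : ℂ) R) := by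
    rw [integrableOn_fun_norm_addHaar volume (f := fun r : ℝ => r ^ (-s))]
    rcases le_or_gt R 0 with hR | hR
    · simp [Set.Ioo_eq_empty_of_le hR]
    have h1 : IntegrableOn (fun y : ℝ => y ^ (1 - s)) (Set.Ioo 0 R) :=
      (intervalIntegral.integrableOn_Ioo_rpow_iff hR).2 (by linarith)
    refine h1.congr_fun (fun y hy => ?_) measurableSet_Ioo
    simp only [Complex.finrank_real_complex, smul_eq_mul]
    norm_num
    rw [sub_eq_add_neg, Real.rpow_add hy.1, Real.rpow_one]
  have h2 := h.hasFiniteIntegral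
  rwa [hasFiniteIntegral_iff_ofReal (Filter.Eventually.of_forall fun x => by positivity)] at h2

lemma lintegral_ball_inv_norm_mul_norm_add {t : ℝ} (ht : 0 < t) :
    ∫⁻ x in ball (0 : ℂ) 4, ENNReal.ofReal (1 / (‖x‖ * (‖x‖ + t))) =
      ENNReal.ofReal (2 * Real.pi * Real.log (1 + 4 / t)) := by
  have hcont : ContinuousOn (fun y : ℝ => (y + t)⁻¹) (Set.Icc 0 4) := by
    refine ContinuousOn.inv₀ (by fun_prop) fun y hy => ?_
    linarith [hy.1]
  have hI : IntegrableOn (fun y : ℝ => (y + t)⁻¹) (Set.Ioo 0 4) :=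
    (hcont.integrableOn_Icc).mono_set Set.Ioo_subset_Icc_self
  have hint : IntegrableOn (fun x : ℂ => 1 / (‖x‖ * (‖x‖ + t))) (ball (0 : ℂ) 4) := by
    rw [integrableOn_fun_norm_addHaar volume (f := fun r : ℝ => 1 / (r * (r + t)))]
    refine hI.congr_fun (fun y hy => ?_) measurableSet_Ioo
    have := hy.1
    simp only [Complex.finrank_real_complex, smul_eq_mul]
    norm_num
    field_simp
  rw [← ofReal_integral_eq_lintegral_ofReal hint
    (Filter.Eventually.of_forall fun x => by positivity)]
  congr 1
  have h1 : ∫ x in ball (0 : ℂ) 4, 1 / (‖x‖ * (‖x‖ + t)) =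
      ∫ x : ℂ, (Set.Iio (4 : ℝ)).indicator (fun r : ℝ => 1 / (r * (r + t))) ‖x‖ := by
    rw [← integral_indicator measurableSet_ball]
    congr 1
    ext x
    simp [Set.indicator]
  have h2 : ∫ y in Set.Ioi (0 : ℝ), y ^ (Module.finrank ℝ ℂ - 1) •
      (Set.Iio (4 : ℝ)).indicator (fun r : ℝ => 1 / (r * (r + t))) y =
      ∫ y in Set.Ioo (0 : ℝ) 4, (y + t)⁻¹ := by
    rw [← integral_indicator measurableSet_Ioi, ← integral_indicator measurableSet_Ioo]
    congr 1
    ext y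
    by_cases hy : 0 < y
    · by_cases hy4 : y < 4
      · simp [Set.indicator, hy, hy4]
        field_simp
      · simp [Set.indicator, hy4]
    · simp [Set.indicator, hy]
  have h3 : ∫ y in Set.Ioo (0 : ℝ) 4, (y + t)⁻¹ = Real.log (1 + 4 / t) := by
    rw [← integral_Ioc_eq_integral_Ioo, ← intervalIntegral.integral_of_le (by norm_num),
      intervalIntegral.integral_comp_add_right (fun y => y⁻¹), integral_inv_of_pos (by linarith)
      (by linarith)]
    congr 1
    field_simp
    ring
  rw [h1, integral_fun_norm_addHaar volume, h2, h3]
  simp [Measure.real, Complex.volume_ball]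
  ring

lemma exists_lintegral_norm_div_le {p : ℝ≥0∞} (hp : 2 < p) :
    ∃ D : ℝ, 0 ≤ D ∧ ∀ (d M : ℝ), d ≤ 2 → ∀ W : ℂ → ℂ, Measurable W →
      eLpNorm W p (volume.restrict (ball 0 d)) ≤ ENNReal.ofReal M → ∀ z ∈ ball (0 : ℂ) d,
        ∫⁻ ξ in ball (0 : ℂ) d, ENNReal.ofReal (‖W ξ‖ / ‖ξ - z‖) ≤ ENNReal.ofReal (D * M) := by
  have hlt : p⁻¹ < 2⁻¹ := ENNReal.inv_lt_inv.2 hp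
  have hle : p⁻¹ ≤ 1 := hlt.le.trans (ENNReal.inv_le_one.2 one_le_two)
  set p' : ℝ≥0∞ := (1 - p⁻¹)⁻¹ with hp'
  have hsub : (2 : ℝ≥0∞)⁻¹ < 1 - p⁻¹ := by
    rw [lt_tsub_iff_right]
    calc (2 : ℝ≥0∞)⁻¹ + p⁻¹ < 2⁻¹ + 2⁻¹ := ENNReal.add_lt_add_left (by simp) hlt
      _ = 1 := ENNReal.inv_two_add_inv_two
  have hp'2 : p' < 2 := by
    rw [hp', ← inv_inv (2 : ℝ≥0∞)]
    exact ENNReal.inv_lt_inv.2 hsub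
  have hp'top : p' ≠ ∞ := (hp'2.trans (by simp)).ne
  have hp'0 : p' ≠ 0 := ENNReal.inv_ne_zero.2 (ENNReal.sub_ne_top one_ne_top)
  have hp'pos : 0 < p'.toReal := ENNReal.toReal_pos hp'0 hp'top
  have hp'r : p'.toReal < 2 := (ENNReal.toReal_lt_toReal hp'top (by simp)).2 hp'2
  have : HolderTriple p p' 1 := ⟨by rw [hp', inv_inv, inv_one, add_tsub_cancel_of_le hle]⟩
  set K := ∫⁻ x in ball (0 : ℂ) 4, ENNReal.ofReal (‖x‖ ^ (-p'.toReal))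
  have hKtop : K < ∞ := lintegral_ball_norm_rpow_lt_top hp'r 4
  refine ⟨(K ^ (1 / p'.toReal)).toReal, ENNReal.toReal_nonneg, fun d M hd W hW hWM z hz => ?_⟩
  have hmeas : Measurable fun ξ : ℂ => (ξ - z)⁻¹ := by fun_prop
  have hker : eLpNorm (fun ξ : ℂ => (ξ - z)⁻¹) p' (volume.restrict (ball 0 d)) ≤
      K ^ (1 / p'.toReal) := by
    rw [eLpNorm_eq_lintegral_rpow_enorm_toReal hp'0 hp'top]
    gcongr
    refine le_trans (le_of_eq ?_) (lintegral_ball_comp_sub_le _ hd hz)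
    refine lintegral_congr fun ξ => ?_
    rw [← ofReal_norm, ENNReal.ofReal_rpow_of_nonneg (norm_nonneg _) hp'pos.le, norm_inv,
      Real.inv_rpow (norm_nonneg _), Real.rpow_neg (norm_nonneg _)]
  calc ∫⁻ ξ in ball (0 : ℂ) d, ENNReal.ofReal (‖W ξ‖ / ‖ξ - z‖)
      = eLpNorm (W • fun ξ : ℂ => (ξ - z)⁻¹) 1 (volume.restrict (ball 0 d)) := by
        rw [eLpNorm_one_eq_lintegral_enorm]
        refine lintegral_congr fun ξ => ?_
        rw [← ofReal_norm, Pi.smul_apply', smul_eq_mul, norm_mul, norm_inv, div_eq_mul_inv]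
    _ ≤ eLpNorm W p (volume.restrict (ball 0 d)) *
          eLpNorm (fun ξ : ℂ => (ξ - z)⁻¹) p' (volume.restrict (ball 0 d)) :=
        eLpNorm_smul_le_mul_eLpNorm hmeas.aestronglyMeasurable hW.aestronglyMeasurable
    _ ≤ ENNReal.ofReal M * K ^ (1 / p'.toReal) := by gcongr
    _ = _ := by
        rw [ENNReal.ofReal_mul ENNReal.toReal_nonneg, ENNReal.ofReal_toReal, mul_comm]
        exact (ENNReal.rpow_lt_top_of_nonneg (by positivity) hKtop.ne).ne

lemma mul_div_le_weighted {r a κ t : ℝ} (hκ : 0 ≤ κ) (ht : 0 < t) :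
    r * (a / κ) ≤ Real.pi * r ^ 2 / 2 * (a ^ 2 + t * (a ^ 2 / κ)) +
      1 / (2 * Real.pi) * (1 / (κ * (κ + t))) := by
  have hpi := Real.pi_pos
  rcases hκ.eq_or_lt with rfl | hκ
  · simp; positivity
  have hs : 0 < κ + t := by positivity
  have : Real.pi * r ^ 2 / 2 * (a ^ 2 + t * (a ^ 2 / κ)) +
      1 / (2 * Real.pi) * (1 / (κ * (κ + t))) - r * (a / κ) =
      (Real.pi * r * a * (κ + t) - 1) ^ 2 / (2 * Real.pi * κ * (κ + t)) := by
    field_simp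
    ring
  have h2 : 0 ≤ (Real.pi * r * a * (κ + t) - 1) ^ 2 / (2 * Real.pi * κ * (κ + t)) := by positivity
  linarith

/-- Logarithmic pointwise bound for the Riesz potential of an `L²` function `W` in terms of the
potential `J` of `|W|²`. -/
lemma ofReal_mul_lintegral_norm_div_le {r d M : ℝ} (hr : 0 < r) (hd : d ≤ 2)
    {W : ℂ → ℂ} (hW : Measurable W)
    (hWM : ∫⁻ ξ in ball (0 : ℂ) d, ENNReal.ofReal (‖W ξ‖ ^ 2) ≤ ENNReal.ofReal (M ^ 2))
    {z : ℂ} (hz : z ∈ ball (0 : ℂ) d)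
    (hJ : ∫⁻ ξ in ball (0 : ℂ) d, ENNReal.ofReal (‖W ξ‖ ^ 2 / ‖ξ - z‖) ≠ ∞) :
    ENNReal.ofReal r * ∫⁻ ξ in ball (0 : ℂ) d, ENNReal.ofReal (‖W ξ‖ / ‖ξ - z‖) ≤
      ENNReal.ofReal (Real.pi * r ^ 2 / 2 * (M ^ 2 + 1) + Real.log (5 + 4 *
        (∫⁻ ξ in ball (0 : ℂ) d, ENNReal.ofReal (‖W ξ‖ ^ 2 / ‖ξ - z‖)).toReal)) := by
  set J := ∫⁻ ξ in ball (0 : ℂ) d, ENNReal.ofReal (‖W ξ‖ ^ 2 / ‖ξ - z‖)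
  have hJ0 : 0 ≤ J.toReal := ENNReal.toReal_nonneg
  set t : ℝ := 1 / (1 + J.toReal) with htdef
  have ht : 0 < t := by positivity
  have hpi := Real.pi_pos
  set A : ℝ := Real.pi * r ^ 2 / 2
  have hA0 : 0 ≤ A := by positivity
  set B : ℝ := 1 / (2 * Real.pi) with hB
  have hB0 : 0 ≤ B := by positivity
  have hnorm : Measurable fun ξ => ‖W ξ‖ := hW.norm
  have hsub : Measurable fun ξ : ℂ => ‖ξ - z‖ := by fun_prop
  have htJ : ENNReal.ofReal t * J ≤ ENNReal.ofReal 1 := by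
    rw [← ENNReal.ofReal_toReal hJ, ← ENNReal.ofReal_mul ht.le]
    refine ENNReal.ofReal_le_ofReal ?_
    rw [htdef, one_div_mul_eq_div, div_le_one (by positivity)]
    linarith
  have hlog : ∫⁻ ξ in ball (0 : ℂ) d, ENNReal.ofReal (1 / (‖ξ - z‖ * (‖ξ - z‖ + t))) ≤
      ENNReal.ofReal (2 * Real.pi * Real.log (5 + 4 * J.toReal)) := by
    refine (lintegral_ball_comp_sub_le
      (fun x => ENNReal.ofReal (1 / (‖x‖ * (‖x‖ + t)))) hd hz).trans (le_of_eq ?_)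
    rw [lintegral_ball_inv_norm_mul_norm_add ht, htdef]
    congr 3
    field_simp
    ring
  have hlog0 : 0 ≤ Real.log (5 + 4 * J.toReal) := Real.log_nonneg (by linarith)
  calc ENNReal.ofReal r * ∫⁻ ξ in ball (0 : ℂ) d, ENNReal.ofReal (‖W ξ‖ / ‖ξ - z‖)
      = ∫⁻ ξ in ball (0 : ℂ) d, ENNReal.ofReal (r * (‖W ξ‖ / ‖ξ - z‖)) := by
        rw [← lintegral_const_mul' _ _ ofReal_ne_top]
        exact lintegral_congr fun ξ => (ENNReal.ofReal_mul hr.le).symm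
    _ ≤ ∫⁻ ξ in ball (0 : ℂ) d, (ENNReal.ofReal A * (ENNReal.ofReal (‖W ξ‖ ^ 2) +
          ENNReal.ofReal t * ENNReal.ofReal (‖W ξ‖ ^ 2 / ‖ξ - z‖)) +
          ENNReal.ofReal B * ENNReal.ofReal (1 / (‖ξ - z‖ * (‖ξ - z‖ + t)))) := by
        refine lintegral_mono fun ξ => ?_
        rw [← ENNReal.ofReal_mul ht.le, ← ENNReal.ofReal_add (by positivity) (by positivity),
          ← ENNReal.ofReal_mul hA0, ← ENNReal.ofReal_mul hB0,
          ← ENNReal.ofReal_add (by positivity) (by positivity)]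
        exact ENNReal.ofReal_le_ofReal (mul_div_le_weighted (norm_nonneg _) ht)
    _ = ENNReal.ofReal A * ((∫⁻ ξ in ball (0 : ℂ) d, ENNReal.ofReal (‖W ξ‖ ^ 2)) +
          ENNReal.ofReal t * J) + ENNReal.ofReal B *
          ∫⁻ ξ in ball (0 : ℂ) d, ENNReal.ofReal (1 / (‖ξ - z‖ * (‖ξ - z‖ + t))) := by
        rw [lintegral_add_left (by fun_prop), lintegral_const_mul' _ _ ofReal_ne_top,
          lintegral_const_mul' _ _ ofReal_ne_top, lintegral_add_left (by fun_prop),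
          lintegral_const_mul' _ _ ofReal_ne_top]
    _ ≤ ENNReal.ofReal A * (ENNReal.ofReal (M ^ 2) + ENNReal.ofReal 1) + ENNReal.ofReal B *
          ENNReal.ofReal (2 * Real.pi * Real.log (5 + 4 * J.toReal)) := by gcongr
    _ = _ := by
        rw [← ENNReal.ofReal_add (by positivity) (by positivity), ← ENNReal.ofReal_mul hA0,
          ← ENNReal.ofReal_mul hB0, ← ENNReal.ofReal_add (by positivity) (by positivity)]
        congr 2
        rw [hB]
        field_simp

lemma lintegral_lintegral_norm_sq_div_le {d : ℝ} (hd : d ≤ 2) {W : ℂ → ℂ} (hW : Measurable W) :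
    ∫⁻ z in ball (0 : ℂ) d, ∫⁻ ξ in ball (0 : ℂ) d, ENNReal.ofReal (‖W ξ‖ ^ 2 / ‖ξ - z‖) ≤
      (∫⁻ ξ in ball (0 : ℂ) d, ENNReal.ofReal (‖W ξ‖ ^ 2)) *
        ∫⁻ x in ball (0 : ℂ) 4, ENNReal.ofReal (‖x‖ ^ (-1 : ℝ)) := by
  have hnorm : Measurable fun ξ => ‖W ξ‖ := hW.norm
  rw [lintegral_lintegral_swap (by fun_prop), ← lintegral_mul_const _ (by fun_prop)]
  refine setLIntegral_mono (by fun_prop) fun ξ hξ => ?_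
  calc ∫⁻ z in ball (0 : ℂ) d, ENNReal.ofReal (‖W ξ‖ ^ 2 / ‖ξ - z‖)
      = ENNReal.ofReal (‖W ξ‖ ^ 2) *
          ∫⁻ z in ball (0 : ℂ) d, ENNReal.ofReal (‖z - ξ‖ ^ (-1 : ℝ)) := by
        rw [← lintegral_const_mul' _ _ ofReal_ne_top]
        refine lintegral_congr fun z => ?_
        rw [← ENNReal.ofReal_mul (by positivity), norm_sub_rev, Real.rpow_neg_one, div_eq_mul_inv]
    _ ≤ _ := by
        refine mul_le_mul_right ?_ _
        exact lintegral_ball_comp_sub_le (fun x => ENNReal.ofReal (‖x‖ ^ (-1 : ℝ))) hd hξ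

/-- Exponential integrability (of Trudinger type) of Riesz potentials of `L²` functions. -/
lemma exists_exp_majorant {r : ℝ} (hr : 0 < r) :
    ∃ C > (0 : ℝ), ∀ (d M : ℝ), d ≤ 2 → 0 ≤ M → ∀ W : ℂ → ℂ, Measurable W →
      eLpNorm W 2 (volume.restrict (ball 0 d)) ≤ ENNReal.ofReal M →
      ∃ g : ℂ → ℝ, Measurable g ∧
        (∀ᵐ z ∂(volume.restrict (ball (0 : ℂ) d)), ∀ x : ℝ, ENNReal.ofReal x ≤
          ∫⁻ ξ in ball (0 : ℂ) d, ENNReal.ofReal (‖W ξ‖ / ‖ξ - z‖) → Real.exp x ≤ g z) ∧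
        eLpNorm g (ENNReal.ofReal r) (volume.restrict (ball 0 d)) ≤
          ENNReal.ofReal (C * Real.exp (C * M ^ 2)) := by
  set K := ∫⁻ x in ball (0 : ℂ) 4, ENNReal.ofReal (‖x‖ ^ (-1 : ℝ))
  have hKtop : K < ∞ := lintegral_ball_norm_rpow_lt_top (by norm_num) 4
  set V := volume (ball (0 : ℂ) 2)
  have hVtop : V < ∞ := measure_ball_lt_top
  set L : ℝ := (5 * V + 4 * K).toReal with hL
  have hL0 : 0 ≤ L := ENNReal.toReal_nonneg
  have hLtop : 5 * V + 4 * K ≠ ∞ :=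
    (ENNReal.add_lt_top.2 ⟨ENNReal.mul_lt_top (by simp) hVtop,
      ENNReal.mul_lt_top (by simp) hKtop⟩).ne
  have hpi := Real.pi_pos
  set a : ℝ := Real.pi * r / 2 with ha
  have ha0 : 0 < a := by positivity
  refine ⟨max (Real.exp a * L ^ (1 / r)) (a + 1 / r), lt_max_of_lt_right (by positivity),
    fun d M hd hM W hW hWM => ?_⟩
  have hnorm : Measurable fun ξ => ‖W ξ‖ := hW.norm
  have hWM2 : ∫⁻ ξ in ball (0 : ℂ) d, ENNReal.ofReal (‖W ξ‖ ^ 2) ≤ ENNReal.ofReal (M ^ 2) := by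
    rw [eLpNorm_eq_lintegral_rpow_enorm_toReal two_ne_zero ENNReal.ofNat_ne_top,
      one_div, ENNReal.rpow_inv_le_iff (by simp)] at hWM
    simpa [ENNReal.ofReal_pow, ofReal_norm, hM] using hWM
  set J : ℂ → ℝ≥0∞ := fun z => ∫⁻ ξ in ball (0 : ℂ) d, ENNReal.ofReal (‖W ξ‖ ^ 2 / ‖ξ - z‖)
  have hJm : Measurable J := by
    refine Measurable.lintegral_prod_right' (f := fun p : ℂ × ℂ =>
      ENNReal.ofReal (‖W p.2‖ ^ 2 / ‖p.2 - p.1‖)) ?_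
    fun_prop
  have hJint : ∫⁻ z in ball (0 : ℂ) d, J z ≤ ENNReal.ofReal (M ^ 2) * K :=
    (lintegral_lintegral_norm_sq_div_le hd hW).trans (by gcongr)
  have hJfin : ∀ᵐ z ∂(volume.restrict (ball (0 : ℂ) d)), J z < ∞ :=
    ae_lt_top hJm (hJint.trans_lt (ENNReal.mul_lt_top (by simp) hKtop)).ne
  have hJsum : ∫⁻ z in ball (0 : ℂ) d, (5 + 4 * J z) ≤ ENNReal.ofReal (L * Real.exp (M ^ 2)) := by
    rw [lintegral_add_left measurable_const, lintegral_const_mul _ hJm, setLIntegral_const,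
      ENNReal.ofReal_mul hL0, hL, ENNReal.ofReal_toReal hLtop, add_mul]
    have h1 : (1 : ℝ≥0∞) ≤ ENNReal.ofReal (Real.exp (M ^ 2)) := by
      rw [← ENNReal.ofReal_one]
      exact ENNReal.ofReal_le_ofReal (Real.one_le_exp (sq_nonneg M))
    have h2 : ENNReal.ofReal (M ^ 2) ≤ ENNReal.ofReal (Real.exp (M ^ 2)) :=
      ENNReal.ofReal_le_ofReal (by linarith [Real.add_one_le_exp (M ^ 2)])
    gcongr ?_ + ?_
    · calc 5 * volume (ball (0 : ℂ) d) ≤ 5 * V := by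
            gcongr
            exact measure_mono (ball_subset_ball hd)
        _ = 5 * V * 1 := (mul_one _).symm
        _ ≤ _ := by gcongr
    · calc 4 * ∫⁻ z in ball (0 : ℂ) d, J z ≤ 4 * (ENNReal.ofReal (M ^ 2) * K) := by gcongr
        _ ≤ 4 * (ENNReal.ofReal (Real.exp (M ^ 2)) * K) := by gcongr
        _ = _ := by ring
  set E : ℝ := Real.exp (a * (M ^ 2 + 1))
  refine ⟨fun z => E * (5 + 4 * (J z).toReal) ^ (1 / r), by fun_prop, ?_, ?_⟩
  · filter_upwards [hJfin, ae_restrict_mem measurableSet_ball] with z hzJ hz x hx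
    have h1 := ofReal_mul_lintegral_norm_div_le hr hd hW hWM2 hz hzJ.ne
    have h2 : ENNReal.ofReal (r * x) ≤ ENNReal.ofReal
        (Real.pi * r ^ 2 / 2 * (M ^ 2 + 1) + Real.log (5 + 4 * (J z).toReal)) := by
      rw [ENNReal.ofReal_mul hr.le]
      exact (mul_le_mul_right hx _).trans h1
    have hpos : 0 < 5 + 4 * (J z).toReal := by
      have : 0 ≤ (J z).toReal := ENNReal.toReal_nonneg
      linarith
    have hlog0 : 0 ≤ Real.log (5 + 4 * (J z).toReal) :=
      Real.log_nonneg (by linarith [(ENNReal.toReal_nonneg : 0 ≤ (J z).toReal)])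
    rw [ENNReal.ofReal_le_ofReal_iff (by positivity)] at h2
    have h3 : x ≤ a * (M ^ 2 + 1) + Real.log (5 + 4 * (J z).toReal) * (1 / r) := by
      rw [mul_comm, ← le_div_iff₀ hr] at h2
      refine h2.trans (le_of_eq ?_)
      rw [ha]
      field_simp
    calc Real.exp x ≤ Real.exp (a * (M ^ 2 + 1) + Real.log (5 + 4 * (J z).toReal) * (1 / r)) :=
          Real.exp_le_exp.2 h3
      _ = _ := by rw [Real.exp_add, Real.rpow_def_of_pos hpos]
  · have hr0 : ENNReal.ofReal r ≠ 0 := by simpa using hr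
    have hroot : eLpNorm (fun z => (5 + 4 * (J z).toReal) ^ (1 / r)) (ENNReal.ofReal r)
        (volume.restrict (ball 0 d)) ≤ ENNReal.ofReal ((L * Real.exp (M ^ 2)) ^ (1 / r)) := by
      rw [eLpNorm_eq_lintegral_rpow_enorm_toReal hr0 ofReal_ne_top,
        ENNReal.toReal_ofReal hr.le,
        ← ENNReal.ofReal_rpow_of_nonneg (by positivity) (by positivity)]
      gcongr
      refine (lintegral_mono_ae ?_).trans hJsum
      filter_upwards [hJfin] with z hz
      have hz0 : 0 ≤ (J z).toReal := ENNReal.toReal_nonneg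
      rw [← ofReal_norm, Real.norm_of_nonneg (by positivity),
        ENNReal.ofReal_rpow_of_nonneg (by positivity) hr.le, ← Real.rpow_mul (by positivity),
        one_div_mul_cancel hr.ne', Real.rpow_one, ENNReal.ofReal_add (by norm_num) (by positivity),
        ENNReal.ofReal_mul (by norm_num), ENNReal.ofReal_toReal hz.ne]
      simp
    calc eLpNorm (fun z => E * (5 + 4 * (J z).toReal) ^ (1 / r)) (ENNReal.ofReal r)
          (volume.restrict (ball 0 d))
        ≤ ENNReal.ofReal E * eLpNorm (fun z => (5 + 4 * (J z).toReal) ^ (1 / r))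
            (ENNReal.ofReal r) (volume.restrict (ball 0 d)) := by
          refine eLpNorm_le_mul_eLpNorm_of_ae_le_mul (Filter.Eventually.of_forall fun z => ?_) _
          rw [norm_mul, Real.norm_of_nonneg (Real.exp_pos _).le]
      _ ≤ ENNReal.ofReal E * ENNReal.ofReal ((L * Real.exp (M ^ 2)) ^ (1 / r)) := by gcongr
      _ = ENNReal.ofReal (Real.exp a * L ^ (1 / r) * Real.exp ((a + 1 / r) * M ^ 2)) := by
          rw [← ENNReal.ofReal_mul (Real.exp_pos _).le, Real.mul_rpow hL0 (Real.exp_pos _).le,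
            ← Real.exp_mul]
          congr 1
          rw [show a * (M ^ 2 + 1) = a + a * M ^ 2 by ring, Real.exp_add,
            show (a + 1 / r) * M ^ 2 = a * M ^ 2 + M ^ 2 * (1 / r) by ring, Real.exp_add]
          ring
      _ ≤ _ := by
          refine ENNReal.ofReal_le_ofReal ?_
          gcongr
          · exact le_max_left _ _
          · exact le_max_right _ _

/-- The exponent `r` with `1/q₂ + 1/r = 1/q`, and a majorant of the exponentials of the
Riesz potential of `W` which is controlled in `L^r`. -/
lemma exists_holderTriple_exp_majorant {q₁ q₂ q : ℝ≥0∞} {α : ℝ}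
    (hcase : (2 < q₁ ∧ q = q₂ ∧ α = 1) ∨ (q₁ = 2 ∧ 2 < q ∧ q < q₂ ∧ α = 2)) :
    ∃ r : ℝ≥0∞, HolderTriple q₂ r q ∧
    ∃ C > (0 : ℝ), ∀ (d M : ℝ), d ≤ 2 → 0 ≤ M → ∀ W : ℂ → ℂ, Measurable W →
      eLpNorm W q₁ (volume.restrict (ball 0 d)) ≤ ENNReal.ofReal M →
      ∃ g : ℂ → ℝ, Measurable g ∧
        (∀ᵐ z ∂(volume.restrict (ball (0 : ℂ) d)), ∀ x : ℝ, ENNReal.ofReal x ≤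
          ∫⁻ ξ in ball (0 : ℂ) d, ENNReal.ofReal (‖W ξ‖ / ‖ξ - z‖) → Real.exp x ≤ g z) ∧
        eLpNorm g r (volume.restrict (ball 0 d)) ≤
          ENNReal.ofReal (C * Real.exp (C * M ^ α)) := by
  rcases hcase with ⟨hq₁, rfl, rfl⟩ | ⟨rfl, hq, hqq₂, rfl⟩
  · obtain ⟨D, hD, h⟩ := exists_lintegral_norm_div_le hq₁
    refine ⟨∞, inferInstance, D + 1, by positivity, fun d M hd hM W hW hWM => ?_⟩
    refine ⟨fun _ => Real.exp (D * M), measurable_const, ?_, ?_⟩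
    · filter_upwards [ae_restrict_mem measurableSet_ball] with z hz x hx
      have := hx.trans (h d M hd W hW hWM z hz)
      rw [ENNReal.ofReal_le_ofReal_iff (by positivity)] at this
      exact Real.exp_le_exp.2 this
    · rw [eLpNorm_exponent_top]
      refine eLpNormEssSup_le_of_ae_bound (Filter.Eventually.of_forall fun z => ?_)
      rw [Real.norm_of_nonneg (Real.exp_pos _).le, Real.rpow_one]
      calc Real.exp (D * M) ≤ Real.exp ((D + 1) * M) := by gcongr; linarith
        _ ≤ _ := le_mul_of_one_le_left (Real.exp_pos _).le (by linarith)
  · have hinv : q₂⁻¹ < q⁻¹ := ENNReal.inv_lt_inv.2 hqq₂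
    have hq0 : q ≠ 0 := (zero_lt_two.trans hq).ne'
    set r : ℝ≥0∞ := (q⁻¹ - q₂⁻¹)⁻¹ with hr
    have hr0 : r ≠ 0 := ENNReal.inv_ne_zero.2 (ENNReal.sub_ne_top (ENNReal.inv_ne_top.2 hq0))
    have hrtop : r ≠ ∞ := ENNReal.inv_ne_top.2 (tsub_pos_of_lt hinv).ne'
    obtain ⟨C, hC, h⟩ := exists_exp_majorant (ENNReal.toReal_pos hr0 hrtop)
    refine ⟨r, ⟨by rw [hr, inv_inv, add_tsub_cancel_of_le hinv.le]⟩, C, hC, ?_⟩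
    simpa only [ENNReal.ofReal_toReal hrtop, Real.rpow_two] using h

/-- Lemma (bound on the Beltrami matrix `G`):  with `h = T[W₁(u₂) - W₁(u₁)]`,
`G₁₁ = G₂₂ = 0`, `G₁₂ = -W₂(u₂)e^h`, `G₂₁ = W₂(u₁)e^{-h}`, one has
`Σ‖G_{jk}‖_{L^q(B_d)} ≤ C M₂ exp(C M₁^α)` with `C = C(q₁,q₂,q)`. -/
theorem statement8 (q₁ q₂ q : ℝ≥0∞) (α : ℝ) (hq₁ : 2 ≤ q₁) (hq₂ : 2 < q₂)
    (hcase : (2 < q₁ ∧ q = q₂ ∧ α = 1) ∨ (q₁ = 2 ∧ 2 < q ∧ q < q₂ ∧ α = 2)) :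
    ∃ C > (0 : ℝ), ∀ (d M₁ M₂ : ℝ), 1 < d → d ≤ 2 → 0 ≤ M₁ → 0 ≤ M₂ →
      ∀ (W₁ W₂ : ℂ → ℂ), Measurable W₁ → Measurable W₂ →
        eLpNorm W₁ q₁ (volume.restrict (ball 0 d)) ≤ ENNReal.ofReal M₁ →
        eLpNorm W₂ q₂ (volume.restrict (ball 0 d)) ≤ ENNReal.ofReal M₂ →
      ∀ (u₁ u₂ : ℂ → ℝ),
        ContDiffOn ℝ 1 u₁ (ball 0 d) → ContDiffOn ℝ 1 u₂ (ball 0 d) →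
        eLpNorm (fun z => -(Wop W₂ u₂ z) *
            Complex.exp (cauchyT d (fun w => Wop W₁ u₂ w - Wop W₁ u₁ w) z)) q
            (volume.restrict (ball 0 d)) +
          eLpNorm (fun z => Wop W₂ u₁ z *
            Complex.exp (-cauchyT d (fun w => Wop W₁ u₂ w - Wop W₁ u₁ w) z)) q
            (volume.restrict (ball 0 d)) ≤
        ENNReal.ofReal (C * M₂ * Real.exp (C * M₁ ^ α)) := by
  obtain ⟨r, hr, C, hC, h⟩ := exists_holderTriple_exp_majorant hcase
  refine ⟨C, hC, fun d M₁ M₂ _ hd hM₁ hM₂ W₁ W₂ hW₁ hW₂ hWM₁ hWM₂ u₁ u₂ _ _ => ?_⟩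
  obtain ⟨g, hg, hgexp, hgnorm⟩ := h d M₁ hd hM₁ W₁ hW₁ hWM₁
  set ψ := cauchyT d (fun w => Wop W₁ u₂ w - Wop W₁ u₁ w)
  set μ := volume.restrict (ball (0 : ℂ) d)
  have hψ : ∀ᵐ z ∂μ, Real.exp ‖ψ z‖ ≤ g z := by
    filter_upwards [hgexp] with z hz
    exact hz _ (ofReal_norm_cauchyT_le d (norm_Wop_sub_Wop_le W₁ u₂ u₁) z)
  have hprod : eLpNorm (g • W₂) q μ ≤ ENNReal.ofReal (C * Real.exp (C * M₁ ^ α) * M₂) := by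
    rw [ENNReal.ofReal_mul (by positivity)]
    exact (eLpNorm_smul_le_mul_eLpNorm (p := r) (q := q₂) hW₂.aestronglyMeasurable
      hg.aestronglyMeasurable).trans (by gcongr)
  have hbound : ∀ a b : ℂ → ℂ, (∀ z, ‖a z‖ ≤ 1 / 2 * ‖W₂ z‖) → (∀ z, ‖b z‖ = ‖ψ z‖) →
      eLpNorm (fun z => a z * Complex.exp (b z)) q μ ≤
        ENNReal.ofReal (1 / 2) * eLpNorm (g • W₂) q μ := by
    intro a b ha hb
    refine eLpNorm_le_mul_eLpNorm_of_ae_le_mul ?_ q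
    filter_upwards [hψ] with z hz
    have hexp : ‖Complex.exp (b z)‖ ≤ g z :=
      (Complex.norm_exp_le_exp_norm _).trans (by rwa [hb])
    rw [norm_mul, Pi.smul_apply', norm_smul,
      Real.norm_of_nonneg ((Real.exp_pos _).le.trans hz)]
    calc ‖a z‖ * ‖Complex.exp (b z)‖ ≤ (1 / 2 * ‖W₂ z‖) * g z := by
          gcongr
          exact ha z
      _ = _ := by ring
  have h₁ := hbound (fun z => -(Wop W₂ u₂ z)) ψ
    (fun z => by rw [norm_neg]; exact norm_Wop_le W₂ u₂ z) fun z => rfl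
  have h₂ := hbound (fun z => Wop W₂ u₁ z) (fun z => -ψ z) (norm_Wop_le W₂ u₁)
    fun z => norm_neg _
  calc _ ≤ ENNReal.ofReal (1 / 2) * eLpNorm (g • W₂) q μ +
        ENNReal.ofReal (1 / 2) * eLpNorm (g • W₂) q μ := add_le_add h₁ h₂
    _ = eLpNorm (g • W₂) q μ := by
        rw [← add_mul, ← ENNReal.ofReal_add (by norm_num) (by norm_num)]
        norm_num
    _ ≤ _ := hprod.trans (le_of_eq (by ring_nf))

end
end

section
/- Let Ω ⊆ ℂ be open, let W = W₁ + iW₂ : Ω → ℂ² with W₁, W₂ real-vector-valued, and let u = u₁ + iu₂ ∈ C²(Ω, ℂ) with u₁, u₂ real-valued. Set v₁ = ∂u₁ and v₂ = ∂u₂. Then at every point z ∈ Ω at which Δu(z) = W(z)·∇u(z) holds, one has ∂̄v₁(z) = W₁(u₁)(z)·v₁(z) − W₂(u₂)(z)·v₂(z) and ∂̄v₂(z) = W₂(u₁)(z)·v₁(z) + W₁(u₂)(z)·v₂(z); that is, the vector v⃗ = (∂u₁, ∂u₂) solves the Beltrami system ∂̄v⃗ = G·v⃗ with G = [[W₁(u₁),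 −W₂(u₂)], [W₂(u₁), W₁(u₂)]]. -/
open MeasureTheory Metric Complex ENNReal

noncomputable section

/-- The Wirtinger derivative `∂̄v = (1/2)(∂ₓv + i ∂_y v)`. -/
def pbar (u : ℂ → ℂ) (z : ℂ) : ℂ := (1 / 2 : ℂ) * (pdx u z + Complex.I * pdy u z)

/-- `W·∇u` where `W = W₁ + iW₂`, with `W₁, W₂` real-vector-valued fields identified
with complex-valued functions. -/
def drift (W₁ W₂ : ℂ → ℂ) (u : ℂ → ℂ) (z : ℂ) : ℂ :=
  (((W₁ z).re : ℂ) + ((W₂ z).re : ℂ) * Complex.I) * pdx u z +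
    (((W₁ z).im : ℂ) + ((W₂ z).im : ℂ) * Complex.I) * pdy u z

/-- Directional derivatives of a complex function given by its real and imaginary parts. -/
theorem fderiv_ofReal_add_ofReal_mul_I {f g : ℂ → ℝ} {z : ℂ} (hf : DifferentiableAt ℝ f z)
    (hg : DifferentiableAt ℝ g z) (e : ℂ) :
    fderiv ℝ (fun w => (f w : ℂ) + (g w : ℂ) * Complex.I) z e =
      (fderiv ℝ f z e : ℂ) + (fderiv ℝ g z e : ℂ) * Complex.I := by
  have hf' : HasFDerivAt (fun w => (f w : ℂ)) (Complex.ofRealCLM.comp (fderiv ℝ f z)) z :=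
    Complex.ofRealCLM.hasFDerivAt.comp z hf.hasFDerivAt
  have hg' : HasFDerivAt (fun w => (g w : ℂ)) (Complex.ofRealCLM.comp (fderiv ℝ g z)) z :=
    Complex.ofRealCLM.hasFDerivAt.comp z hg.hasFDerivAt
  rw [(hf'.fun_add (hg'.mul_const Complex.I)).fderiv]
  simp [mul_comm]

theorem ContDiffAt.hasFDerivAt_fderiv_apply {u : ℂ → ℝ} {z : ℂ} (hu : ContDiffAt ℝ 2 u z)
    (e : ℂ) :
    HasFDerivAt (fun w => fderiv ℝ u w e) ((fderiv ℝ (fderiv ℝ u) z).flip e) z := by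
  have hd : DifferentiableAt ℝ (fderiv ℝ u) z :=
    (hu.fderiv_right (m := 1) (by norm_num)).differentiableAt (by norm_num)
  simpa using hd.hasFDerivAt.clm_apply (hasFDerivAt_const e z)

theorem ContDiffAt.eventually_differentiableAt {u : ℂ → ℝ} {z : ℂ} (hu : ContDiffAt ℝ 2 u z) :
    ∀ᶠ w in nhds z, DifferentiableAt ℝ u w :=
  (hu.eventually (by simp)).mono fun _ hw => hw.differentiableAt (by norm_num)

/-- Second directional derivatives of a complex function given by its real and imaginary parts. -/
theorem fderiv_fderiv_ofReal_add_ofReal_mul_I {f g : ℂ → ℝ} {z : ℂ} (hf : ContDiffAt ℝ 2 f z)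
    (hg : ContDiffAt ℝ 2 g z) (e : ℂ) :
    fderiv ℝ (fun w => fderiv ℝ (fun w => (f w : ℂ) + (g w : ℂ) * Complex.I) w e) z e =
      (fderiv ℝ (fderiv ℝ f) z e e : ℂ) + (fderiv ℝ (fderiv ℝ g) z e e : ℂ) * Complex.I := by
  have h : (fun w => fderiv ℝ (fun w => (f w : ℂ) + (g w : ℂ) * Complex.I) w e) =ᶠ[nhds z]
      fun w => (fderiv ℝ f w e : ℂ) + (fderiv ℝ g w e : ℂ) * Complex.I := by
    filter_upwards [hf.eventually_differentiableAt, hg.eventually_differentiableAt] with w h₁ h₂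
    exact fderiv_ofReal_add_ofReal_mul_I h₁ h₂ e
  have hf' := hf.hasFDerivAt_fderiv_apply e
  have hg' := hg.hasFDerivAt_fderiv_apply e
  rw [h.fderiv_eq, fderiv_ofReal_add_ofReal_mul_I hf'.differentiableAt hg'.differentiableAt,
    hf'.fderiv, hg'.fderiv]
  simp

/-- The factorization `∂̄∂u = Δu / 4` for a real-valued function. -/
theorem pbar_wirtR {u : ℂ → ℝ} {z : ℂ} (hu : ContDiffAt ℝ 2 u z) :
    pbar (fun w => wirtR u w) z =
      (1 / 4 : ℂ) * ((fderiv ℝ (fderiv ℝ u) z 1 1 : ℂ) +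
        (fderiv ℝ (fderiv ℝ u) z Complex.I Complex.I : ℂ)) := by
  have hsymm : fderiv ℝ (fderiv ℝ u) z Complex.I 1 = fderiv ℝ (fderiv ℝ u) z 1 Complex.I :=
    (hu.isSymmSndFDerivAt (by simp)).eq _ _
  have hx := (hu.hasFDerivAt_fderiv_apply 1).const_mul (1 / 2)
  have hy := (hu.hasFDerivAt_fderiv_apply Complex.I).const_mul (-1 / 2)
  have hw : (fun w => wirtR u w) = fun w => ((1 / 2 * fderiv ℝ u w 1 : ℝ) : ℂ) +
      ((-1 / 2 * fderiv ℝ u w Complex.I : ℝ) : ℂ) * Complex.I := by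
    funext w
    simp only [wirtR, pdxR, pdyR]
    push_cast
    ring
  simp only [pbar, pdx, pdy, hw]
  rw [fderiv_ofReal_add_ofReal_mul_I hx.differentiableAt hy.differentiableAt,
    fderiv_ofReal_add_ofReal_mul_I hx.differentiableAt hy.differentiableAt, hx.fderiv, hy.fderiv]
  simp only [smul_apply, ContinuousLinearMap.flip_apply, smul_eq_mul, hsymm]
  push_cast
  linear_combination (-1 / 4 * (fderiv ℝ (fderiv ℝ u) z Complex.I Complex.I : ℂ)) * Complex.I_sq

/-- The identity `4 W(u) ∂u = W·∇u`. -/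
theorem Wop_mul_wirtR (W : ℂ → ℂ) (u : ℂ → ℝ) (z : ℂ) :
    Wop W u z * wirtR u z =
      (1 / 4 : ℂ) * (((W z).re * pdxR u z + (W z).im * pdyR u z : ℝ) : ℂ) := by
  by_cases h : wirtR u z = 0
  · have hre := congrArg Complex.re h
    have him := congrArg Complex.im h
    simp [wirtR] at hre him
    simp [h, hre, him]
  · have h' : Wop W u z * wirtR u z = (1 / 4 : ℂ) *
        (W z * wirtR u z + (starRingEnd ℂ) (W z) * wirtbarR u z) := by
      simp only [Wop, if_pos h]
      field_simp
    rw [h']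
    congr 1
    apply Complex.ext <;> simp [wirtR, wirtbarR] <;> ring

/-- Reduction of the drift equation to a vector-valued Beltrami system:
`v⃗ = (∂u₁, ∂u₂)` satisfies `∂̄v⃗ = G v⃗` with
`G = [[W₁(u₁), -W₂(u₂)], [W₂(u₁), W₁(u₂)]]` wherever `Δu = W·∇u` holds. -/
theorem statement12 (Ω : Set ℂ) (hΩ : IsOpen Ω) (W₁ W₂ : ℂ → ℂ) (u₁ u₂ : ℂ → ℝ)
    (hu₁ : ContDiffOn ℝ 2 u₁ Ω) (hu₂ : ContDiffOn ℝ 2 u₂ Ω)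
    (z : ℂ) (hz : z ∈ Ω)
    (heq : lap (fun w => (u₁ w : ℂ) + (u₂ w : ℂ) * Complex.I) z =
      drift W₁ W₂ (fun w => (u₁ w : ℂ) + (u₂ w : ℂ) * Complex.I) z) :
    pbar (fun w => wirtR u₁ w) z =
        Wop W₁ u₁ z * wirtR u₁ z - Wop W₂ u₂ z * wirtR u₂ z ∧
      pbar (fun w => wirtR u₂ w) z =
        Wop W₂ u₁ z * wirtR u₁ z + Wop W₁ u₂ z * wirtR u₂ z := by
  have h₁ : ContDiffAt ℝ 2 u₁ z := hu₁.contDiffAt (hΩ.mem_nhds hz)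
  have h₂ : ContDiffAt ℝ 2 u₂ z := hu₂.contDiffAt (hΩ.mem_nhds hz)
  have d₁ : DifferentiableAt ℝ u₁ z := h₁.differentiableAt (by norm_num)
  have d₂ : DifferentiableAt ℝ u₂ z := h₂.differentiableAt (by norm_num)
  have hlap : lap (fun w => (u₁ w : ℂ) + (u₂ w : ℂ) * Complex.I) z =
      ((fderiv ℝ (fderiv ℝ u₁) z 1 1 : ℂ) + (fderiv ℝ (fderiv ℝ u₂) z 1 1 : ℂ) * Complex.I) +
      ((fderiv ℝ (fderiv ℝ u₁) z Complex.I Complex.I : ℂ) +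
        (fderiv ℝ (fderiv ℝ u₂) z Complex.I Complex.I : ℂ) * Complex.I) :=
    congrArg₂ (· + ·) (fderiv_fderiv_ofReal_add_ofReal_mul_I h₁ h₂ 1)
      (fderiv_fderiv_ofReal_add_ofReal_mul_I h₁ h₂ Complex.I)
  rw [hlap] at heq
  simp only [drift, pdx, pdy, fderiv_ofReal_add_ofReal_mul_I d₁ d₂] at heq
  have hre := congrArg Complex.re heq
  have him := congrArg Complex.im heq
  simp at hre him
  rw [pbar_wirtR h₁, pbar_wirtR h₂]
  simp only [Wop_mul_wirtR, pdxR, pdyR, ← mul_sub, ← mul_add, ← Complex.ofReal_add,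
    ← Complex.ofReal_sub]
  constructor <;> congr 2 <;> linarith

end
end

section
/- Let p ∈ (1,2] and φ(t) = t + (1/2)·log(t²), and for τ > 0 define the conjugated operator L_τ v = ∂_t v + i·∂_θ v + τ·(1 + 1/t)·v and the high-frequency projection P^h_τ = Σ_{k > ⌈2τ⌉} P_k (acting in the θ-variable). Then there exist t₀ < 0, τ₀ > 0, and a constant C = C(p,t₀) > 0 such that for every τ ≥ τ₀ and every smooth v : ℝ × S¹ → ℂ with compact support contained in (−∞, t₀) × S¹: ‖P^h_τ v‖_{L²(dt dθ)} ≤ C·τ^{−1+1/p}·‖L_τ v‖_{L^p(dt dθ)}. -/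
open MeasureTheory Metric Complex ENNReal

noncomputable section

/-- Partial derivative in `t` of a function on `ℝ × S¹` (viewed as `ℝ × ℝ`). -/
def dT (v : ℝ × ℝ → ℂ) (q : ℝ × ℝ) : ℂ := deriv (fun s => v (s, q.2)) q.1

/-- Partial derivative in `θ` of a function on `ℝ × S¹` (viewed as `ℝ × ℝ`). -/
def dTh (v : ℝ × ℝ → ℂ) (q : ℝ × ℝ) : ℂ := deriv (fun s => v (q.1, s)) q.2

/-- The region `ℝ × [0, 2π)`, a fundamental domain for `ℝ × S¹`. -/
def stripe : Set (ℝ × ℝ) := Set.univ ×ˢ Set.Ico 0 (2 * Real.pi)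

/-- The conjugated operator `L_τ v = ∂_t v + i ∂_θ v + τ(1 + 1/t) v`. -/
def Ltau (τ : ℝ) (v : ℝ × ℝ → ℂ) (q : ℝ × ℝ) : ℂ :=
  dT v q + Complex.I * dTh v q + ((τ * (1 + 1 / q.1) : ℝ) : ℂ) * v q

/-- The `k`-th Fourier coefficient in `θ`:
`(1/2π) ∫₀^{2π} v(t,θ') e^{-ikθ'} dθ'`. -/
def fcT (v : ℝ × ℝ → ℂ) (k : ℤ) (t : ℝ) : ℂ :=
  (1 / (2 * Real.pi) : ℂ) *
    ∫ θ in Set.Ico (0 : ℝ) (2 * Real.pi), v (t, θ) * Complex.exp (-Complex.I * k * θ)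

/-- The projection `P_k` onto the `k`-th Fourier mode in `θ`. -/
def Pk (v : ℝ × ℝ → ℂ) (k : ℤ) (q : ℝ × ℝ) : ℂ :=
  fcT v k q.1 * Complex.exp (Complex.I * k * q.2)

/-- The high-frequency projection `P^h_τ = Σ_{k > ⌈2τ⌉} P_k`. -/
def Ph (τ : ℝ) (v : ℝ × ℝ → ℂ) (q : ℝ × ℝ) : ℂ :=
  ∑' k : ℤ, if ⌈(2 * τ : ℝ)⌉ < k then Pk v k q else 0

/-- The one-sided exponential kernel `e^{-lu} 1_{u ≥ 0}`. -/
def expKernel (l u : ℝ) : ℝ≥0∞ :=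
  (Set.Ici (0 : ℝ)).indicator (fun u => ENNReal.ofReal (Real.exp (-l * u))) u

lemma measurable_expKernel (l : ℝ) : Measurable (expKernel l) := by
  unfold expKernel
  exact Measurable.indicator (by fun_prop) measurableSet_Ici

lemma expKernel_le_one {l : ℝ} (hl : 0 < l) (u : ℝ) : expKernel l u ≤ 1 := by
  unfold expKernel
  by_cases hu : u ∈ Set.Ici (0 : ℝ)
  · rw [Set.indicator_of_mem hu, ENNReal.ofReal_le_one, Real.exp_le_one_iff]
    have : 0 ≤ l * u := mul_nonneg hl.le hu
    linarith
  · rw [Set.indicator_of_notMem hu]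
    exact zero_le

lemma lintegral_expKernel {l : ℝ} (hl : 0 < l) :
    ∫⁻ u, expKernel l u = ENNReal.ofReal l⁻¹ := by
  unfold expKernel
  rw [lintegral_indicator measurableSet_Ici, setLIntegral_congr Ioi_ae_eq_Ici.symm,
    ← ofReal_integral_eq_lintegral_ofReal]
  · rw [integral_exp_mul_Ioi (by linarith)]
    simp
  · exact exp_neg_integrableOn_Ioi 0 hl
  · exact Filter.Eventually.of_forall fun x => (Real.exp_pos _).le

/-- Hölder's inequality with a weight. -/
lemma lintegral_mul_rpow_le {α : Type*} [MeasurableSpace α] (μ : Measure α) {p : ℝ} (hp : 1 < p)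
    {K f : α → ℝ≥0∞} (hK : AEMeasurable K μ) (hf : AEMeasurable f μ) :
    (∫⁻ x, K x * f x ∂μ) ^ p ≤ (∫⁻ x, K x ∂μ) ^ (p - 1) * ∫⁻ x, K x * f x ^ p ∂μ := by
  have hpq := Real.HolderConjugate.conjExponent hp
  set q := p.conjExponent with hq
  have hp0 : 0 < p := by linarith
  have hq0 : 0 < q := hpq.symm.pos
  have hsum : 1 / q + 1 / p = 1 := by
    have := hpq.inv_add_inv_eq_one
    rw [one_div, one_div]; linarith
  have h := ENNReal.lintegral_mul_le_Lp_mul_Lq μ hpq.symm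
    (f := fun x => K x ^ (1 / q)) (g := fun x => K x ^ (1 / p) * f x)
    (hK.pow_const _) ((hK.pow_const _).mul hf)
  have e1 : ∀ x, ((fun x => K x ^ (1 / q)) * fun x => K x ^ (1 / p) * f x) x = K x * f x := by
    intro x
    simp only [Pi.mul_apply]
    rw [← mul_assoc, ← ENNReal.rpow_add_of_nonneg _ _ (by positivity) (by positivity), hsum,
      ENNReal.rpow_one]
  have e2 : ∀ x, (K x ^ (1 / q)) ^ q = K x := by
    intro x
    rw [← ENNReal.rpow_mul, one_div_mul_cancel hq0.ne', ENNReal.rpow_one]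
  have e3 : ∀ x, (K x ^ (1 / p) * f x) ^ p = K x * f x ^ p := by
    intro x
    rw [ENNReal.mul_rpow_of_nonneg _ _ hp0.le, ← ENNReal.rpow_mul, one_div_mul_cancel hp0.ne',
      ENNReal.rpow_one]
  simp only [e1, e2, e3] at h
  calc _ ≤ ((∫⁻ x, K x ∂μ) ^ (1 / q) * (∫⁻ x, K x * f x ^ p ∂μ) ^ (1 / p)) ^ p :=
        ENNReal.rpow_le_rpow h hp0.le
    _ = _ := by
        rw [ENNReal.mul_rpow_of_nonneg _ _ hp0.le, ← ENNReal.rpow_mul, ← ENNReal.rpow_mul,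
          one_div_mul_cancel hp0.ne', ENNReal.rpow_one]
        congr 2
        have : 1 / q = 1 - 1 / p := by linarith
        rw [this]; field_simp

/-- Young's inequality `L^p → L²` for convolution with the one-sided exponential kernel. -/
lemma lintegral_sq_le_of_le_expKernel {p l : ℝ} (hp1 : 1 < p) (hp2 : p ≤ 2) (hl : 0 < l)
    {f g : ℝ → ℝ≥0∞} (hf : Measurable f)
    (hg : ∀ t, g t ≤ ∫⁻ s, expKernel l (s - t) * f s) :
    ∫⁻ t, g t ^ (2 : ℝ) ≤
      ENNReal.ofReal (l ^ (2 / p - 3)) * (∫⁻ s, f s ^ p) ^ (2 / p) := by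
  have hp0 : 0 < p := by linarith
  have hlt : ∀ a : ℝ, ENNReal.ofReal l⁻¹ ^ a = ENNReal.ofReal (l ^ (-a)) := by
    intro a
    rw [ENNReal.ofReal_rpow_of_pos (inv_pos.2 hl), Real.inv_rpow hl.le, Real.rpow_neg hl.le]
  have hK := measurable_expKernel l
  set M := ∫⁻ s, f s ^ p with hM
  have hgp : ∀ t, g t ^ p ≤
      ENNReal.ofReal (l ^ (1 - p)) * ∫⁻ s, expKernel l (s - t) * f s ^ p := by
    intro t
    have h := lintegral_mul_rpow_le volume hp1 (K := fun s => expKernel l (s - t)) (f := f)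
      (by fun_prop) (by fun_prop)
    rw [lintegral_sub_right_eq_self (expKernel l), lintegral_expKernel hl, hlt] at h
    refine (ENNReal.rpow_le_rpow (hg t) hp0.le).trans (h.trans_eq ?_)
    rw [neg_sub]
  have hgs : ∀ t, g t ^ p ≤ ENNReal.ofReal (l ^ (1 - p)) * M := by
    intro t
    refine (hgp t).trans ?_
    refine mul_le_mul' le_rfl (lintegral_mono fun s => ?_)
    exact mul_le_of_le_one_left zero_le (expKernel_le_one hl _)
  have hint : ∫⁻ t, ∫⁻ s, expKernel l (s - t) * f s ^ p = ENNReal.ofReal l⁻¹ * M := by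
    rw [lintegral_lintegral_swap]
    · rw [hM, ← lintegral_const_mul _ (by fun_prop)]
      congr 1 with s
      rw [lintegral_mul_const _ (by fun_prop), lintegral_sub_left_eq_self (expKernel l),
        lintegral_expKernel hl]
    · fun_prop
  have hsq : ∀ t, g t ^ (2 : ℝ) ≤ (ENNReal.ofReal (l ^ (1 - p)) * M) ^ ((2 - p) / p) *
      (ENNReal.ofReal (l ^ (1 - p)) * ∫⁻ s, expKernel l (s - t) * f s ^ p) := by
    intro t
    have h2 : g t ^ (2 : ℝ) = (g t ^ p) ^ ((2 - p) / p) * g t ^ p := by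
      rw [← ENNReal.rpow_mul, mul_div_cancel₀ _ hp0.ne',
        ← ENNReal.rpow_add_of_nonneg _ _ (by linarith) hp0.le]
      congr 1; ring
    rw [h2]
    have h3 : 0 ≤ (2 - p) / p := div_nonneg (by linarith) hp0.le
    exact mul_le_mul' (ENNReal.rpow_le_rpow (hgs t) h3) (hgp t)
  refine (lintegral_mono hsq).trans ?_
  have hmeas : Measurable fun t => ∫⁻ s, expKernel l (s - t) * f s ^ p := by
    apply Measurable.lintegral_prod_right'
      (f := fun z : ℝ × ℝ => expKernel l (z.2 - z.1) * f z.2 ^ p)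
    fun_prop
  rw [lintegral_const_mul _ (by fun_prop), lintegral_const_mul _ hmeas, hint]
  have h3 : 0 ≤ (2 - p) / p := div_nonneg (by linarith) hp0.le
  rw [ENNReal.mul_rpow_of_nonneg _ _ h3, ENNReal.ofReal_rpow_of_pos (by positivity),
    ← Real.rpow_mul hl.le]
  apply le_of_eq
  calc _ = (ENNReal.ofReal (l ^ ((1 - p) * ((2 - p) / p))) *
        ENNReal.ofReal (l ^ (1 - p)) * ENNReal.ofReal l⁻¹) * (M ^ ((2 - p) / p) * M) := by ring
    _ = _ := by
      rw [← ENNReal.ofReal_mul (by positivity), ← ENNReal.ofReal_mul (by positivity),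
        ← Real.rpow_neg_one l, ← Real.rpow_add hl, ← Real.rpow_add hl]
      congr 1
      · congr 2; field_simp; ring
      · nth_rewrite 2 [← ENNReal.rpow_one M]
        rw [← ENNReal.rpow_add_of_nonneg _ _ h3 zero_le_one]
        congr 1; field_simp; ring

lemma enorm_fcT_rpow_le {p : ℝ} (hp : 1 < p) {F : ℝ × ℝ → ℂ} (hF : Measurable F) (k : ℤ) (t : ℝ) :
    ‖fcT F k t‖ₑ ^ p ≤ ∫⁻ θ in Set.Ico 0 (2 * Real.pi), ‖F (t, θ)‖ₑ ^ p := by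
  have hp0 : 0 < p := by linarith
  have hpi := Real.pi_pos
  have h1 : ‖fcT F k t‖ₑ ≤
      ∫⁻ θ in Set.Ico 0 (2 * Real.pi), ENNReal.ofReal (2 * Real.pi)⁻¹ * ‖F (t, θ)‖ₑ := by
    rw [lintegral_const_mul _ (by fun_prop), fcT, enorm_mul]
    have : ‖(1 / (2 * Real.pi) : ℂ)‖ₑ = ENNReal.ofReal (2 * Real.pi)⁻¹ := by
      rw [← ofReal_norm]
      congr 1
      simp [abs_of_pos hpi]
    rw [this]
    gcongr
    refine (enorm_integral_le_lintegral_enorm _).trans (le_of_eq ?_)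
    congr 1 with θ
    rw [enorm_mul]
    have : ‖Complex.exp (-Complex.I * k * θ)‖ₑ = 1 := by
      rw [← ofReal_norm, Complex.norm_exp]
      simp
    rw [this, mul_one]
  refine (ENNReal.rpow_le_rpow h1 hp0.le).trans ?_
  refine (lintegral_mul_rpow_le _ hp (by fun_prop) (by fun_prop)).trans ?_
  have h2 : ∫⁻ _ in Set.Ico 0 (2 * Real.pi), ENNReal.ofReal (2 * Real.pi)⁻¹ = 1 := by
    rw [setLIntegral_const, Real.volume_Ico, sub_zero, ← ENNReal.ofReal_mul (by positivity),
      inv_mul_cancel₀ (by positivity), ENNReal.ofReal_one]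
  rw [h2, ENNReal.one_rpow, one_mul]
  gcongr with θ
  refine mul_le_of_le_one_left zero_le ?_
  rw [ENNReal.ofReal_le_one]
  exact inv_le_one_of_one_le₀ (by linarith [Real.two_le_pi])

lemma lintegral_stripe {f : ℝ × ℝ → ℝ≥0∞} (hf : Measurable f) :
    ∫⁻ q in stripe, f q = ∫⁻ t, ∫⁻ θ in Set.Ico 0 (2 * Real.pi), f (t, θ) := by
  rw [stripe, Measure.volume_eq_prod, ← Measure.prod_restrict, lintegral_prod _ hf.aemeasurable,
    Measure.restrict_univ]

lemma lintegral_enorm_fcT_rpow_le {p : ℝ} (hp : 1 < p) {F : ℝ × ℝ → ℂ} (hF : Measurable F) (k : ℤ) :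
    ∫⁻ t, ‖fcT F k t‖ₑ ^ p ≤ ∫⁻ q in stripe, ‖F q‖ₑ ^ p := by
  rw [lintegral_stripe (by fun_prop)]
  exact lintegral_mono fun t => enorm_fcT_rpow_le hp hF k t

lemma measurable_fcT {F : ℝ × ℝ → ℂ} (hF : Measurable F) (k : ℤ) : Measurable (fcT F k) := by
  unfold fcT
  refine Measurable.const_mul ?_ _
  refine (StronglyMeasurable.integral_prod_right'
    (f := fun z : ℝ × ℝ => F z * Complex.exp (-Complex.I * k * z.2)) ?_).measurable
  exact Measurable.stronglyMeasurable (by fun_prop)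

lemma continuous_fcT {v : ℝ × ℝ → ℂ} (hv : Continuous v) (k : ℤ) : Continuous (fcT v k) := by
  have h : fcT v k = fun t => (1 / (2 * Real.pi) : ℂ) *
      ∫ θ in (0 : ℝ)..(2 * Real.pi), v (t, θ) * Complex.exp (-Complex.I * k * θ) := by
    ext t
    rw [fcT, integral_Ico_eq_integral_Ioc,
      ← intervalIntegral.integral_of_le (by positivity)]
  rw [h]
  refine Continuous.mul continuous_const ?_
  apply intervalIntegral.continuous_parametric_intervalIntegral_of_continuous'
  fun_prop

lemma hasDerivAt_dT {v : ℝ × ℝ → ℂ} (hv : ContDiff ℝ (⊤ : ℕ∞) v) (t θ : ℝ) :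
    HasDerivAt (fun s => v (s, θ)) (dT v (t, θ)) t := by
  have : DifferentiableAt ℝ (fun s => v (s, θ)) t := by
    have := hv.differentiable (by simp)
    fun_prop
  exact this.hasDerivAt

lemma hasDerivAt_dTh {v : ℝ × ℝ → ℂ} (hv : ContDiff ℝ (⊤ : ℕ∞) v) (t θ : ℝ) :
    HasDerivAt (fun s => v (t, s)) (dTh v (t, θ)) θ := by
  have : DifferentiableAt ℝ (fun s => v (t, s)) θ := by
    have := hv.differentiable (by simp)
    fun_prop
  exact this.hasDerivAt

lemma dT_eq_fderiv {v : ℝ × ℝ → ℂ} (hv : ContDiff ℝ (⊤ : ℕ∞) v) (q : ℝ × ℝ) :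
    dT v q = fderiv ℝ v q (1, 0) := by
  have h1 : HasFDerivAt v (fderiv ℝ v q) q := (hv.differentiable (by simp) q).hasFDerivAt
  have h2 : HasDerivAt (fun s : ℝ => (s, q.2)) ((1 : ℝ), (0 : ℝ)) q.1 :=
    (hasDerivAt_id q.1).prodMk (hasDerivAt_const q.1 q.2)
  exact (h1.comp_hasDerivAt q.1 h2).deriv

lemma dTh_eq_fderiv {v : ℝ × ℝ → ℂ} (hv : ContDiff ℝ (⊤ : ℕ∞) v) (q : ℝ × ℝ) :
    dTh v q = fderiv ℝ v q (0, 1) := by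
  have h1 : HasFDerivAt v (fderiv ℝ v q) q := (hv.differentiable (by simp) q).hasFDerivAt
  have h2 : HasDerivAt (fun s : ℝ => (q.1, s)) ((0 : ℝ), (1 : ℝ)) q.2 :=
    (hasDerivAt_const q.2 q.1).prodMk (hasDerivAt_id q.2)
  exact (h1.comp_hasDerivAt q.2 h2).deriv

lemma continuous_dT {v : ℝ × ℝ → ℂ} (hv : ContDiff ℝ (⊤ : ℕ∞) v) : Continuous (dT v) := by
  rw [funext (dT_eq_fderiv hv)]
  have := hv.continuous_fderiv (by simp)
  fun_prop

lemma continuous_dTh {v : ℝ × ℝ → ℂ} (hv : ContDiff ℝ (⊤ : ℕ∞) v) : Continuous (dTh v) := by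
  rw [funext (dTh_eq_fderiv hv)]
  have := hv.continuous_fderiv (by simp)
  fun_prop

lemma measurable_Ltau (τ : ℝ) {v : ℝ × ℝ → ℂ} (hv : ContDiff ℝ (⊤ : ℕ∞) v) :
    Measurable (Ltau τ v) := by
  unfold Ltau
  have h1 := (continuous_dT hv).measurable
  have h2 := (continuous_dTh hv).measurable
  have h3 := hv.continuous.measurable
  fun_prop

lemma hasDerivAt_fcT {v : ℝ × ℝ → ℂ} (hv : ContDiff ℝ (⊤ : ℕ∞) v) (k : ℤ) (t : ℝ) :
    HasDerivAt (fcT v k) (fcT (dT v) k t) t := by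
  have hc := hv.continuous
  have hd := continuous_dT hv
  have hcomp : IsCompact ((Set.Icc (t - 1) (t + 1)) ×ˢ (Set.Icc 0 (2 * Real.pi))) :=
    isCompact_Icc.prod isCompact_Icc
  obtain ⟨B, hB⟩ := hcomp.exists_bound_of_continuousOn (f := fun q : ℝ × ℝ =>
    dT v q * Complex.exp (-Complex.I * k * q.2)) (by fun_prop)
  have h := hasDerivAt_integral_of_dominated_loc_of_deriv_le
    (μ := volume.restrict (Set.Ico 0 (2 * Real.pi))) (x₀ := t) (s := Set.Icc (t - 1) (t + 1))
    (F := fun s θ => v (s, θ) * Complex.exp (-Complex.I * k * θ))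
    (F' := fun s θ => dT v (s, θ) * Complex.exp (-Complex.I * k * θ)) (bound := fun _ => B)
    (Icc_mem_nhds (by linarith) (by linarith))
    (Filter.Eventually.of_forall fun s => by
      apply Continuous.aestronglyMeasurable; fun_prop)
    (by
      apply (Continuous.integrableOn_Icc (a := 0) (b := 2 * Real.pi) _).mono_set
        Set.Ico_subset_Icc_self
      fun_prop)
    (by apply Continuous.aestronglyMeasurable; fun_prop)
    (by
      filter_upwards [ae_restrict_mem measurableSet_Ico] with θ hθ s hs
      exact hB (s, θ) ⟨hs, Set.Ico_subset_Icc_self hθ⟩)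
    (integrable_const _)
    (Filter.Eventually.of_forall fun θ s _ => (hasDerivAt_dT hv s θ).mul_const _)
  exact h.2.const_mul _

lemma fcT_dTh {v : ℝ × ℝ → ℂ} (hv : ContDiff ℝ (⊤ : ℕ∞) v)
    (hper : ∀ t θ : ℝ, v (t, θ + 2 * Real.pi) = v (t, θ)) (k : ℤ) (t : ℝ) :
    fcT (dTh v) k t = Complex.I * k * fcT v k t := by
  have hc := hv.continuous
  have hd := continuous_dTh hv
  have he : ∀ x : ℝ, HasDerivAt (fun θ : ℝ => Complex.exp (-Complex.I * k * θ))
      (-Complex.I * k * Complex.exp (-Complex.I * k * x)) x := by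
    intro x
    have h1 : HasDerivAt (fun θ : ℝ => -Complex.I * k * (θ : ℂ)) (-Complex.I * k) x := by
      simpa using (Complex.ofRealCLM.hasDerivAt (x := x)).const_mul (-Complex.I * k)
    simpa [mul_comm] using h1.cexp
  have h := intervalIntegral.integral_mul_deriv_eq_deriv_mul (a := 0) (b := 2 * Real.pi)
    (u := fun θ : ℝ => Complex.exp (-Complex.I * k * θ)) (v := fun θ => v (t, θ))
    (fun x _ => he x) (fun x _ => hasDerivAt_dTh hv t x)
    (by apply Continuous.intervalIntegrable; fun_prop)
    (by apply Continuous.intervalIntegrable; fun_prop)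
  have hend : Complex.exp (-Complex.I * k * ((2 * Real.pi : ℝ) : ℂ)) = 1 := by
    rw [Complex.exp_eq_one_iff]
    exact ⟨-k, by push_cast; ring⟩
  have hv0 : v (t, 2 * Real.pi) = v (t, 0) := by simpa using hper t 0
  rw [hend, hv0] at h
  simp only [fcT, integral_Ico_eq_integral_Ioc]
  rw [← intervalIntegral.integral_of_le (by positivity),
    ← intervalIntegral.integral_of_le (by positivity)]
  have h' : ∫ θ in (0 : ℝ)..(2 * Real.pi), dTh v (t, θ) * Complex.exp (-Complex.I * k * θ) =
      Complex.I * k * ∫ θ in (0 : ℝ)..(2 * Real.pi), v (t, θ) * Complex.exp (-Complex.I * k * θ) := by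
    rw [← intervalIntegral.integral_const_mul]
    calc _ = ∫ θ in (0 : ℝ)..(2 * Real.pi), Complex.exp (-Complex.I * k * θ) * dTh v (t, θ) := by
          simp only [mul_comm]
      _ = _ := by
          rw [h]
          simp only [Complex.ofReal_zero, mul_zero, Complex.exp_zero, sub_self, zero_sub,
            ← intervalIntegral.integral_neg]
          congr 1 with θ
          ring
  rw [h']
  ring

lemma fcT_Ltau (τ : ℝ) {v : ℝ × ℝ → ℂ} (hv : ContDiff ℝ (⊤ : ℕ∞) v)
    (hper : ∀ t θ : ℝ, v (t, θ + 2 * Real.pi) = v (t, θ)) (k : ℤ) (t : ℝ) :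
    fcT (Ltau τ v) k t =
      fcT (dT v) k t - ((k - τ * (1 + 1 / t) : ℝ) : ℂ) * fcT v k t := by
  have hc := hv.continuous
  have hd := continuous_dTh hv
  have hd' := continuous_dT hv
  have hint : ∀ u : ℝ × ℝ → ℂ, Continuous u →
      IntegrableOn (fun θ : ℝ => u (t, θ) * Complex.exp (-Complex.I * k * θ))
        (Set.Ico 0 (2 * Real.pi)) := by
    intro u hu
    apply (Continuous.integrableOn_Icc (a := 0) (b := 2 * Real.pi) _).mono_set
        Set.Ico_subset_Icc_self
    fun_prop
  have h : fcT (Ltau τ v) k t = fcT (dT v) k t + Complex.I * fcT (dTh v) k t +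
      ((τ * (1 + 1 / t) : ℝ) : ℂ) * fcT v k t := by
    have e : ∀ θ : ℝ, Ltau τ v (t, θ) * Complex.exp (-Complex.I * k * θ) =
        dT v (t, θ) * Complex.exp (-Complex.I * k * θ) +
        Complex.I * (dTh v (t, θ) * Complex.exp (-Complex.I * k * θ)) +
        ((τ * (1 + 1 / t) : ℝ) : ℂ) * (v (t, θ) * Complex.exp (-Complex.I * k * θ)) := by
      intro θ
      simp only [Ltau]
      ring
    have i1 := hint _ hd'
    have i2 := (hint _ hd).const_mul Complex.I
    have i3 := (hint _ hc).const_mul ((τ * (1 + 1 / t) : ℝ) : ℂ)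
    simp only [fcT, e]
    rw [integral_add (f := fun θ : ℝ => dT v (t, θ) * Complex.exp (-Complex.I * k * θ) +
        Complex.I * (dTh v (t, θ) * Complex.exp (-Complex.I * k * θ))) (i1.add i2) i3,
      integral_add i1 i2, integral_const_mul, integral_const_mul]
    ring
  rw [h, fcT_dTh hv hper]
  push_cast
  linear_combination (k * fcT v k t) * Complex.I_mul_I

lemma enorm_fcT_le {τ : ℝ} (hτ : 0 < τ) {v : ℝ × ℝ → ℂ} (hv : ContDiff ℝ (⊤ : ℕ∞) v)
    (hper : ∀ t θ : ℝ, v (t, θ + 2 * Real.pi) = v (t, θ))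
    (hsupp : ∀ q : ℝ × ℝ, v q ≠ 0 → q.1 < -1) (k : ℤ) (t : ℝ) :
    ‖fcT v k t‖ₑ ≤ ∫⁻ s, expKernel (k - τ) (s - t) * ‖fcT (Ltau τ v) k s‖ₑ := by
  have hvan : ∀ s, -1 ≤ s → fcT v k s = 0 := by
    intro s hs
    have : ∀ θ, v (s, θ) = 0 := fun θ => by
      by_contra h
      exact absurd (hsupp _ h) (not_lt.2 hs)
    simp [fcT, this]
  rcases le_or_gt (-1) t with ht | ht
  · simp [hvan t ht]
  set F := fcT (Ltau τ v) k with hF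
  -- the integrating factor, normalised at `t`
  let E : ℝ → ℝ := fun s => Real.exp (-(k - τ) * (s - t)) * (s / t) ^ τ
  have hquot : ∀ s ∈ Set.Icc t (-1), 0 < s / t := fun s hs =>
    div_pos_of_neg_of_neg (by linarith [hs.2]) (by linarith)
  have hE : ∀ s ∈ Set.Icc t (-1), HasDerivAt E (-(k - τ * (1 + 1 / s)) * E s) s := by
    intro s hs
    have hs0 : s ≠ 0 := by linarith [hs.2]
    have ht0 : t ≠ 0 := by linarith
    have hq := hquot s hs
    have h1 : HasDerivAt (fun s : ℝ => Real.exp (-(k - τ) * (s - t)))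
        (Real.exp (-(k - τ) * (s - t)) * (-(k - τ))) s := by
      have := (((hasDerivAt_id s).sub_const t).const_mul (-((k : ℝ) - τ))).exp
      simpa using this
    have h2 : HasDerivAt (fun s : ℝ => (s / t) ^ τ) (1 / t * τ * (s / t) ^ (τ - 1)) s :=
      ((hasDerivAt_id s).div_const t).rpow_const (Or.inl hq.ne')
    refine (h1.mul h2).congr_deriv ?_
    simp only [E]
    rw [Real.rpow_sub_one hq.ne']
    field_simp
    ring
  have hEc : ContinuousOn E (Set.Icc t (-1)) := fun s hs => (hE s hs).continuousAt.continuousWithinAt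
  have hG : ∀ s ∈ Set.uIcc t (-1),
      HasDerivAt (fun s => (E s : ℂ) * fcT v k s) ((E s : ℂ) * F s) s := by
    intro s hs
    rw [Set.uIcc_of_le ht.le] at hs
    refine ((hE s hs).ofReal_comp.mul (hasDerivAt_fcT hv k s)).congr_deriv ?_
    rw [hF, fcT_Ltau τ hv hper]
    push_cast
    ring
  have hFc : ContinuousOn F (Set.Icc t (-1)) := by
    have h1 := continuous_fcT (continuous_dT hv) k
    have h2 := continuous_fcT hv.continuous k
    have h3 : ContinuousOn (fun s : ℝ => ((k - τ * (1 + 1 / s) : ℝ) : ℂ)) (Set.Icc t (-1)) := by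
      refine Complex.continuous_ofReal.comp_continuousOn ?_
      have : ContinuousOn (fun s : ℝ => 1 / s) (Set.Icc t (-1)) :=
        continuousOn_const.div continuousOn_id fun s hs => by
          have := hs.2
          linarith
      fun_prop
    refine (h1.continuousOn.sub (h3.mul h2.continuousOn)).congr fun s _ => fcT_Ltau τ hv hper k s
  have hint := intervalIntegral.integral_eq_sub_of_hasDerivAt hG (by
    apply ContinuousOn.intervalIntegrable
    rw [Set.uIcc_of_le ht.le]
    exact (Complex.continuous_ofReal.comp_continuousOn hEc).mul hFc)
  have hEt : E t = 1 := by
    simp [E, div_self (show t ≠ 0 by linarith)]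
  rw [hvan (-1) le_rfl, hEt, mul_zero, zero_sub, Complex.ofReal_one, one_mul,
    intervalIntegral.integral_of_le ht.le] at hint
  rw [← enorm_neg, ← hint]
  refine (enorm_integral_le_lintegral_enorm _).trans ?_
  refine le_trans ?_ (setLIntegral_le_lintegral (Set.Ioc t (-1)) _)
  refine setLIntegral_mono' measurableSet_Ioc fun s hs => ?_
  rw [enorm_mul]
  gcongr
  have hs' : s ∈ Set.Icc t (-1) := ⟨hs.1.le, hs.2⟩
  have hst : s - t ∈ Set.Ici (0 : ℝ) := sub_nonneg.2 hs.1.le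
  rw [expKernel, Set.indicator_of_mem hst, ← ofReal_norm, Complex.norm_real]
  apply ENNReal.ofReal_le_ofReal
  have hq := hquot s hs'
  rw [Real.norm_of_nonneg (by positivity)]
  refine mul_le_of_le_one_right (Real.exp_pos _).le (Real.rpow_le_one hq.le ?_ hτ.le)
  rw [div_le_one_of_neg (by linarith)]
  exact hs'.1

lemma integral_exp_I_int_mul (m : ℤ) :
    ∫ θ in (0 : ℝ)..(2 * Real.pi), Complex.exp (Complex.I * m * θ) =
      if m = 0 then ((2 * Real.pi : ℝ) : ℂ) else 0 := by
  split_ifs with h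
  · simp [h]
  · rw [integral_exp_mul_complex (by simp [h])]
    have : Complex.exp (Complex.I * m * ((2 * Real.pi : ℝ) : ℂ)) = 1 := by
      rw [Complex.exp_eq_one_iff]
      exact ⟨m, by push_cast; ring⟩
    rw [this]
    simp

lemma lintegral_enorm_trigSum_sq {ι : Type*} (s : Finset ι) {m : ι → ℤ}
    (hm : Function.Injective m) (c : ι → ℂ) :
    ∫⁻ θ in Set.Ico (0 : ℝ) (2 * Real.pi),
      ‖∑ j ∈ s, c j * Complex.exp (Complex.I * m j * θ)‖ₑ ^ (2 : ℝ) =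
      ENNReal.ofReal (2 * Real.pi) * ∑ j ∈ s, ‖c j‖ₑ ^ (2 : ℝ) := by
  classical
  have hen : ∀ z : ℂ, ‖z‖ₑ ^ (2 : ℝ) = ENNReal.ofReal (‖z‖ ^ 2) := fun z => by
    rw [← ofReal_norm, ENNReal.ofReal_rpow_of_nonneg (norm_nonneg _) zero_le_two, Real.rpow_two]
  simp only [hen]
  rw [← ENNReal.ofReal_sum_of_nonneg (fun _ _ => by positivity),
    ← ENNReal.ofReal_mul (by positivity), ← ofReal_integral_eq_lintegral_ofReal]
  rotate_left
  · apply (Continuous.integrableOn_Icc (a := 0) (b := 2 * Real.pi) _).mono_set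
      Set.Ico_subset_Icc_self
    fun_prop
  · exact Filter.Eventually.of_forall fun θ => by positivity
  congr 1
  rw [integral_Ico_eq_integral_Ioc, ← intervalIntegral.integral_of_le (by positivity)]
  apply Complex.ofReal_injective
  rw [← intervalIntegral.integral_ofReal]
  have hexp : ∀ θ : ℝ, ((‖∑ j ∈ s, c j * Complex.exp (Complex.I * m j * θ)‖ ^ 2 : ℝ) : ℂ) =
      ∑ j ∈ s, ∑ l ∈ s, (c j * (starRingEnd ℂ) (c l)) *
        Complex.exp (Complex.I * ((m j - m l : ℤ) : ℂ) * θ) := by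
    intro θ
    rw [Complex.ofReal_pow, ← Complex.mul_conj', map_sum, Finset.sum_mul_sum]
    refine Finset.sum_congr rfl fun j _ => Finset.sum_congr rfl fun l _ => ?_
    rw [map_mul, ← Complex.exp_conj, mul_mul_mul_comm, ← Complex.exp_add]
    congr 2
    simp only [map_mul, Complex.conj_I, Complex.conj_ofReal, map_intCast]
    push_cast
    ring
  simp only [hexp]
  rw [intervalIntegral.integral_finsetSum
    (fun j _ => Continuous.intervalIntegrable (by fun_prop) _ _)]
  have hin : ∀ j ∈ s, ∫ θ in (0 : ℝ)..(2 * Real.pi), ∑ l ∈ s, (c j * (starRingEnd ℂ) (c l)) *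
        Complex.exp (Complex.I * ((m j - m l : ℤ) : ℂ) * θ) =
      ((2 * Real.pi : ℝ) : ℂ) * ((‖c j‖ ^ 2 : ℝ) : ℂ) := by
    intro j hj
    rw [intervalIntegral.integral_finsetSum
      (fun l _ => Continuous.intervalIntegrable (by fun_prop) _ _)]
    simp only [intervalIntegral.integral_const_mul, integral_exp_I_int_mul, sub_eq_zero,
      hm.eq_iff, mul_ite, mul_zero]
    rw [Finset.sum_ite_eq, if_pos hj, Complex.mul_conj']
    push_cast
    ring
  rw [Finset.sum_congr rfl hin]
  push_cast
  rw [Finset.mul_sum]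

lemma Ph_eq_tsum_nat (τ : ℝ) (v : ℝ × ℝ → ℂ) (q : ℝ × ℝ) :
    Ph τ v q = ∑' j : ℕ, Pk v (⌈2 * τ⌉ + 1 + j) q := by
  have hinj : Function.Injective fun j : ℕ => ⌈2 * τ⌉ + 1 + (j : ℤ) := fun a b h => by
    simpa using h
  rw [Ph, ← hinj.tsum_eq]
  · refine tsum_congr fun j => if_pos ?_
    omega
  · intro k hk
    have hk' : ⌈2 * τ⌉ < k := by
      by_contra h
      exact hk (if_neg h)
    exact ⟨(k - (⌈2 * τ⌉ + 1)).toNat, by simp only; omega⟩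

/-- A lower-semicontinuity bound for a series in terms of its partial sums; it holds trivially
where the series diverges. -/
lemma enorm_tsum_rpow_le_liminf (f : ℕ → ℂ) :
    ‖∑' j, f j‖ₑ ^ (2 : ℝ) ≤
      Filter.liminf (fun n => ‖∑ j ∈ Finset.range n, f j‖ₑ ^ (2 : ℝ)) Filter.atTop := by
  by_cases h : Summable f
  · have := h.hasSum.tendsto_sum_nat
    exact (((ENNReal.continuous_rpow_const (y := 2)).tendsto _).comp this.enorm).liminf_eq.ge
  · rw [tsum_eq_zero_of_not_summable h]
    simp

lemma lintegral_enorm_Ph_le (τ : ℝ) {v : ℝ × ℝ → ℂ} (hv : Continuous v) {B : ℝ≥0∞}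
    (hB : ∀ n, ∑ j ∈ Finset.range n, ∫⁻ t, ‖fcT v (⌈2 * τ⌉ + 1 + (j : ℕ)) t‖ₑ ^ (2 : ℝ) ≤ B) :
    ∫⁻ q in stripe, ‖Ph τ v q‖ₑ ^ (2 : ℝ) ≤ ENNReal.ofReal (2 * Real.pi) * B := by
  have hc := fun k => continuous_fcT hv k
  have hPk : ∀ k, Continuous (Pk v k) := fun k => by
    unfold Pk
    fun_prop
  have hS : ∀ n : ℕ, Measurable fun q =>
      ‖∑ j ∈ Finset.range n, Pk v (⌈2 * τ⌉ + 1 + (j : ℕ)) q‖ₑ ^ (2 : ℝ) := fun n => by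
    have : Continuous fun q => ∑ j ∈ Finset.range n, Pk v (⌈2 * τ⌉ + 1 + (j : ℕ)) q := by
      fun_prop
    exact this.measurable.enorm.pow_const _
  have hinj : Function.Injective fun j : ℕ => ⌈2 * τ⌉ + 1 + (j : ℤ) := fun a b h => by
    simpa using h
  simp only [Ph_eq_tsum_nat]
  refine (lintegral_mono fun q => enorm_tsum_rpow_le_liminf _).trans ?_
  refine (lintegral_liminf_le hS).trans ?_
  refine Filter.liminf_le_of_frequently_le' (Filter.Frequently.of_forall fun n => ?_)
  rw [lintegral_stripe (hS n)]
  calc _ = ∫⁻ t, ENNReal.ofReal (2 * Real.pi) *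
        ∑ j ∈ Finset.range n, ‖fcT v (⌈2 * τ⌉ + 1 + (j : ℕ)) t‖ₑ ^ (2 : ℝ) := by
        congr 1 with t
        exact lintegral_enorm_trigSum_sq (Finset.range n) hinj
          fun j => fcT v (⌈2 * τ⌉ + 1 + (j : ℕ)) t
    _ ≤ _ := by
        have hm : ∀ k, Measurable fun t => ‖fcT v k t‖ₑ ^ (2 : ℝ) := fun k =>
          (hc k).measurable.enorm.pow_const _
        rw [lintegral_const_mul _ (by fun_prop), lintegral_finsetSum _ (fun j _ => hm _)]
        gcongr
        exact hB n

lemma sum_rpow_le {τ a : ℝ} (hτ : 0 < τ) (ha : 1 < a) (n : ℕ) :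
    ∑ j ∈ Finset.range n, (τ + (j + 1 : ℕ)) ^ (-a) ≤ τ ^ (1 - a) / (a - 1) := by
  have hanti : AntitoneOn (fun x : ℝ => x ^ (-a)) (Set.Icc τ (τ + n)) := by
    intro x hx y hy hxy
    exact Real.rpow_le_rpow_of_nonpos (hτ.trans_le hx.1) hxy (by linarith)
  refine hanti.sum_le_integral.trans ?_
  rw [integral_rpow (Or.inr ⟨by linarith, by
    rw [Set.uIcc_of_le (by simp)]
    exact fun h => absurd h.1 (not_le.2 hτ)⟩)]
  have e : -a + 1 = -(a - 1) := by ring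
  have h1 : 0 ≤ (τ + n) ^ (-(a - 1)) := by positivity
  rw [e, show 1 - a = -(a - 1) by ring, div_neg, ← neg_div]
  have : 0 < a - 1 := by linarith
  gcongr
  linarith

/-- The bound for the high-frequency part in the Carleman estimate. -/
theorem statement15 (p : ℝ) (hp1 : 1 < p) (hp2 : p ≤ 2) :
    ∃ t₀ < (0 : ℝ), ∃ τ₀ > (0 : ℝ), ∃ C > (0 : ℝ),
      ∀ τ : ℝ, τ₀ ≤ τ →
      ∀ v : ℝ × ℝ → ℂ, ContDiff ℝ (⊤ : ℕ∞) v →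
        (∀ t θ : ℝ, v (t, θ + 2 * Real.pi) = v (t, θ)) →
        (∃ a : ℝ, ∀ q : ℝ × ℝ, v q ≠ 0 → a < q.1 ∧ q.1 < t₀) →
        eLpNorm (Ph τ v) 2 (volume.restrict stripe) ≤
          ENNReal.ofReal (C * τ ^ (-1 + 1 / p)) *
            eLpNorm (Ltau τ v) (ENNReal.ofReal p) (volume.restrict stripe) := by
  have hp0 : 0 < p := by linarith
  set b : ℝ := 3 - 2 / p with hb
  have hb1 : 1 < b := by
    have : 2 / p < 2 := by rw [div_lt_iff₀ hp0]; linarith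
    linarith
  have hb0 : 0 < b - 1 := by linarith
  refine ⟨-1, by norm_num, 1, one_pos, (2 * Real.pi / (b - 1)) ^ (1 / 2 : ℝ), by positivity, ?_⟩
  rintro τ hτ1 v hv hper ⟨a, hsupp⟩
  have hτ : 0 < τ := by linarith
  set M := ∫⁻ q in stripe, ‖Ltau τ v q‖ₑ ^ p with hM
  have hmode : ∀ j : ℕ, ∫⁻ t, ‖fcT v (⌈2 * τ⌉ + 1 + (j : ℕ)) t‖ₑ ^ (2 : ℝ) ≤
      ENNReal.ofReal ((τ + (j + 1 : ℕ)) ^ (-b)) * M ^ (2 / p) := by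
    intro j
    set k : ℤ := ⌈2 * τ⌉ + 1 + (j : ℕ) with hk
    have hkτ : τ + (j + 1 : ℕ) ≤ k - τ := by
      have := Int.le_ceil (2 * τ)
      rw [hk]; push_cast; linarith
    have hl : 0 < (k : ℝ) - τ := lt_of_lt_of_le (by positivity) hkτ
    refine (lintegral_sq_le_of_le_expKernel hp1 hp2 hl
      (measurable_fcT (measurable_Ltau τ hv) k).enorm
      (enorm_fcT_le hτ hv hper (fun q hq => (hsupp q hq).2) k)).trans ?_
    gcongr ENNReal.ofReal ?_ * ?_ ^ _
    · rw [show 2 / p - 3 = -b by ring]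
      exact Real.rpow_le_rpow_of_nonpos (by positivity) hkτ (by linarith)
    · exact lintegral_enorm_fcT_rpow_le hp1 (measurable_Ltau τ hv) k
  have hsum : ∀ n, ∑ j ∈ Finset.range n, ∫⁻ t, ‖fcT v (⌈2 * τ⌉ + 1 + (j : ℕ)) t‖ₑ ^ (2 : ℝ) ≤
      ENNReal.ofReal (τ ^ (1 - b) / (b - 1)) * M ^ (2 / p) := by
    intro n
    refine (Finset.sum_le_sum fun j _ => hmode j).trans ?_
    rw [← Finset.sum_mul, ← ENNReal.ofReal_sum_of_nonneg fun _ _ => by positivity]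
    gcongr
    exact sum_rpow_le hτ hb1 n
  have hmain := lintegral_enorm_Ph_le τ hv.continuous hsum
  rw [eLpNorm_eq_lintegral_rpow_enorm_toReal two_ne_zero ENNReal.ofNat_ne_top,
    eLpNorm_eq_lintegral_rpow_enorm_toReal (ENNReal.ofReal_pos.2 hp0).ne' ENNReal.ofReal_ne_top,
    ENNReal.toReal_ofReal hp0.le, ENNReal.toReal_ofNat]
  refine (ENNReal.rpow_le_rpow hmain (by norm_num)).trans_eq ?_
  rw [← mul_assoc, ← ENNReal.ofReal_mul (by positivity),
    ENNReal.mul_rpow_of_nonneg _ _ (by norm_num), ← ENNReal.rpow_mul,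
    ENNReal.ofReal_rpow_of_nonneg (by positivity) (by norm_num)]
  congr 2
  · rw [← mul_div_assoc, mul_div_right_comm, Real.mul_rpow (by positivity) (by positivity),
      ← Real.rpow_mul hτ.le]
    congr 2
    rw [hb]; ring
  · ring

end
end
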